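/- (The rescaled cross-section is asymptotically a unit disc, and the flux constant satisfies an asymptotic identity.) For every κ, W, δ₀, m₀ > 0 and every η > 0 there exist ε₀ > 0 and d₀ > 0 such that: whenever ε ∈ (0, ε₀] and ψ is a centralized stream function of a steady vortex ring with parameters (ε, W, μ), μ ≥ m₀, whose circulation equals κ and whose cross-section A is simply connected, contained in {x : δ₀ ≤ x₁ ≤ 1/δ₀}, and of diameter at most d₀, and p = (p₁, 0) ∈ A is a point at which ψ attains its maximum over the closure of A, then, with σ := (1/2)·diam A, one has both | |A|/σ² − π | ≤ η (|A| the Lebesgue measure of A) and | (κ p₁/(2π)) ln(2 p₁/σ) + (κ/p₁) H_{p₁}(p, p) − (W/2) p₁² ln(1/ε) − μ | ≤ η. -/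

import Mathlib

open MeasureTheory Real Filter
open scoped RealInnerProductSpace

noncomputable section

/-- The plane `ℝ²` with the Euclidean norm. -/
abbrev Plane : Type := EuclideanSpace ℝ (Fin 2)

/-- The point `(a, b)` of the plane. -/
def mk2 (a b : ℝ) : Plane := (WithLp.equiv 2 (Fin 2 → ℝ)).symm ![a, b]

/-- The open right half plane `Π = {x : x₁ > 0}`. -/
def halfPlane : Set Plane := {x : Plane | 0 < x 0}

/-- The reflection `x̄ = (−x₁, x₂)` of a point `x = (x₁, x₂)`. -/
def reflPt (x : Plane) : Plane := mk2 (-(x 0)) (x 1)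

/-- The Green function `G_*` on the half plane of the operator `−(1/x₁)div((1/x₁)∇)`. -/
def Gstar (x x' : Plane) : ℝ :=
  x 0 * (x' 0) ^ 2 / (4 * π) *
    ∫ θ in (-π)..π, Real.cos θ /
      Real.sqrt ((x 1 - x' 1) ^ 2 + (x 0) ^ 2 + (x' 0) ^ 2 - 2 * x 0 * x' 0 * Real.cos θ)

/-- The Green function of `−Δ` on the half plane. -/
def Gfun (x x' : Plane) : ℝ :=
  (1 / (4 * π)) * Real.log
    (((x 0 + x' 0) ^ 2 + (x 1 - x' 1) ^ 2) / ((x 0 - x' 0) ^ 2 + (x 1 - x' 1) ^ 2))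

/-- The regular part `H_c(x,x') = G_*(x,x') − c² G(x,x')`. -/
def Hker (c : ℝ) (x x' : Plane) : ℝ := Gstar x x' - c ^ 2 * Gfun x x'

/-- The regular part `H_c`, extended continuously to the diagonal. -/
def HkerExt (c : ℝ) (x x' : Plane) : ℝ := by
  classical
  exact if x = x' then limUnder (nhdsWithin x' {x'}ᶜ) (fun y => Hker c y x')
    else Hker c x x'

/-- The cross-section `A = {x ∈ Π : ψ(x) − (W/2) x₁² ln(1/ε) > μ}`. -/
def crossSection (ψ : Plane → ℝ) (ε W μ : ℝ) : Set Plane :=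
  {x : Plane | x ∈ halfPlane ∧ μ < ψ x - W / 2 * (x 0) ^ 2 * Real.log (1 / ε)}

/-- `ψ` is a stream function of a steady vortex ring with parameters `(ε, W, μ)`. -/
structure IsVortexRingStream (ψ : Plane → ℝ) (ε W μ : ℝ) : Prop where
  continuousOn : ContinuousOn ψ halfPlane
  bounded : Bornology.IsBounded (crossSection ψ ε W μ)
  closure_subset : closure (crossSection ψ ε W μ) ⊆ halfPlane
  repr : ∀ x ∈ halfPlane, ψ x = (∫ x' in crossSection ψ ε W μ, Gstar x x') / ε ^ 2

/-- The circulation `ε⁻² ∫_A x₁ dx` of a vortex ring. -/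
def circulation (ψ : Plane → ℝ) (ε W μ : ℝ) : ℝ :=
  (∫ x in crossSection ψ ε W μ, x 0) / ε ^ 2

/-- `ψ` is centralized: it is even in the second variable. -/
def Centralized (ψ : Plane → ℝ) : Prop :=
  ∀ a b : ℝ, ψ (mk2 a (-b)) = ψ (mk2 a b)

theorem integrableOn_inv_norm_ball (x : Plane) (r : ℝ) :
    IntegrableOn (fun y : Plane => ‖x - y‖⁻¹) (Metric.ball x r) ∧
      ∫ y in Metric.ball x r, ‖x - y‖⁻¹ ≤ 2 * π * |r| := by
  have key : (Metric.ball x r).indicator (fun y : Plane => ‖x - y‖⁻¹)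
      = fun y => (Set.Iio r).indicator (fun s => s⁻¹) ‖y - x‖ := by
    funext y
    by_cases h : ‖y - x‖ < r
    · rw [Set.indicator_of_mem (by simpa [dist_eq_norm] using h),
        Set.indicator_of_mem (by simpa using h), norm_sub_rev]
    · rw [Set.indicator_of_notMem (by simpa [dist_eq_norm] using h),
        Set.indicator_of_notMem (by simpa using h)]
  have h1 : ∀ y ∈ Set.Ioi (0 : ℝ), y ^ (Module.finrank ℝ Plane - 1) •
      (Set.Iio r).indicator (fun s => s⁻¹) y = (Set.Iio r).indicator (fun _ => (1 : ℝ)) y := by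
    intro y hy
    have hy' : y ≠ 0 := ne_of_gt hy
    by_cases h : y < r
    · simp [Set.indicator, h, hy']
    · simp [Set.indicator, h]
  have h2 : IntegrableOn (fun y : ℝ => (Set.Iio r).indicator (fun _ => (1 : ℝ)) y)
      (Set.Ioi 0) := by
    rw [IntegrableOn, integrable_indicator_iff measurableSet_Iio, IntegrableOn,
      Measure.restrict_restrict measurableSet_Iio]
    refine integrable_const_iff.2 (Or.inr ?_)
    rw [isFiniteMeasure_restrict, Set.inter_comm, Set.Ioi_inter_Iio]
    simp
  constructor
  · rw [← integrable_indicator_iff Metric.isOpen_ball.measurableSet, key]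
    have : Integrable (fun y : Plane => (Set.Iio r).indicator (fun s => s⁻¹) ‖y‖) := by
      rw [integrable_fun_norm_addHaar]
      exact h2.congr_fun (fun y hy => (h1 y hy).symm) measurableSet_Ioi
    exact this.comp_sub_right x
  · rw [← integral_indicator Metric.isOpen_ball.measurableSet, key,
      integral_sub_right_eq_self (fun y : Plane => (Set.Iio r).indicator (fun s => s⁻¹) ‖y‖) x,
      integral_fun_norm_addHaar, setIntegral_congr_fun measurableSet_Ioi h1,
      integral_indicator measurableSet_Iio, Measure.restrict_restrict measurableSet_Iio,
      Set.inter_comm, Set.Ioi_inter_Iio]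
    simp only [integral_const, measureReal_restrict_apply_univ, smul_eq_mul, mul_one, nsmul_eq_mul]
    have hv : volume.real (Metric.ball (0 : Plane) 1) = π := by
      simp [Measure.real, EuclideanSpace.volume_ball_fin_two, pi_nonneg]
    rw [hv]
    simp only [finrank_euclideanSpace, Fintype.card_fin, Real.volume_real_Ioo, sub_zero]
    have : max r 0 ≤ |r| := max_le (le_abs_self r) (abs_nonneg r)
    push_cast
    nlinarith [pi_pos, mul_le_mul_of_nonneg_left this pi_pos.le]

theorem integrableOn_inv_norm {S : Set Plane} (hS : MeasurableSet S) (hfin : volume S ≠ ⊤)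
    (x : Plane) : IntegrableOn (fun y : Plane => ‖x - y‖⁻¹) S := by
  have h1 : IntegrableOn (fun y : Plane => ‖x - y‖⁻¹) (S ∩ Metric.ball x 1) :=
    (integrableOn_inv_norm_ball x 1).1.mono_set Set.inter_subset_right
  have h2 : IntegrableOn (fun y : Plane => ‖x - y‖⁻¹) (S \ Metric.ball x 1) := by
    have hf : volume (S \ Metric.ball x 1) ≠ ⊤ :=
      measure_ne_top_of_subset Set.sdiff_subset hfin
    refine Measure.integrableOn_of_bounded (M := 1) hf
      (by fun_prop) ?_
    refine (ae_restrict_iff' (hS.diff Metric.isOpen_ball.measurableSet)).2 (ae_of_all _ ?_)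
    intro y hy
    have : 1 ≤ ‖x - y‖ := by
      have := hy.2
      rw [Metric.mem_ball, dist_comm, dist_eq_norm] at this
      linarith
    rw [norm_inv, norm_norm]
    exact inv_le_one_of_one_le₀ this
  have := h1.union h2
  rwa [Set.inter_union_sdiff] at this

theorem setIntegral_inv_norm_le {S : Set Plane} (hS : MeasurableSet S) (hfin : volume S ≠ ⊤)
    (x : Plane) {r : ℝ} (hr : 0 < r) :
    ∫ y in S, ‖x - y‖⁻¹ ≤ 2 * π * r + volume.real S / r := by
  have hi := integrableOn_inv_norm hS hfin x
  have hb := integrableOn_inv_norm_ball x r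
  rw [abs_of_pos hr] at hb
  have hcov : IntegrableOn (fun y => (Metric.ball x r).indicator (fun y => ‖x - y‖⁻¹) y + r⁻¹) S := by
    refine Integrable.add ?_ (integrableOn_const hfin)
    exact ((integrable_indicator_iff Metric.isOpen_ball.measurableSet).2 hb.1).integrableOn
  calc ∫ y in S, ‖x - y‖⁻¹
      ≤ ∫ y in S, ((Metric.ball x r).indicator (fun y => ‖x - y‖⁻¹) y + r⁻¹) := by
        refine setIntegral_mono hi hcov ?_
        intro y
        by_cases h : y ∈ Metric.ball x r
        · simp only [Set.indicator_of_mem h]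
          have : 0 < r⁻¹ := inv_pos.2 hr
          linarith
        · simp only [Set.indicator_of_notMem h, zero_add]
          rw [Metric.mem_ball, dist_comm, dist_eq_norm, not_lt] at h
          exact inv_anti₀ hr h
    _ = (∫ y in S, (Metric.ball x r).indicator (fun y => ‖x - y‖⁻¹) y) + volume.real S / r := by
        rw [integral_add ((integrable_indicator_iff Metric.isOpen_ball.measurableSet).2
          hb.1).integrableOn (integrableOn_const hfin)]
        simp [div_eq_mul_inv]
    _ ≤ _ := by
        gcongr
        refine le_trans (setIntegral_le_integral
          ((integrable_indicator_iff Metric.isOpen_ball.measurableSet).2 hb.1) ?_) ?_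
        · exact ae_of_all _ fun y => Set.indicator_nonneg (fun _ _ => by positivity) y
        · rw [integral_indicator Metric.isOpen_ball.measurableSet]
          exact hb.2

theorem abs_log_le_inv_add {r : ℝ} (hr : 0 ≤ r) : |log r| ≤ r⁻¹ + r := by
  rcases hr.eq_or_lt with rfl | hr
  · simp
  · have h1 := log_le_sub_one_of_pos hr
    have h2 := log_le_sub_one_of_pos (inv_pos.2 hr)
    rw [log_inv] at h2
    have := inv_pos.2 hr
    rw [abs_le]
    constructor <;> linarith

theorem abs_log_sub_log_le {r s : ℝ} (hr : 0 < r) (hs : 0 < s) :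
    |log r - log s| ≤ |r - s| * (r⁻¹ + s⁻¹) := by
  have key : ∀ {r s : ℝ}, 0 < r → 0 < s → log r - log s ≤ |r - s| * (r⁻¹ + s⁻¹) := by
    intro r s hr hs
    have h1 := log_le_sub_one_of_pos (div_pos hr hs)
    rw [log_div hr.ne' hs.ne'] at h1
    have h2 : r / s - 1 = (r - s) * s⁻¹ := by field_simp
    have h3 : (r - s) * s⁻¹ ≤ |r - s| * s⁻¹ :=
      mul_le_mul_of_nonneg_right (le_abs_self _) (inv_pos.2 hs).le
    have h4 : 0 ≤ |r - s| * r⁻¹ := by positivity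
    rw [mul_add]; linarith
  rw [abs_le]
  have h1 := key hr hs
  have h2 := key hs hr
  rw [abs_sub_comm, add_comm] at h2
  constructor <;> linarith

/-- The difference between the regularised logarithm `log (r² + a²) / 2` and `log r`. -/
def regGap (a r : ℝ) : ℝ := log (r ^ 2 + a ^ 2) / 2 - log r

theorem regGap_nonneg (a : ℝ) {r : ℝ} (hr : 0 < r) : 0 ≤ regGap a r := by
  have h : log (r ^ 2) ≤ log (r ^ 2 + a ^ 2) := log_le_log (by positivity) (by nlinarith [sq_nonneg a])
  rw [log_pow] at h
  unfold regGap
  push_cast at h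
  linarith

theorem regGap_le {a : ℝ} (ha : 0 ≤ a) {r : ℝ} (hr : 0 < r) : regGap a r ≤ a * r⁻¹ := by
  have h : log (r ^ 2 + a ^ 2) ≤ log ((r + a) ^ 2) :=
    log_le_log (by positivity) (by nlinarith [mul_nonneg ha hr.le])
  rw [log_pow] at h
  have h1 := log_le_sub_one_of_pos (div_pos (add_pos_of_pos_of_nonneg hr ha) hr)
  rw [log_div (by positivity) hr.ne'] at h1
  have h2 : (r + a) / r - 1 = a * r⁻¹ := by field_simp; ring
  unfold regGap
  push_cast at h
  linarith

/-- The Lipschitz majorant of `regGap`. -/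
def gapSlope (a r : ℝ) : ℝ := a ^ 2 / (r * (r ^ 2 + a ^ 2))

theorem gapSlope_nonneg (a : ℝ) {r : ℝ} (hr : 0 ≤ r) : 0 ≤ gapSlope a r := by
  unfold gapSlope; positivity

theorem hasDerivAt_regGap {a r : ℝ} (hr : 0 < r) : HasDerivAt (regGap a) (-gapSlope a r) r := by
  have h1 : HasDerivAt (fun r : ℝ => r ^ 2 + a ^ 2) (2 * r) r := by
    simpa using (hasDerivAt_pow 2 r).add_const (a ^ 2)
  have h2 := ((h1.log (by positivity)).div_const 2).sub (hasDerivAt_log hr.ne')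
  have h3 : -gapSlope a r = 2 * r / (r ^ 2 + a ^ 2) / 2 - r⁻¹ := by
    unfold gapSlope
    field_simp
    ring
  rw [h3]
  exact h2

theorem abs_regGap_sub_le {a r s : ℝ} (hr : 0 < r) (hs : 0 < s) :
    |regGap a r - regGap a s| ≤ |r - s| * (gapSlope a r + gapSlope a s) := by
  wlog h : s ≤ r generalizing r s
  · have := this hs hr (le_of_not_ge h)
    rwa [abs_sub_comm, abs_sub_comm s, add_comm] at this
  have hanti : ∀ t ∈ Set.Icc s r, ‖-gapSlope a t‖ ≤ gapSlope a s := by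
    intro t ht
    have ht0 : 0 < t := hs.trans_le ht.1
    rw [norm_neg, Real.norm_of_nonneg (gapSlope_nonneg a ht0.le)]
    unfold gapSlope
    have := ht.1
    gcongr
  have := Convex.norm_image_sub_le_of_norm_hasDerivWithin_le
    (f := regGap a) (f' := fun t => -gapSlope a t) (s := Set.Icc s r)
    (fun t ht => (hasDerivAt_regGap (hs.trans_le ht.1)).hasDerivWithinAt) hanti
    (convex_Icc s r) (Set.left_mem_Icc.2 h) (Set.right_mem_Icc.2 h)
  rw [Real.norm_eq_abs, Real.norm_eq_abs] at this
  nlinarith [mul_nonneg (abs_nonneg (r - s)) (gapSlope_nonneg a hr.le)]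

theorem gapSlope_le_inv (a : ℝ) {r : ℝ} (hr : 0 ≤ r) : gapSlope a r ≤ r⁻¹ := by
  rcases hr.eq_or_lt with rfl | hr
  · simp [gapSlope]
  · unfold gapSlope
    rw [div_le_iff₀ (by positivity)]
    field_simp
    nlinarith [sq_nonneg r]

theorem gapSlope_sq_le {b : ℝ} (hb : 0 < b) {r : ℝ} (hr : b ≤ r) : gapSlope (b ^ 2) r ≤ b := by
  have hr0 := hb.trans_le hr
  unfold gapSlope
  rw [div_le_iff₀ (by positivity)]
  have h1 : b ^ 3 ≤ r ^ 3 := by gcongr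
  have h2 : 0 < b * (r * (b ^ 2) ^ 2) := by positivity
  nlinarith [mul_le_mul_of_nonneg_left h1 hb.le]

theorem measurable_gapSlope (a : ℝ) : Measurable (gapSlope a) := by
  unfold gapSlope; fun_prop

section Potentials

variable {S : Set Plane}

theorem ae_restrict_ne (S : Set Plane) (x : Plane) : ∀ᵐ y ∂(volume.restrict S), y ≠ x := by
  have : ∀ᵐ y ∂(volume : Measure Plane), y ≠ x := by
    rw [ae_iff]; simp
  exact ae_restrict_of_ae this

theorem integrableOn_gapSlope (hS : MeasurableSet S) (hfin : volume S ≠ ⊤) (a : ℝ) (x : Plane) :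
    IntegrableOn (fun y : Plane => gapSlope a ‖x - y‖) S := by
  refine (integrableOn_inv_norm hS hfin x).mono'
    ((measurable_gapSlope a).comp (by fun_prop)).aestronglyMeasurable (ae_of_all _ fun y => ?_)
  rw [Real.norm_of_nonneg (gapSlope_nonneg a (norm_nonneg _))]
  exact gapSlope_le_inv a (norm_nonneg _)

theorem setIntegral_gapSlope_le (hS : MeasurableSet S) (hfin : volume S ≠ ⊤) {b : ℝ} (hb : 0 < b)
    (x : Plane) : ∫ y in S, gapSlope (b ^ 2) ‖x - y‖ ≤ (2 * π + volume.real S) * b := by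
  have hi := integrableOn_inv_norm_ball x b
  rw [abs_of_pos hb] at hi
  have hind := (integrable_indicator_iff Metric.isOpen_ball.measurableSet).2 hi.1
  calc ∫ y in S, gapSlope (b ^ 2) ‖x - y‖
      ≤ ∫ y in S, ((Metric.ball x b).indicator (fun y => ‖x - y‖⁻¹) y + b) := by
        refine setIntegral_mono (integrableOn_gapSlope hS hfin _ x)
          (hind.integrableOn.add (integrableOn_const hfin)) ?_
        intro y
        by_cases h : y ∈ Metric.ball x b
        · simp only [Set.indicator_of_mem h]
          have := gapSlope_le_inv (b ^ 2) (norm_nonneg (x - y))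
          linarith
        · simp only [Set.indicator_of_notMem h, zero_add]
          rw [Metric.mem_ball, dist_comm, dist_eq_norm, not_lt] at h
          exact gapSlope_sq_le hb h
    _ = (∫ y in S, (Metric.ball x b).indicator (fun y => ‖x - y‖⁻¹) y) + volume.real S * b := by
        rw [integral_add hind.integrableOn (integrableOn_const hfin)]
        simp
    _ ≤ _ := by
        rw [add_mul]
        gcongr
        refine le_trans (setIntegral_le_integral hind ?_) ?_
        · exact ae_of_all _ fun y => Set.indicator_nonneg (fun _ _ => by positivity) y
        · rw [integral_indicator Metric.isOpen_ball.measurableSet]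
          exact hi.2

theorem abs_setIntegral_mul_le {ρ k g : Plane → ℝ} {P I : ℝ} (hS : MeasurableSet S)
    (hP : ∀ y ∈ S, |ρ y| ≤ P) (hP0 : 0 ≤ P) (hg : IntegrableOn g S)
    (hkg : ∀ᵐ y ∂(volume.restrict S), |k y| ≤ g y) (hI : ∫ y in S, g y ≤ I) :
    |∫ y in S, ρ y * k y| ≤ P * I := by
  rw [← Real.norm_eq_abs]
  refine (norm_integral_le_of_norm_le (hg.const_mul P) ?_).trans ?_
  · filter_upwards [hkg, ae_restrict_mem hS] with y hy hyS
    rw [norm_mul, Real.norm_eq_abs, Real.norm_eq_abs]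
    exact mul_le_mul (hP y hyS) hy (abs_nonneg _) hP0
  · rw [integral_const_mul]
    exact mul_le_mul_of_nonneg_left hI hP0

theorem integrableOn_bdd_mul {ρ k : Plane → ℝ} {P : ℝ} (hS : MeasurableSet S)
    (hρ : Measurable ρ) (hP : ∀ y ∈ S, |ρ y| ≤ P) (hk : IntegrableOn k S) :
    IntegrableOn (fun y => ρ y * k y) S := by
  refine hk.bdd_mul (c := P) hρ.aestronglyMeasurable ?_
  filter_upwards [ae_restrict_mem hS] with y hy using hP y hy

theorem integrableOn_log_norm (hS : MeasurableSet S) (hb : Bornology.IsBounded S) (x : Plane) :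
    IntegrableOn (fun y : Plane => log ‖x - y‖) S := by
  have hfin : volume S ≠ ⊤ := hb.measure_lt_top.ne
  obtain ⟨R, hR⟩ := hb.subset_closedBall x
  refine Integrable.mono' (g := fun y => ‖x - y‖⁻¹ + R)
    ((integrableOn_inv_norm hS hfin x).add (integrableOn_const hfin))
    (measurable_log.comp (by fun_prop)).aestronglyMeasurable ?_
  filter_upwards [ae_restrict_mem hS] with y hy
  have h1 := hR hy
  rw [Metric.mem_closedBall, dist_comm, dist_eq_norm] at h1
  rw [Real.norm_eq_abs]
  have := abs_log_le_inv_add (norm_nonneg (x - y))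
  linarith

theorem integrableOn_reg_log_norm (hb : Bornology.IsBounded S) {a : ℝ}
    (ha : 0 < a) (x : Plane) : IntegrableOn (fun y : Plane => log (‖x - y‖ ^ 2 + a ^ 2) / 2) S := by
  have hc : Continuous (fun y : Plane => log (‖x - y‖ ^ 2 + a ^ 2) / 2) := by
    refine Continuous.div_const (Continuous.log (by fun_prop) fun y => ?_) 2
    positivity
  exact (hc.continuousOn.integrableOn_compact hb.isCompact_closure).mono_set subset_closure

/-- The logarithmic potential of the density `ρ` on `S`. -/
def logPot (ρ : Plane → ℝ) (S : Set Plane) (x : Plane) : ℝ := ∫ y in S, ρ y * -log ‖x - y‖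

/-- The regularised logarithmic potential of the density `ρ` on `S`. -/
def regPot (a : ℝ) (ρ : Plane → ℝ) (S : Set Plane) (x : Plane) : ℝ :=
  ∫ y in S, ρ y * -(log (‖x - y‖ ^ 2 + a ^ 2) / 2)

variable {ρ : Plane → ℝ} {P : ℝ}

theorem integrableOn_logPot (hS : MeasurableSet S) (hb : Bornology.IsBounded S)
    (hρ : Measurable ρ) (hP : ∀ y ∈ S, |ρ y| ≤ P) (x : Plane) :
    IntegrableOn (fun y => ρ y * -log ‖x - y‖) S :=
  integrableOn_bdd_mul hS hρ hP (integrableOn_log_norm hS hb x).neg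

theorem integrableOn_regPot (hS : MeasurableSet S) (hb : Bornology.IsBounded S)
    (hρ : Measurable ρ) (hP : ∀ y ∈ S, |ρ y| ≤ P) {a : ℝ} (ha : 0 < a) (x : Plane) :
    IntegrableOn (fun y => ρ y * -(log (‖x - y‖ ^ 2 + a ^ 2) / 2)) S :=
  integrableOn_bdd_mul hS hρ hP (integrableOn_reg_log_norm hb ha x).neg

theorem setIntegral_inv_norm_le' (hS : MeasurableSet S) (hb : Bornology.IsBounded S) (x : Plane) :
    ∫ y in S, ‖x - y‖⁻¹ ≤ 2 * π + volume.real S := by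
  simpa using setIntegral_inv_norm_le hS hb.measure_lt_top.ne x one_pos

theorem abs_logPot_sub_le (hS : MeasurableSet S) (hb : Bornology.IsBounded S)
    (hρ : Measurable ρ) (hP : ∀ y ∈ S, |ρ y| ≤ P) (hP0 : 0 ≤ P) (x x' : Plane) :
    |logPot ρ S x - logPot ρ S x'| ≤ 2 * P * (2 * π + volume.real S) * ‖x - x'‖ := by
  have hi := fun x => integrableOn_inv_norm hS hb.measure_lt_top.ne x
  unfold logPot
  rw [← integral_sub (integrableOn_logPot hS hb hρ hP x) (integrableOn_logPot hS hb hρ hP x')]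
  simp_rw [← mul_sub]
  refine (abs_setIntegral_mul_le (g := fun y => ‖x - x'‖ * (‖x - y‖⁻¹ + ‖x' - y‖⁻¹))
    (I := ‖x - x'‖ * (2 * (2 * π + volume.real S))) hS hP hP0
    (((hi x).add (hi x')).const_mul _) ?_ ?_).trans (le_of_eq (by ring))
  · filter_upwards [ae_restrict_ne S x, ae_restrict_ne S x'] with y h1 h2
    have h3 : 0 < ‖x - y‖ := norm_pos_iff.2 (sub_ne_zero.2 h1.symm)
    have h4 : 0 < ‖x' - y‖ := norm_pos_iff.2 (sub_ne_zero.2 h2.symm)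
    rw [← neg_sub', abs_neg]
    refine (abs_log_sub_log_le h3 h4).trans ?_
    gcongr
    simpa using abs_norm_sub_norm_le (x - y) (x' - y)
  · rw [integral_const_mul, integral_add (hi x) (hi x')]
    gcongr
    linarith [setIntegral_inv_norm_le' hS hb x, setIntegral_inv_norm_le' hS hb x']

theorem logPot_sub_regPot (hS : MeasurableSet S) (hb : Bornology.IsBounded S)
    (hρ : Measurable ρ) (hP : ∀ y ∈ S, |ρ y| ≤ P) {a : ℝ} (ha : 0 < a) (x : Plane) :
    logPot ρ S x - regPot a ρ S x = ∫ y in S, ρ y * regGap a ‖x - y‖ := by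
  unfold logPot regPot
  rw [← integral_sub (integrableOn_logPot hS hb hρ hP x) (integrableOn_regPot hS hb hρ hP ha x)]
  congr 1; funext y; unfold regGap; ring

theorem integrableOn_regGap (hS : MeasurableSet S) (hb : Bornology.IsBounded S)
    (hρ : Measurable ρ) (hP : ∀ y ∈ S, |ρ y| ≤ P) {a : ℝ} (ha : 0 < a) (x : Plane) :
    IntegrableOn (fun y => ρ y * regGap a ‖x - y‖) S :=
  integrableOn_bdd_mul hS hρ hP
    ((integrableOn_reg_log_norm hb ha x).sub (integrableOn_log_norm hS hb x))

theorem abs_logPot_sub_regPot_le (hS : MeasurableSet S) (hb : Bornology.IsBounded S)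
    (hρ : Measurable ρ) (hP : ∀ y ∈ S, |ρ y| ≤ P) (hP0 : 0 ≤ P) {a : ℝ} (ha : 0 < a)
    (x : Plane) : |logPot ρ S x - regPot a ρ S x| ≤ P * (a * (2 * π + volume.real S)) := by
  rw [logPot_sub_regPot hS hb hρ hP ha]
  refine abs_setIntegral_mul_le (g := fun y => a * ‖x - y‖⁻¹) hS hP hP0
    ((integrableOn_inv_norm hS hb.measure_lt_top.ne x).const_mul _) ?_ ?_
  · filter_upwards [ae_restrict_ne S x] with y h1
    have h3 : 0 < ‖x - y‖ := norm_pos_iff.2 (sub_ne_zero.2 h1.symm)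
    rw [abs_of_nonneg (regGap_nonneg a h3)]
    exact regGap_le ha.le h3
  · rw [integral_const_mul]
    gcongr
    exact setIntegral_inv_norm_le' hS hb x

theorem abs_logPot_sub_regPot_sub_le (hS : MeasurableSet S) (hb : Bornology.IsBounded S)
    (hρ : Measurable ρ) (hP : ∀ y ∈ S, |ρ y| ≤ P) (hP0 : 0 ≤ P) {b : ℝ} (hb0 : 0 < b)
    (x x' : Plane) :
    |(logPot ρ S x - regPot (b ^ 2) ρ S x) - (logPot ρ S x' - regPot (b ^ 2) ρ S x')|
      ≤ 2 * P * (2 * π + volume.real S) * b * ‖x - x'‖ := by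
  have ha : 0 < b ^ 2 := by positivity
  have hi := fun x => integrableOn_gapSlope hS hb.measure_lt_top.ne (b ^ 2) x
  rw [logPot_sub_regPot hS hb hρ hP ha, logPot_sub_regPot hS hb hρ hP ha,
    ← integral_sub (integrableOn_regGap hS hb hρ hP ha x) (integrableOn_regGap hS hb hρ hP ha x')]
  simp_rw [← mul_sub]
  refine (abs_setIntegral_mul_le
    (g := fun y => ‖x - x'‖ * (gapSlope (b ^ 2) ‖x - y‖ + gapSlope (b ^ 2) ‖x' - y‖))
    (I := ‖x - x'‖ * (2 * ((2 * π + volume.real S) * b))) hS hP hP0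
    (((hi x).add (hi x')).const_mul _) ?_ ?_).trans (le_of_eq (by ring))
  · filter_upwards [ae_restrict_ne S x, ae_restrict_ne S x'] with y h1 h2
    have h3 : 0 < ‖x - y‖ := norm_pos_iff.2 (sub_ne_zero.2 h1.symm)
    have h4 : 0 < ‖x' - y‖ := norm_pos_iff.2 (sub_ne_zero.2 h2.symm)
    refine (abs_regGap_sub_le h3 h4).trans ?_
    have := gapSlope_nonneg (b ^ 2) h3.le
    have := gapSlope_nonneg (b ^ 2) h4.le
    gcongr
    simpa using abs_norm_sub_norm_le (x - y) (x' - y)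
  · rw [integral_const_mul, integral_add (hi x) (hi x')]
    gcongr
    have hf : volume S ≠ ⊤ := hb.measure_lt_top.ne
    linarith [setIntegral_gapSlope_le hS hf hb0 x, setIntegral_gapSlope_le hS hf hb0 x']

end Potentials

/-- Pairs `(x, t)` such that the segment from `x` to `x + t e` lies in `B`. -/
def sliceSet (B : Set Plane) (e : Plane) : Set (Plane × ℝ) :=
  {q | ∀ s ∈ Set.Icc (0 : ℝ) 1, q.1 + (s * q.2) • e ∈ B}

theorem isOpen_sliceSet {B : Set Plane} (hB : IsOpen B) (e : Plane) : IsOpen (sliceSet B e) := by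
  rw [isOpen_iff_eventually]
  intro q hq
  have : ∀ᶠ q' in nhds q, ∀ s ∈ Set.Icc (0 : ℝ) 1, q'.1 + (s * q'.2) • e ∈ B := by
    refine isCompact_Icc.eventually_forall_of_forall_eventually fun s hs => ?_
    have hc : Continuous fun z : (Plane × ℝ) × ℝ => z.1.1 + (z.2 * z.1.2) • e := by fun_prop
    exact hc.continuousAt.preimage_mem_nhds (hB.mem_nhds (hq s hs))
  exact this

theorem sliceSet_zero {B : Set Plane} {e x : Plane} : (x, (0 : ℝ)) ∈ sliceSet B e ↔ x ∈ B := by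
  constructor
  · intro h; simpa using h 0 (by simp)
  · intro h s _; simpa using h

theorem mem_of_mem_sliceSet {B : Set Plane} {e x : Plane} {t : ℝ} (h : (x, t) ∈ sliceSet B e) :
    x ∈ B ∧ x + t • e ∈ B :=
  ⟨by simpa using h 0 (by simp), by simpa using h 1 (by simp)⟩

theorem measurableSet_sliceSet_fiber {B : Set Plane} (hB : IsOpen B) (e : Plane) (t : ℝ) :
    MeasurableSet {x | (x, t) ∈ sliceSet B e} :=
  ((isOpen_sliceSet hB e).preimage (by fun_prop : Continuous fun x : Plane => (x, t))).measurableSet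

theorem tendsto_setIntegral_slice {B : Set Plane} (hB : IsOpen B) (e : Plane) {φ : Plane → ℝ}
    (hφ : IntegrableOn φ B) :
    Tendsto (fun t : ℝ => ∫ x in {x | (x, t) ∈ sliceSet B e}, φ x) (nhdsWithin 0 (Set.Ioi 0))
      (nhds (∫ x in B, φ x)) := by
  have h1 : ∀ t : ℝ, ∫ x in {x | (x, t) ∈ sliceSet B e}, φ x
      = ∫ x in B, {x | (x, t) ∈ sliceSet B e}.indicator φ x := by
    intro t
    rw [integral_indicator (measurableSet_sliceSet_fiber hB e t),
      Measure.restrict_restrict (measurableSet_sliceSet_fiber hB e t)]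
    have h : {x | (x, t) ∈ sliceSet B e} ∩ B = {x | (x, t) ∈ sliceSet B e} :=
      Set.inter_eq_left.2 fun x (hx : (x, t) ∈ sliceSet B e) => (mem_of_mem_sliceSet hx).1
    rw [h]
  simp_rw [h1]
  refine tendsto_integral_filter_of_dominated_convergence (fun x => ‖φ x‖) ?_ ?_ hφ.norm ?_
  · exact Eventually.of_forall fun t =>
      hφ.aestronglyMeasurable.indicator (measurableSet_sliceSet_fiber hB e t)
  · exact Eventually.of_forall fun t => ae_of_all _ fun x => norm_indicator_le_norm_self _ _
  · filter_upwards [ae_restrict_mem hB.measurableSet] with x hx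
    refine tendsto_const_nhds.congr' ?_
    have : ∀ᶠ t : ℝ in nhds 0, (x, t) ∈ sliceSet B e :=
      (by fun_prop : Continuous fun t : ℝ => (x, t)).continuousAt.preimage_mem_nhds
        ((isOpen_sliceSet hB e).mem_nhds (sliceSet_zero.2 hx))
    filter_upwards [nhdsWithin_le_nhds this] with t ht
    rw [Set.indicator_of_mem (by exact ht)]

theorem slice_integration_by_parts {B : Set Plane} (hB : IsOpen B) (hBb : Bornology.IsBounded B)
    {e : Plane} (he : ‖e‖ = 1) {f g v : Plane → ℝ} {γ G lam Λ C V R : ℝ} (hG : 0 ≤ G)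
    (hΛ : 0 ≤ Λ) (hlam : 0 ≤ lam) (hR : 0 < R) (hgm : Measurable g) (hvm : Measurable v)
    (hgG : ∀ x ∈ B, |g x| ≤ G) (hvV : ∀ x ∈ B, |v x| ≤ V)
    (hgs : ∀ x t, (x, t) ∈ sliceSet B e → g (x + t • e) = g x + γ * t)
    (hfi : IntegrableOn f B) (hf0 : ∀ x ∈ B, 0 ≤ f x)
    (hfΛ : ∀ x ∈ B, ∀ z ∉ B, ‖x - z‖ ≤ R → f x ≤ Λ * ‖x - z‖)
    (hfd : ∀ x t, 0 < t → t ≤ R → (x, t) ∈ sliceSet B e →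
      |f (x + t • e) - f x - t * v x| ≤ t * (lam + C * t)) :
    |∫ x in B, (g x * v x + γ * f x)| ≤ lam * G * volume.real B := by
  have hBm := hB.measurableSet
  have hfin : volume B ≠ ⊤ := hBb.measure_lt_top.ne
  set F : Plane → ℝ := B.indicator (fun x => g x * f x) with hF
  have hgv : IntegrableOn (fun x => g x * v x) B :=
    integrableOn_bdd_mul hBm hgm hgG (Measure.integrableOn_of_bounded hfin hvm.aestronglyMeasurable
      ((ae_restrict_iff' hBm).2 (ae_of_all _ hvV)))
  have hφ : IntegrableOn (fun x => g x * v x + γ * f x) B := hgv.add (hfi.const_mul γ)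
  have hgf : IntegrableOn (fun x => g x * f x) B := integrableOn_bdd_mul hBm hgm hgG hfi
  have hFi : Integrable F := (integrable_indicator_iff hBm).2 hgf
  have h1i : IntegrableOn (fun _ : Plane => (1 : ℝ)) B := integrableOn_const hfin
  set Wt : ℝ → Set Plane := fun t => {x | (x, t) ∈ sliceSet B e} with hWt
  have hWm : ∀ t, MeasurableSet (Wt t) := measurableSet_sliceSet_fiber hB e
  have hWB : ∀ t, Wt t ⊆ B := fun t x hx => (mem_of_mem_sliceSet hx).1
  have main : ∀ t, 0 < t → t ≤ R → |∫ x in Wt t, (g x * v x + γ * f x)|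
      ≤ (G * (lam + |C| * t) + |γ| * t * |V|) * volume.real B
        + 2 * (G * Λ) * ((∫ x in B, (1 : ℝ)) - ∫ x in Wt t, (1 : ℝ)) := by
    intro t ht htR
    have hFt : Integrable (fun x => F (x + t • e)) := hFi.comp_add_right (t • e)
    have h0 : ∫ x, (F (x + t • e) - F x) = 0 := by
      rw [integral_sub hFt hFi, integral_add_right_eq_self, sub_self]
    have hsub : Integrable (fun x => F (x + t • e) - F x) := hFt.sub hFi
    rw [← integral_add_compl (hWm t) hsub] at h0
    -- the contribution of the points whose segment leaves `B`
    have hbad : |∫ x in (Wt t)ᶜ, (F (x + t • e) - F x)|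
        ≤ t * (2 * (G * Λ) * ((∫ x in B, (1 : ℝ)) - ∫ x in Wt t, (1 : ℝ))) := by
      have hI1 : Integrable (B.indicator (fun _ : Plane => (1 : ℝ))) :=
        (integrable_indicator_iff hBm).2 h1i
      have hI2 : Integrable (fun x => B.indicator (fun _ : Plane => (1 : ℝ)) (x + t • e)) :=
        hI1.comp_add_right _
      have hbd : ∀ x ∈ (Wt t)ᶜ, ‖F (x + t • e) - F x‖ ≤ G * Λ * t *
          (B.indicator (fun _ : Plane => (1 : ℝ)) (x + t • e)
            + B.indicator (fun _ : Plane => (1 : ℝ)) x) := by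
        intro x hx
        have hx' : ¬ ∀ s ∈ Set.Icc (0 : ℝ) 1, x + (s * t) • e ∈ B := hx
        push Not at hx'
        obtain ⟨s, hs, hz⟩ := hx'
        have key : ∀ y, ‖y - (x + (s * t) • e)‖ ≤ t →
            |F y| ≤ G * Λ * t * B.indicator (fun _ : Plane => (1 : ℝ)) y := by
          intro y hy
          by_cases hyB : y ∈ B
          · rw [hF, Set.indicator_of_mem hyB, Set.indicator_of_mem hyB, mul_one, abs_mul,
              abs_of_nonneg (hf0 y hyB), mul_assoc]
            refine mul_le_mul (hgG y hyB) ?_ (hf0 y hyB) hG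
            exact (hfΛ y hyB _ hz (hy.trans htR)).trans (mul_le_mul_of_nonneg_left hy hΛ)
          · simp [hF, hyB]
        rw [Real.norm_eq_abs]
        refine (abs_sub _ _).trans ?_
        rw [mul_add]
        refine add_le_add (key _ ?_) (key _ ?_)
        · have : x + t • e - (x + (s * t) • e) = ((1 - s) * t) • e := by module
          rw [this, norm_smul, he, mul_one, Real.norm_of_nonneg
            (mul_nonneg (by linarith [hs.2]) ht.le)]
          nlinarith [hs.1]
        · have : x - (x + (s * t) • e) = (-(s * t)) • e := by module
          rw [this, norm_smul, he, mul_one, norm_neg, Real.norm_of_nonneg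
            (mul_nonneg hs.1 ht.le)]
          nlinarith [hs.2]
      have hW1 : ∀ (h : Plane → ℝ), Integrable h → (∀ x ∈ Wt t, h x = 1) →
          ∫ x in (Wt t)ᶜ, h x = (∫ x, h x) - ∫ x in Wt t, (1 : ℝ) := by
        intro h hh h1
        rw [← integral_add_compl (hWm t) hh, setIntegral_congr_fun (hWm t) h1]
        ring
      rw [← Real.norm_eq_abs]
      refine (norm_integral_le_of_norm_le ((hI2.add hI1).integrableOn.const_mul (G * Λ * t))
        ((ae_restrict_iff' (hWm t).compl).2 (ae_of_all _ hbd))).trans ?_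
      rw [integral_const_mul]
      simp only [Pi.add_apply]
      rw [integral_add hI2.integrableOn hI1.integrableOn, hW1 _ hI2, hW1 _ hI1,
        integral_add_right_eq_self (B.indicator (fun _ : Plane => (1 : ℝ))),
        integral_indicator hBm]
      · exact le_of_eq (by ring)
      · intro x hx; exact Set.indicator_of_mem (hWB t hx) _
      · intro x hx; exact Set.indicator_of_mem (mem_of_mem_sliceSet hx).2 _
    -- the contribution of the points whose segment stays in `B`
    have hgood : |(∫ x in Wt t, (F (x + t • e) - F x)) - t * ∫ x in Wt t, (g x * v x + γ * f x)|
        ≤ t * ((G * (lam + |C| * t) + |γ| * t * |V|) * volume.real B) := by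
      rw [← integral_const_mul, ← integral_sub hsub.integrableOn
        ((hφ.mono_set (hWB t)).const_mul t)]
      have hbd : ∀ x ∈ Wt t, ‖(F (x + t • e) - F x) - t * (g x * v x + γ * f x)‖
          ≤ t * (G * (lam + |C| * t) + |γ| * t * |V|) := by
        intro x hx
        obtain ⟨hx1, hx2⟩ := mem_of_mem_sliceSet hx
        have h1 := hfd x t ht htR hx
        have h2 := hgs x t hx
        have h3 := hgG _ hx2
        have h4 := (hvV x hx1).trans (le_abs_self V)
        rw [hF, Set.indicator_of_mem hx1, Set.indicator_of_mem hx2]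
        have : g (x + t • e) * f (x + t • e) - g x * f x - t * (g x * v x + γ * f x)
            = g (x + t • e) * (f (x + t • e) - f x - t * v x) + γ * t * (t * v x) := by
          rw [h2]; ring
        rw [Real.norm_eq_abs, this]
        refine (abs_add_le _ _).trans ?_
        rw [abs_mul, abs_mul, abs_mul, abs_mul, abs_of_pos ht, mul_add]
        have h5 : t * (lam + C * t) ≤ t * (lam + |C| * t) := by
          gcongr; exact le_abs_self C
        refine add_le_add ?_ ?_
        · calc |g (x + t • e)| * |f (x + t • e) - f x - t * v x|
              ≤ G * (t * (lam + |C| * t)) := mul_le_mul h3 (h1.trans h5) (abs_nonneg _) hG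
            _ = _ := by ring
        · calc |γ| * t * (t * |v x|) ≤ |γ| * t * (t * |V|) := by gcongr
            _ = _ := by ring
      have hWfin : volume (Wt t) < ⊤ := (measure_mono (hWB t)).trans_lt hBb.measure_lt_top
      rw [← Real.norm_eq_abs]
      refine (norm_setIntegral_le_of_norm_le_const hWfin hbd).trans ?_
      rw [mul_assoc]
      have : volume.real (Wt t) ≤ volume.real B := measureReal_mono (hWB t) hfin
      gcongr
    have h3 : t * |∫ x in Wt t, (g x * v x + γ * f x)|
        ≤ t * ((G * (lam + |C| * t) + |γ| * t * |V|) * volume.real B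
        + 2 * (G * Λ) * ((∫ x in B, (1 : ℝ)) - ∫ x in Wt t, (1 : ℝ))) := by
      rw [← abs_of_pos ht, ← abs_mul, abs_of_pos ht]
      set X := t * ∫ x in Wt t, (g x * v x + γ * f x)
      have h4 : X = (∫ x in Wt t, (F (x + t • e) - F x))
        - ((∫ x in Wt t, (F (x + t • e) - F x)) - X) := by ring
      rw [h4, mul_add]
      refine (abs_sub _ _).trans ?_
      rw [add_comm]
      refine add_le_add hgood ?_
      have : (∫ x in Wt t, (F (x + t • e) - F x)) = -∫ x in (Wt t)ᶜ, (F (x + t • e) - F x) := by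
        linarith
      rw [this, abs_neg]
      exact hbad
    exact le_of_mul_le_mul_left h3 ht
  have hlim := (tendsto_setIntegral_slice hB e hφ).abs
  have hl1 := tendsto_setIntegral_slice hB e h1i
  have hid : Tendsto (fun t : ℝ => t) (nhdsWithin 0 (Set.Ioi 0)) (nhds 0) :=
    tendsto_nhdsWithin_of_tendsto_nhds tendsto_id
  have hrhs : Tendsto (fun t : ℝ => (G * (lam + |C| * t) + |γ| * t * |V|) * volume.real B
        + 2 * (G * Λ) * ((∫ x in B, (1 : ℝ)) - ∫ x in Wt t, (1 : ℝ))) (nhdsWithin 0 (Set.Ioi 0))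
      (nhds ((G * (lam + |C| * 0) + |γ| * 0 * |V|) * volume.real B
        + 2 * (G * Λ) * ((∫ x in B, (1 : ℝ)) - ∫ x in B, (1 : ℝ)))) :=
    (((((hid.const_mul _).const_add _).const_mul _).add
      ((hid.const_mul _).mul_const _)).mul_const _).add ((hl1.const_sub _).const_mul _)
  have := le_of_tendsto_of_tendsto hlim hrhs (by
    have : ∀ᶠ t : ℝ in nhdsWithin 0 (Set.Ioi 0), t ∈ Set.Ioc 0 R :=
      Ioc_mem_nhdsGT hR
    filter_upwards [this] with t ht using main t ht.1 ht.2)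
  refine this.trans (le_of_eq ?_)
  ring

section Slices

variable {B : Set Plane} {e : Plane}

theorem mem_sliceSet_iff {x : Plane} {t : ℝ} :
    (x, t) ∈ sliceSet B e ↔ ∀ r ∈ Set.uIcc 0 t, x + r • e ∈ B := by
  have h : Set.uIcc 0 t = (fun s => s * t) '' Set.Icc (0 : ℝ) 1 := by
    rw [← segment_eq_uIcc, segment_eq_image_lineMap]
    refine Set.image_congr fun s _ => ?_
    simp [AffineMap.lineMap_apply]
  rw [h, Set.forall_mem_image]
  rfl

theorem mem_sliceSet_add_iff {x : Plane} {τ t : ℝ} (hτ : (x, τ) ∈ sliceSet B e) :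
    (x + τ • e, t) ∈ sliceSet B e ↔ (x, τ + t) ∈ sliceSet B e := by
  have h0 : ∀ r, x + τ • e + r • e ∈ B ↔ x + (τ + r) • e ∈ B := fun r => by
    rw [add_smul, add_assoc]
  have h1 : ∀ r, r ∈ Set.uIcc 0 t ↔ τ + r ∈ Set.uIcc τ (τ + t) := fun r => by
    rw [Set.mem_uIcc, Set.mem_uIcc]
    constructor <;> rintro (h | h)
    · left; constructor <;> linarith [h.1, h.2]
    · right; constructor <;> linarith [h.1, h.2]
    · left; constructor <;> linarith [h.1, h.2]
    · right; constructor <;> linarith [h.1, h.2]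
  rw [mem_sliceSet_iff] at hτ
  rw [mem_sliceSet_iff, mem_sliceSet_iff]
  constructor
  · intro h r hr
    rcases Set.uIcc_subset_uIcc_union_uIcc (b := τ) hr with h2 | h2
    · exact hτ r h2
    · have h3 := h (r - τ) ((h1 _).2 (by simpa using h2))
      rw [h0] at h3
      simpa using h3
  · intro h r hr
    rw [h0]
    rcases Set.uIcc_subset_uIcc_union_uIcc (b := 0) ((h1 r).1 hr) with h2 | h2
    · rw [Set.uIcc_comm] at h2; exact hτ _ h2
    · exact h _ h2

theorem sliceSet_neg_iff {x : Plane} {t : ℝ} :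
    (x - t • e, t) ∈ sliceSet B e ↔ (x, -t) ∈ sliceSet B e := by
  have h : ∀ (x : Plane) (t : ℝ), (x, t) ∈ sliceSet B e → (x + t • e, -t) ∈ sliceSet B e := by
    intro x t h
    rw [mem_sliceSet_add_iff h, add_neg_cancel, sliceSet_zero]
    exact (mem_of_mem_sliceSet h).1
  constructor
  · intro h1; simpa using h _ _ h1
  · intro h1; simpa [sub_eq_add_neg] using h _ _ h1

theorem exists_slice_eq_Ioo (hB : IsOpen B) (hBb : Bornology.IsBounded B) (he : ‖e‖ = 1)
    {x : Plane} (hx : x ∈ B) :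
    ∃ α < 0, ∃ β > 0, {t : ℝ | (x, t) ∈ sliceSet B e} = Set.Ioo α β := by
  set T := {t : ℝ | (x, t) ∈ sliceSet B e} with hT
  have hTo : IsOpen T :=
    (isOpen_sliceSet hB e).preimage (by fun_prop : Continuous fun t : ℝ => (x, t))
  have h0 : (0 : ℝ) ∈ T := sliceSet_zero.2 hx
  obtain ⟨R, hR⟩ := hBb.subset_closedBall x
  have hTR : T ⊆ Set.Icc (-R) R := by
    intro t ht
    have := hR (mem_of_mem_sliceSet ht).2
    rw [Metric.mem_closedBall, dist_eq_norm, add_sub_cancel_left, norm_smul, he, mul_one,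
      Real.norm_eq_abs] at this
    exact abs_le.1 this
  have hc : T.OrdConnected := by
    rw [Set.ordConnected_iff_uIcc_subset_left h0]
    intro t ht r hr
    rw [hT, Set.mem_ofPred_eq, mem_sliceSet_iff] at ht ⊢
    exact fun s hs => ht s (Set.uIcc_subset_uIcc_left hr hs)
  have hba : BddAbove T := ⟨R, fun t ht => (hTR ht).2⟩
  have hbb : BddBelow T := ⟨-R, fun t ht => (hTR ht).1⟩
  have hlt : ∀ t ∈ T, sInf T < t ∧ t < sSup T := by
    intro t ht
    obtain ⟨δ, hδ, hsub⟩ := Metric.isOpen_iff.1 hTo t ht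
    have h1 : t - δ / 2 ∈ T := hsub (by simp [abs_of_pos hδ]; linarith)
    have h2 : t + δ / 2 ∈ T := hsub (by simp [abs_of_pos hδ]; linarith)
    have h3 := csInf_le hbb h1
    have h4 := le_csSup hba h2
    constructor <;> linarith
  refine ⟨sInf T, (hlt 0 h0).1, sSup T, (hlt 0 h0).2, ?_⟩
  refine Set.Subset.antisymm (fun t ht => ⟨(hlt t ht).1, (hlt t ht).2⟩) ?_
  exact IsConnected.Ioo_csInf_csSup_subset ⟨⟨0, h0⟩, hc.isPreconnected⟩ hbb hba

/-- Length of the component of the line `x + ℝ e` in `B` through `x`. -/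
def sliceLen (B : Set Plane) (e x : Plane) : ℝ := volume.real {t : ℝ | (x, t) ∈ sliceSet B e}

/-- Mean of `h` over the component of the line `x + ℝ e` in `B` through `x`. -/
def sliceAvg (B : Set Plane) (e : Plane) (h : Plane → ℝ) (x : Plane) : ℝ :=
  (∫ t, (sliceSet B e).indicator (fun q => h (q.1 + q.2 • e)) (x, t)) / sliceLen B e x

theorem sliceAvg_eq_of_Ioo {h : Plane → ℝ} {x : Plane} {α β : ℝ} (hαβ : α < β)
    (hs : {t : ℝ | (x, t) ∈ sliceSet B e} = Set.Ioo α β) :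
    sliceLen B e x = β - α ∧
    sliceAvg B e h x = (∫ t in Set.Ioo α β, h (x + t • e)) / (β - α) := by
  have h1 : sliceLen B e x = β - α := by
    rw [sliceLen, hs, Real.volume_real_Ioo_of_le hαβ.le]
  refine ⟨h1, ?_⟩
  rw [sliceAvg, h1, ← hs, ← integral_indicator (by rw [hs]; exact measurableSet_Ioo)]
  rfl

theorem measurable_sliceLen (hB : IsOpen B) (e : Plane) : Measurable (sliceLen B e) := by
  have := measurable_measure_prodMk_left (ν := (volume : Measure ℝ))
    (isOpen_sliceSet hB e).measurableSet
  exact this.ennreal_toReal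

theorem measurable_sliceAvg (hB : IsOpen B) (e : Plane) {h : Plane → ℝ} (hh : Measurable h) :
    Measurable (sliceAvg B e h) := by
  refine Measurable.div ?_ (measurable_sliceLen hB e)
  refine (StronglyMeasurable.integral_prod_right (ν := (volume : Measure ℝ))
    (f := fun x t => (sliceSet B e).indicator (fun q => h (q.1 + q.2 • e)) (x, t)) ?_).measurable
  exact ((hh.comp (by fun_prop)).indicator (isOpen_sliceSet hB e).measurableSet).stronglyMeasurable

theorem sliceLen_add {x : Plane} {τ : ℝ} (hτ : (x, τ) ∈ sliceSet B e) :
    sliceLen B e (x + τ • e) = sliceLen B e x := by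
  have : {t : ℝ | (x + τ • e, t) ∈ sliceSet B e}
      = (fun t => τ + t) ⁻¹' {t : ℝ | (x, t) ∈ sliceSet B e} := by
    ext t; exact mem_sliceSet_add_iff hτ
  rw [sliceLen, this, Measure.real, measure_preimage_add]
  rfl

theorem sliceAvg_add {h : Plane → ℝ} {x : Plane} {τ : ℝ} (hτ : (x, τ) ∈ sliceSet B e) :
    sliceAvg B e h (x + τ • e) = sliceAvg B e h x := by
  rw [sliceAvg, sliceAvg, sliceLen_add hτ]
  congr 1
  rw [← integral_add_left_eq_self (fun t => (sliceSet B e).indicator _ (x, t)) τ]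
  congr 1; funext t
  by_cases ht : (x + τ • e, t) ∈ sliceSet B e
  · rw [Set.indicator_of_mem ht, Set.indicator_of_mem ((mem_sliceSet_add_iff hτ).1 ht)]
    simp only [add_smul, add_assoc]
  · rw [Set.indicator_of_notMem ht, Set.indicator_of_notMem
      (fun h' => ht ((mem_sliceSet_add_iff hτ).2 h'))]

theorem abs_sliceAvg_le (hB : IsOpen B) (hBb : Bornology.IsBounded B) (he : ‖e‖ = 1)
    {h : Plane → ℝ} {H : ℝ} (hH : ∀ x ∈ B, |h x| ≤ H) {x : Plane} (hx : x ∈ B) :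
    |sliceAvg B e h x| ≤ H := by
  obtain ⟨α, hα, β, hβ, hs⟩ := exists_slice_eq_Ioo hB hBb he hx
  rw [(sliceAvg_eq_of_Ioo (hα.trans hβ) hs).2, abs_div, abs_of_pos (by linarith : 0 < β - α),
    div_le_iff₀ (by linarith), ← Real.norm_eq_abs]
  refine (norm_setIntegral_le_of_norm_le_const (C := H) (by simp) fun t ht => ?_).trans ?_
  · rw [← hs] at ht
    exact hH _ (mem_of_mem_sliceSet ht).2
  · rw [Real.volume_real_Ioo_of_le (by linarith)]

theorem setIntegral_sliceAvg (hB : IsOpen B) (hBb : Bornology.IsBounded B) (he : ‖e‖ = 1)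
    {h : Plane → ℝ} (hh : Measurable h) {H : ℝ} (hH : ∀ x ∈ B, |h x| ≤ H) :
    ∫ x in B, sliceAvg B e h x = ∫ x in B, h x := by
  have hW := (isOpen_sliceSet hB e).measurableSet
  have hfin : volume B ≠ ⊤ := hBb.measure_lt_top.ne
  set Φ : Plane × ℝ → ℝ :=
    (sliceSet B e).indicator (fun q => h (q.1 + q.2 • e) / sliceLen B e q.1) with hΦ
  have hΦm : Measurable Φ :=
    ((hh.comp (by fun_prop)).div ((measurable_sliceLen hB e).comp measurable_fst)).indicator hW
  have hpos : ∀ x ∈ B, 0 < sliceLen B e x ∧ volume {t : ℝ | (x, t) ∈ sliceSet B e} ≠ ⊤ := by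
    intro x hx
    obtain ⟨α, hα, β, hβ, hs⟩ := exists_slice_eq_Ioo hB hBb he hx
    rw [(sliceAvg_eq_of_Ioo (h := h) (hα.trans hβ) hs).1, hs]
    exact ⟨by linarith, by simp⟩
  have hΦ0 : ∀ x ∉ B, ∀ t, Φ (x, t) = 0 := fun x hx t =>
    Set.indicator_of_notMem (fun h' => hx (mem_of_mem_sliceSet h').1) _
  have hbound : ∀ x t, ‖Φ (x, t)‖ ≤
      {t : ℝ | (x, t) ∈ sliceSet B e}.indicator (fun _ => H / sliceLen B e x) t := by
    intro x t
    by_cases ht : (x, t) ∈ sliceSet B e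
    · rw [hΦ, Set.indicator_of_mem ht, Set.indicator_of_mem (by exact ht), norm_div,
        Real.norm_of_nonneg (hpos x (mem_of_mem_sliceSet ht).1).1.le]
      exact div_le_div_of_nonneg_right (hH _ (mem_of_mem_sliceSet ht).2)
        (hpos x (mem_of_mem_sliceSet ht).1).1.le
    · rw [hΦ, Set.indicator_of_notMem ht, Set.indicator_of_notMem (by exact ht), norm_zero]
  have hfm : ∀ x, MeasurableSet {t : ℝ | (x, t) ∈ sliceSet B e} := fun x =>
    ((isOpen_sliceSet hB e).preimage
      (by fun_prop : Continuous fun t : ℝ => (x, t))).measurableSet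
  have hbi : ∀ x ∈ B, Integrable
      ({t : ℝ | (x, t) ∈ sliceSet B e}.indicator (fun _ => H / sliceLen B e x)) :=
    fun x hx => (integrable_indicator_iff (hfm x)).2 (integrableOn_const (hpos x hx).2)
  have hint : Integrable Φ (volume.prod volume) := by
    rw [integrable_prod_iff hΦm.aestronglyMeasurable]
    constructor
    · refine ae_of_all _ fun x => ?_
      by_cases hx : x ∈ B
      · exact (hbi x hx).mono' (hΦm.comp measurable_prodMk_left).aestronglyMeasurable
          (ae_of_all _ (hbound x))
      · simp_rw [hΦ0 x hx]; exact integrable_zero _ _ _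
    · have hBi : Integrable (B.indicator (fun _ : Plane => H)) :=
        (integrable_indicator_iff hB.measurableSet).2 (integrableOn_const hfin)
      refine hBi.mono'
        (hΦm.stronglyMeasurable.norm.integral_prod_right).aestronglyMeasurable
        (ae_of_all _ fun x => ?_)
      rw [Real.norm_of_nonneg (integral_nonneg fun _ => norm_nonneg _)]
      by_cases hx : x ∈ B
      · rw [Set.indicator_of_mem hx]
        refine (integral_mono_of_nonneg (ae_of_all _ fun _ => norm_nonneg _) (hbi x hx)
          (ae_of_all _ (hbound x))).trans (le_of_eq ?_)
        rw [integral_indicator (hfm x), setIntegral_const, smul_eq_mul]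
        exact mul_div_cancel₀ _ (hpos x hx).1.ne'
      · simp [hΦ0 x hx, hx]
  have h1 : ∫ x in B, sliceAvg B e h x = ∫ x, ∫ t, Φ (x, t) := by
    rw [← integral_indicator hB.measurableSet]
    congr 1; funext x
    by_cases hx : x ∈ B
    · rw [Set.indicator_of_mem hx, sliceAvg, ← integral_div]
      congr 1; funext t
      by_cases ht : (x, t) ∈ sliceSet B e
      · rw [hΦ, Set.indicator_of_mem ht, Set.indicator_of_mem ht]
      · rw [hΦ, Set.indicator_of_notMem ht, Set.indicator_of_notMem ht, zero_div]
    · simp [hΦ0 x hx, hx]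
  have hint2 : Integrable (fun q : Plane × ℝ => Φ (q.1 - q.2 • e, q.2)) (volume.prod volume) := by
    have hmp : MeasurePreserving (fun q : Plane × ℝ => (q.1 - q.2 • e, q.2))
        (volume.prod volume) (volume.prod volume) := by
      have h2 : MeasurePreserving (fun q : ℝ × Plane => (q.1, q.2 - q.1 • e))
          (volume.prod volume) (volume.prod volume) :=
        (MeasurePreserving.id volume).skew_product (g := fun t x => x - t • e) (by fun_prop)
          (ae_of_all _ fun t => (measurePreserving_sub_right volume (t • e)).map_eq)
      exact (Measure.measurePreserving_swap.comp h2).comp Measure.measurePreserving_swap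
    exact hmp.integrable_comp_of_integrable hint
  have h2 : ∫ x, ∫ t, Φ (x, t) = ∫ x, ∫ t, Φ (x - t • e, t) := by
    rw [integral_integral_swap (f := fun x t => Φ (x, t)) hint,
      integral_integral_swap (f := fun x t => Φ (x - t • e, t)) hint2]
    congr 1; funext t
    exact (integral_sub_right_eq_self (fun x => Φ (x, t)) (t • e)).symm
  rw [h1, h2, ← integral_indicator hB.measurableSet]
  congr 1; funext x
  have h3 : ∀ t, Φ (x - t • e, t)
      = {t : ℝ | (x, t) ∈ sliceSet B e}.indicator (fun _ => h x / sliceLen B e x) (-t) := by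
    intro t
    by_cases ht : (x, -t) ∈ sliceSet B e
    · rw [hΦ, Set.indicator_of_mem (sliceSet_neg_iff.2 ht), Set.indicator_of_mem (by exact ht)]
      have := sliceLen_add ht
      simp only [sub_add_cancel]
      rw [neg_smul, ← sub_eq_add_neg] at this
      rw [this]
    · rw [hΦ, Set.indicator_of_notMem (fun h' => ht (sliceSet_neg_iff.1 h')),
        Set.indicator_of_notMem (by exact ht)]
  simp_rw [h3]
  rw [integral_neg_eq_self, integral_indicator (hfm x), setIntegral_const, smul_eq_mul]
  by_cases hx : x ∈ B
  · rw [Set.indicator_of_mem hx]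
    exact mul_div_cancel₀ _ (hpos x hx).1.ne'
  · rw [Set.indicator_of_notMem hx]
    have : {t : ℝ | (x, t) ∈ sliceSet B e} = ∅ := by
      ext t; simp only [Set.mem_ofPred_eq, Set.mem_empty_iff_false, iff_false]
      exact fun h' => hx (mem_of_mem_sliceSet h').1
    simp [this]

end Slices

theorem setIntegral_odd_kernel_nonneg {k : ℝ → ℝ} (hk : Continuous k) (hodd : ∀ v, k (-v) = -k v)
    (hpos : ∀ v, 0 ≤ v → 0 ≤ k v) {a b c d : ℝ} (h : c + d ≤ a + b) :
    0 ≤ ∫ t in Set.Ioo c d, ∫ s in Set.Ioo a b, k (s - t) := by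
  set Ω : Set (ℝ × ℝ) := {q | q.1 ∈ Set.Ioo c d ∧ q.2 + q.1 ∈ Set.Ioo a b} with hΩ
  have hΩo : IsOpen Ω :=
    (isOpen_Ioo.preimage continuous_fst).inter
      (isOpen_Ioo.preimage (continuous_snd.add continuous_fst))
  set Ψ : ℝ × ℝ → ℝ := Ω.indicator (fun q => k q.2) with hΨ
  have hint : Integrable Ψ (volume.prod volume) := by
    rw [hΨ, integrable_indicator_iff hΩo.measurableSet]
    have hc : IsCompact (Set.Icc c d ×ˢ Set.Icc (a - d) (b - c)) := isCompact_Icc.prod isCompact_Icc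
    refine ((hk.comp continuous_snd).continuousOn.integrableOn_compact hc).mono_set ?_
    rintro ⟨t, v⟩ ⟨⟨h1, h2⟩, h3, h4⟩
    simp only at h1 h2 h3 h4
    refine ⟨⟨h1.le, h2.le⟩, ?_, ?_⟩ <;> simp only <;> linarith
  have e1 : ∫ t in Set.Ioo c d, ∫ s in Set.Ioo a b, k (s - t) = ∫ t, ∫ v, Ψ (t, v) := by
    rw [← integral_indicator measurableSet_Ioo]
    congr 1; funext t
    by_cases ht : t ∈ Set.Ioo c d
    · rw [Set.indicator_of_mem ht, ← integral_indicator measurableSet_Ioo,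
        ← integral_add_right_eq_self _ t]
      congr 1; funext v
      by_cases hv : v + t ∈ Set.Ioo a b
      · rw [Set.indicator_of_mem hv, hΨ, Set.indicator_of_mem (show (t, v) ∈ Ω from ⟨ht, hv⟩)]
        simp
      · rw [Set.indicator_of_notMem hv, hΨ,
          Set.indicator_of_notMem (show (t, v) ∉ Ω from fun h' => hv h'.2)]
    · rw [Set.indicator_of_notMem ht]
      have : ∀ v, Ψ (t, v) = 0 := fun v => Set.indicator_of_notMem (fun h' => ht h'.1) _
      simp [this]
  set ℓ : ℝ → ℝ := fun v => max (min d (b - v) - max c (a - v)) 0 with hℓ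
  have e2 : ∀ v, ∫ t, Ψ (t, v) = k v * ℓ v := by
    intro v
    have : ∀ t, Ψ (t, v) = (Set.Ioo (max c (a - v)) (min d (b - v))).indicator (fun _ => k v) t := by
      intro t
      have hiff : (t, v) ∈ Ω ↔ t ∈ Set.Ioo (max c (a - v)) (min d (b - v)) := by
        simp only [hΩ, Set.mem_ofPred_eq, Set.mem_Ioo, max_lt_iff, lt_min_iff]
        constructor
        · rintro ⟨⟨h1, h2⟩, h3, h4⟩; exact ⟨⟨h1, by linarith⟩, h2, by linarith⟩
        · rintro ⟨⟨h1, h2⟩, h3, h4⟩; exact ⟨⟨h1, h3⟩, by linarith, by linarith⟩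
      by_cases ht : (t, v) ∈ Ω
      · rw [hΨ, Set.indicator_of_mem ht, Set.indicator_of_mem (hiff.1 ht)]
      · rw [hΨ, Set.indicator_of_notMem ht, Set.indicator_of_notMem (fun h' => ht (hiff.2 h'))]
    simp_rw [this]
    rw [integral_indicator measurableSet_Ioo, setIntegral_const, Real.volume_real_Ioo, smul_eq_mul,
      mul_comm]
  rw [e1, integral_integral_swap (f := fun t v => Ψ (t, v)) hint]
  simp_rw [e2]
  have hkl : Integrable (fun v => k v * ℓ v) := by
    have := hint.integral_prod_right
    simpa only [e2] using this
  have hneg : ∫ v, k v * ℓ v = -∫ v, k v * ℓ (-v) := by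
    rw [← integral_neg_eq_self, ← integral_neg]
    congr 1; funext v; rw [hodd]; ring
  have hkl' : Integrable (fun v => k v * ℓ (-v)) := by
    refine (hkl.comp_neg.neg).congr (ae_of_all _ fun v => ?_)
    simp only [Pi.neg_apply, hodd]; ring
  have hle : ∀ v, 0 ≤ v → ℓ (-v) ≤ ℓ v := by
    intro v hv
    refine max_le_max ?_ le_rfl
    rcases min_cases d (b - v) with ⟨h1, _⟩ | ⟨h1, _⟩ <;>
    rcases max_cases c (a - v) with ⟨h2, _⟩ | ⟨h2, _⟩ <;> rw [h1, h2]
    · linarith [min_le_left d (b - -v), le_max_left c (a - -v)]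
    · linarith [min_le_left d (b - -v), le_max_right c (a - -v)]
    · linarith [min_le_left d (b - -v), le_max_right c (a - -v)]
    · linarith [min_le_right d (b - -v), le_max_right c (a - -v)]
  have hpt : ∀ v, 0 ≤ k v * ℓ v - k v * ℓ (-v) := by
    intro v
    rw [← mul_sub]
    rcases le_total 0 v with hv | hv
    · exact mul_nonneg (hpos v hv) (sub_nonneg.2 (hle v hv))
    · have h1 := hpos (-v) (by linarith)
      have h2 := hle (-v) (by linarith)
      rw [hodd] at h1
      rw [neg_neg] at h2
      exact mul_nonneg_of_nonpos_of_nonpos (by linarith) (by linarith)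
  have h0 : 0 ≤ ∫ v, (k v * ℓ v - k v * ℓ (-v)) := integral_nonneg hpt
  rw [integral_sub hkl hkl'] at h0
  linarith

theorem setIntegral_Ioo_sub {a b t : ℝ} (h : a ≤ b) :
    ∫ s in Set.Ioo a b, (s - t) = ((a + b) / 2 - t) * (b - a) := by
  rw [← integral_Ioc_eq_integral_Ioo, ← intervalIntegral.integral_of_le h,
    intervalIntegral.integral_sub (by simp) (by simp), integral_id,
    intervalIntegral.integral_const, smul_eq_mul]
  ring

theorem setIntegral_kernel_ge {k k₀ : ℝ → ℝ} (hk : Continuous k)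
    (hodd : ∀ v, k (-v) = -k v) (hpos : ∀ v, 0 ≤ v → 0 ≤ k v) {a b c d c₀ : ℝ} (hab : a ≤ b)
    (hcd : c ≤ d)
    (heq : ∀ t ∈ Set.Ioo c d, ∀ s ∈ Set.Ioo a b, k₀ (s - t) = k (s - t) + c₀ * (s - t)) :
    c₀ * ((a + b) / 2 - (c + d) / 2) ^ 2 * ((b - a) * (d - c)) ≤
      ((a + b) / 2 - (c + d) / 2) * ∫ t in Set.Ioo c d, ∫ s in Set.Ioo a b, k₀ (s - t) := by
  have hi : ∀ (f : ℝ → ℝ), Continuous f → ∀ p q : ℝ, IntegrableOn f (Set.Ioo p q) := fun f hf p q =>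
    (hf.continuousOn.integrableOn_compact isCompact_Icc).mono_set Set.Ioo_subset_Icc_self
  have hi2 : Integrable (fun t => ∫ s in Set.Ioo a b, k (s - t)) (volume.restrict (Set.Ioo c d)) := by
    have hc : Continuous fun t => ∫ s in a..b, k (s - t) :=
      intervalIntegral.continuous_parametric_intervalIntegral_of_continuous' (by fun_prop) a b
    have : Integrable _ (volume.restrict (Set.Ioo c d)) := hi _ hc c d
    simpa only [intervalIntegral.integral_of_le hab, integral_Ioc_eq_integral_Ioo] using this
  have h1 : ∫ t in Set.Ioo c d, ∫ s in Set.Ioo a b, k₀ (s - t)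
      = (∫ t in Set.Ioo c d, ∫ s in Set.Ioo a b, k (s - t))
        + c₀ * (((a + b) / 2 - (c + d) / 2) * ((b - a) * (d - c))) := by
    have h2 : ∀ t ∈ Set.Ioo c d, ∫ s in Set.Ioo a b, k₀ (s - t)
        = (∫ s in Set.Ioo a b, k (s - t)) + c₀ * (-(b - a) * (t - (a + b) / 2)) := by
      intro t ht
      rw [setIntegral_congr_fun measurableSet_Ioo (heq t ht),
        integral_add (hi _ (by fun_prop) a b) (hi _ (by fun_prop) a b), integral_const_mul,
        setIntegral_Ioo_sub hab]
      ring
    rw [setIntegral_congr_fun measurableSet_Ioo h2, integral_add hi2 (hi _ (by fun_prop) c d),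
      integral_const_mul, integral_const_mul, setIntegral_Ioo_sub hcd]
    ring
  rw [h1, mul_add]
  have h3 : 0 ≤ ((a + b) / 2 - (c + d) / 2) * ∫ t in Set.Ioo c d, ∫ s in Set.Ioo a b, k (s - t) := by
    rcases le_total (c + d) (a + b) with h | h
    · exact mul_nonneg (by linarith) (setIntegral_odd_kernel_nonneg hk hodd hpos h)
    · have h4 : 0 ≤ ∫ t in Set.Ioo (-d) (-c), ∫ s in Set.Ioo (-b) (-a), k (s - t) :=
        setIntegral_odd_kernel_nonneg hk hodd hpos (by linarith)
      have h5 : ∫ t in Set.Ioo (-d) (-c), ∫ s in Set.Ioo (-b) (-a), k (s - t)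
          = - ∫ t in Set.Ioo c d, ∫ s in Set.Ioo a b, k (s - t) := by
        simp only [← integral_Ioc_eq_integral_Ioo]
        rw [← intervalIntegral.integral_of_le (by linarith), ← intervalIntegral.integral_of_le hcd,
          ← intervalIntegral.integral_comp_neg, ← intervalIntegral.integral_neg]
        congr 1; funext t
        rw [← intervalIntegral.integral_of_le (by linarith), ← intervalIntegral.integral_of_le hab,
          ← intervalIntegral.integral_comp_neg, ← intervalIntegral.integral_neg]
        congr 1; funext s
        rw [← hodd]; congr 1; ring
      rw [h5] at h4
      exact mul_nonneg_of_nonpos_of_nonpos (by linarith) (by linarith)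
  nlinarith [h3]

theorem setIntegral_swap_of_bounded {B : Set Plane} (hB : MeasurableSet B)
    (hfin : volume B ≠ ⊤) {F : Plane → Plane → ℝ} (hF : Measurable (Function.uncurry F)) {H : ℝ}
    (hH : ∀ x ∈ B, ∀ y ∈ B, |F x y| ≤ H) :
    Integrable (Function.uncurry F) ((volume.restrict B).prod (volume.restrict B)) ∧
    ∫ x in B, ∫ y in B, F x y = ∫ y in B, ∫ x in B, F x y := by
  have : Integrable (Function.uncurry F) ((volume.restrict B).prod (volume.restrict B)) := by
    rw [Measure.prod_restrict]
    refine Measure.integrableOn_of_bounded (M := H) ?_ hF.aestronglyMeasurable ?_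
    · rw [Measure.prod_prod]; exact ENNReal.mul_ne_top hfin hfin
    · exact (ae_restrict_iff' (hB.prod hB)).2 (ae_of_all _ fun q hq => hH _ hq.1 _ hq.2)
  exact ⟨this, integral_integral_swap this⟩

section Mid

variable {B : Set Plane} {e : Plane}

theorem sliceAvg_const_mul {c h : Plane → ℝ} {x : Plane}
    (hc : ∀ t, (x, t) ∈ sliceSet B e → c (x + t • e) = c x) :
    sliceAvg B e (fun y => c y * h y) x = c x * sliceAvg B e h x := by
  rw [sliceAvg, sliceAvg, ← mul_div_assoc, ← integral_const_mul]
  congr 2; funext t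
  by_cases ht : (x, t) ∈ sliceSet B e
  · rw [Set.indicator_of_mem ht, Set.indicator_of_mem ht]
    simp only [hc t ht]
  · rw [Set.indicator_of_notMem ht, Set.indicator_of_notMem ht, mul_zero]

/-- The `e`-coordinate of the midpoint of the component of `x + ℝ e` in `B` through `x`. -/
def sliceMid (B : Set Plane) (e : Plane) : Plane → ℝ := sliceAvg B e (fun y => ⟪y, e⟫)

theorem measurable_sliceMid (hB : IsOpen B) (e : Plane) : Measurable (sliceMid B e) :=
  measurable_sliceAvg hB e (by fun_prop)

theorem inner_add_smul_self (he : ‖e‖ = 1) (x : Plane) (t : ℝ) :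
    ⟪x + t • e, e⟫ = ⟪x, e⟫ + t := by
  rw [inner_add_left, inner_smul_left, real_inner_self_eq_norm_sq, he]; simp

theorem sliceMid_eq (he : ‖e‖ = 1) {x : Plane} {α β : ℝ} (hαβ : α < β)
    (hs : {t : ℝ | (x, t) ∈ sliceSet B e} = Set.Ioo α β) :
    sliceMid B e x = ⟪x, e⟫ + (α + β) / 2 := by
  rw [sliceMid, (sliceAvg_eq_of_Ioo hαβ hs).2]
  have : ∀ t : ℝ, ⟪x + t • e, e⟫ = t - (-⟪x, e⟫) := fun t => by
    rw [inner_add_smul_self he]; ring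
  simp_rw [this]
  rw [setIntegral_Ioo_sub hαβ.le]
  field_simp [(sub_pos.2 hαβ).ne']
  ring

theorem sliceMid_add {x : Plane} {τ : ℝ} (hτ : (x, τ) ∈ sliceSet B e) :
    sliceMid B e (x + τ • e) = sliceMid B e x := sliceAvg_add hτ

/-- The `e`-component of the gradient of the regularised logarithm. -/
def regKer (a : ℝ) (e z : Plane) : ℝ := ⟪z, e⟫ / (‖z‖ ^ 2 + a ^ 2)

theorem continuous_regKer {a : ℝ} (ha : 0 < a) (e : Plane) : Continuous (regKer a e) := by
  unfold regKer
  exact Continuous.div (by fun_prop) (by fun_prop) fun z => by positivity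

theorem abs_regKer_le {a : ℝ} (ha : 0 < a) (he : ‖e‖ = 1) (z : Plane) : |regKer a e z| ≤ a⁻¹ := by
  unfold regKer
  rw [abs_div, abs_of_pos (by positivity : 0 < ‖z‖ ^ 2 + a ^ 2), div_le_iff₀ (by positivity)]
  have h1 := abs_real_inner_le_norm z e
  rw [he, mul_one] at h1
  have h2 : a⁻¹ * (‖z‖ ^ 2 + a ^ 2) = a⁻¹ * (‖z‖ ^ 2 + a ^ 2 - a * ‖z‖) + ‖z‖ := by
    field_simp; ring
  have h3 : 0 ≤ a⁻¹ * (‖z‖ ^ 2 + a ^ 2 - a * ‖z‖) := by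
    have := norm_nonneg z
    have : 0 ≤ ‖z‖ ^ 2 + a ^ 2 - a * ‖z‖ := by nlinarith [sq_nonneg (‖z‖ - a)]
    positivity
  linarith

theorem measurable_sliceAvg_sub (hB : IsOpen B) {κ : Plane → ℝ} (hκ : Measurable κ) :
    Measurable (Function.uncurry fun x y => sliceAvg B e (fun x' => κ (x' - y)) x) := by
  unfold sliceAvg
  refine Measurable.div ?_ ((measurable_sliceLen hB e).comp measurable_fst)
  refine (StronglyMeasurable.integral_prod_right (ν := (volume : Measure ℝ))
    (f := fun (p : Plane × Plane) t =>
      (sliceSet B e).indicator (fun q => κ (q.1 + q.2 • e - p.2)) (p.1, t)) ?_).measurable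
  have : (Function.uncurry fun (p : Plane × Plane) t =>
      (sliceSet B e).indicator (fun q => κ (q.1 + q.2 • e - p.2)) (p.1, t))
      = ((fun q : (Plane × Plane) × ℝ => (q.1.1, q.2)) ⁻¹' (sliceSet B e)).indicator
        (fun q => κ (q.1.1 + q.2 • e - q.1.2)) := by
    funext q
    rfl
  rw [this]
  exact ((hκ.comp (by fun_prop)).indicator
    ((isOpen_sliceSet hB e).measurableSet.preimage (by fun_prop))).stronglyMeasurable

theorem abs_sliceMid_sub_le (hB : IsOpen B) (hBb : Bornology.IsBounded B) (he : ‖e‖ = 1)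
    {x y : Plane} (hx : x ∈ B) (hy : y ∈ B) : |sliceMid B e x - ⟪y, e⟫| ≤ Metric.diam B := by
  have h1 : sliceMid B e x - ⟪y, e⟫ = sliceAvg B e (fun z => ⟪z, e⟫ - ⟪y, e⟫) x := by
    obtain ⟨α, hα, β, hβ, hs⟩ := exists_slice_eq_Ioo hB hBb he hx
    rw [sliceMid_eq he (hα.trans hβ) hs, (sliceAvg_eq_of_Ioo (hα.trans hβ) hs).2]
    have : ∀ t : ℝ, ⟪x + t • e, e⟫ - ⟪y, e⟫ = t - (⟪y, e⟫ -⟪x, e⟫) := fun t => by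
      rw [inner_add_smul_self he]; ring
    simp_rw [this]
    rw [setIntegral_Ioo_sub (hα.trans hβ).le]
    field_simp [(sub_pos.2 (hα.trans hβ)).ne']
    ring
  rw [h1]
  refine abs_sliceAvg_le hB hBb he (fun z hz => ?_) hx
  rw [← inner_sub_left]
  refine (abs_real_inner_le_norm _ _).trans ?_
  rw [he, mul_one, ← dist_eq_norm]
  exact Metric.dist_le_diam_of_mem hBb hz hy

theorem setIntegral_sliceMid (hB : IsOpen B) (hBb : Bornology.IsBounded B) (he : ‖e‖ = 1) :
    ∫ x in B, sliceMid B e x = ∫ x in B, ⟪x, e⟫ := by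
  obtain ⟨R, hR⟩ := hBb.subset_closedBall 0
  refine setIntegral_sliceAvg hB hBb he (by fun_prop) (H := R) fun x hx => ?_
  refine (abs_real_inner_le_norm _ _).trans ?_
  rw [he, mul_one]; simpa using hR hx

theorem sliceMid_deficit_pointwise (hB : IsOpen B) (hBb : Bornology.IsBounded B) (he : ‖e‖ = 1)
    {a : ℝ} (ha : 0 < a) {x y : Plane} (hx : x ∈ B) (hy : y ∈ B) :
    (sliceMid B e x - sliceMid B e y) ^ 2 / (Metric.diam B ^ 2 + a ^ 2) ≤
      (sliceMid B e x - sliceMid B e y) *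
        sliceAvg B e (fun y' => sliceAvg B e (fun x' => regKer a e (x' - y')) x) y := by
  obtain ⟨α, hα, β, hβ, hs⟩ := exists_slice_eq_Ioo hB hBb he hx
  obtain ⟨α', hα', β', hβ', hs'⟩ := exists_slice_eq_Ioo hB hBb he hy
  have h1 := hα.trans hβ
  have h2 := hα'.trans hβ'
  set D := Metric.diam B
  rw [sliceMid_eq he h1 hs, sliceMid_eq he h2 hs', (sliceAvg_eq_of_Ioo h2 hs').2]
  simp_rw [(sliceAvg_eq_of_Ioo h1 hs).2]
  rw [integral_div, div_div]
  set ξ := ⟪x, e⟫ with hξ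
  set ζ := ⟪y, e⟫ with hζ
  set w := ‖x - y‖ ^ 2 - (ξ - ζ) ^ 2 with hw
  have hin : ⟪x - y, e⟫ = ξ - ζ := by rw [inner_sub_left]
  have hw0 : 0 ≤ w := by
    have := abs_real_inner_le_norm (x - y) e
    rw [he, mul_one, hin] at this
    have := sq_le_sq' (by linarith [abs_nonneg (ξ - ζ), norm_nonneg (x - y)]) this
    rw [sq_abs] at this
    linarith
  have hz : ∀ s t : ℝ, x + s • e - (y + t • e) = (x - y) + (s - t) • e := fun s t => by module
  have hinner : ∀ s t : ℝ, ⟪x + s • e - (y + t • e), e⟫ = (ξ + s) - (ζ + t) := fun s t => by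
    rw [hz, inner_add_smul_self he, hin]; ring
  have hnorm : ∀ s t : ℝ, ‖x + s • e - (y + t • e)‖ ^ 2 = w + ((ξ + s) - (ζ + t)) ^ 2 := by
    intro s t
    rw [hz, norm_add_sq_real, inner_smul_right, hin, norm_smul, he, hw]
    simp only [Real.norm_eq_abs, mul_one, sq_abs]
    ring
  set k₀ : ℝ → ℝ := fun v => v / (w + v ^ 2 + a ^ 2) with hk₀
  set k : ℝ → ℝ := fun v => v * max ((w + v ^ 2 + a ^ 2)⁻¹ - (D ^ 2 + a ^ 2)⁻¹) 0 with hk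
  have hkc : Continuous k := by
    refine continuous_id.mul (Continuous.max (Continuous.sub (Continuous.inv₀ (by fun_prop)
      fun v => by positivity) continuous_const) continuous_const)
  have key := setIntegral_kernel_ge (k := k) (k₀ := k₀) (a := ξ + α) (b := ξ + β) (c := ζ + α')
    (d := ζ + β') (c₀ := (D ^ 2 + a ^ 2)⁻¹) hkc (fun v => by simp [hk])
    (fun v hv => mul_nonneg hv (le_max_right _ _)) (by linarith) (by linarith) (by
      intro t ht s hs2
      have hm1 : x + (s - ξ) • e ∈ B := by
        have : (s - ξ) ∈ {t : ℝ | (x, t) ∈ sliceSet B e} := by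
          rw [hs]; exact ⟨by linarith [hs2.1], by linarith [hs2.2]⟩
        exact (mem_of_mem_sliceSet this).2
      have hm2 : y + (t - ζ) • e ∈ B := by
        have : (t - ζ) ∈ {t : ℝ | (y, t) ∈ sliceSet B e} := by
          rw [hs']; exact ⟨by linarith [ht.1], by linarith [ht.2]⟩
        exact (mem_of_mem_sliceSet this).2
      have h3 := Metric.dist_le_diam_of_mem hBb hm1 hm2
      rw [dist_eq_norm] at h3
      have h4 := hnorm (s - ξ) (t - ζ)
      rw [add_sub_cancel, add_sub_cancel] at h4
      have h5 : w + (s - t) ^ 2 ≤ D ^ 2 := by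
        rw [← h4]; exact pow_le_pow_left₀ (norm_nonneg _) h3 2
      have h6 : (D ^ 2 + a ^ 2)⁻¹ ≤ (w + (s - t) ^ 2 + a ^ 2)⁻¹ :=
        inv_anti₀ (by positivity) (by linarith)
      simp only [hk, hk₀]
      rw [max_eq_left (by linarith)]
      ring)
  have hshift : ∫ t in Set.Ioo (ζ + α') (ζ + β'), ∫ s in Set.Ioo (ξ + α) (ξ + β), k₀ (s - t)
      = ∫ t in Set.Ioo α' β', ∫ s in Set.Ioo α β, regKer a e (x + s • e - (y + t • e)) := by
    simp only [← integral_Ioc_eq_integral_Ioo]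
    rw [← intervalIntegral.integral_of_le (by linarith), ← intervalIntegral.integral_of_le h2.le,
      ← intervalIntegral.integral_comp_add_left]
    congr 1; funext t
    rw [← intervalIntegral.integral_of_le (by linarith), ← intervalIntegral.integral_of_le h1.le,
      ← intervalIntegral.integral_comp_add_left]
    congr 1; funext s
    rw [regKer, hinner, hnorm]
  rw [hshift] at key
  set X := ∫ t in Set.Ioo α' β', ∫ s in Set.Ioo α β, regKer a e (x + s • e - (y + t • e))
  have h7 : 0 < (β - α) * (β' - α') := mul_pos (by linarith) (by linarith)
  have h8 : (ξ + α + (ξ + β)) / 2 - (ζ + α' + (ζ + β')) / 2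
      = ξ + (α + β) / 2 - (ζ + (α' + β') / 2) := by ring
  rw [h8] at key
  have h9 : (ξ + β - (ξ + α)) * (ζ + β' - (ζ + α')) = (β - α) * (β' - α') := by ring
  rw [h9] at key
  rw [← mul_div_assoc, le_div_iff₀ h7, div_mul_eq_mul_div, div_eq_inv_mul]
  linarith

theorem sliceMid_deficit (hB : IsOpen B) (hBb : Bornology.IsBounded B) (he : ‖e‖ = 1)
    {a : ℝ} (ha : 0 < a) :
    (∫ x in B, ∫ y in B, (sliceMid B e x - sliceMid B e y) ^ 2) / (Metric.diam B ^ 2 + a ^ 2) ≤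
      ∫ x in B, ∫ y in B, (sliceMid B e x - sliceMid B e y) * regKer a e (x - y) := by
  have hBm := hB.measurableSet
  have hfin : volume B ≠ ⊤ := hBb.measure_lt_top.ne
  set m := sliceMid B e with hm
  set D := Metric.diam B
  have hmm : Measurable m := measurable_sliceMid hB e
  have hmd : Measurable (fun p : Plane × Plane => m p.1 - m p.2) :=
    (hmm.comp measurable_fst).sub (hmm.comp measurable_snd)
  have hdb : ∀ x ∈ B, ∀ y ∈ B, |m x - m y| ≤ 2 * D := by
    intro x hx y hy
    have h1 := abs_sliceMid_sub_le hB hBb he hx hx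
    have h2 := abs_sliceMid_sub_le hB hBb he hy hx
    rw [abs_sub_comm] at h2
    have h3 := abs_sub_le (m x) ⟪x, e⟫ (m y)
    simp only [hm] at h3 ⊢
    linarith
  have hD : 0 ≤ D := Metric.diam_nonneg
  set K₁ : Plane → Plane → ℝ := fun x y => sliceAvg B e (fun x' => regKer a e (x' - y)) x with hK₁
  have hkm : Measurable (regKer a e) := (continuous_regKer ha e).measurable
  have hK₁m : Measurable (Function.uncurry K₁) := measurable_sliceAvg_sub hB hkm
  have hK₁x : ∀ x, Measurable (K₁ x) := fun x => hK₁m.of_uncurry_left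
  have hK₁b : ∀ x ∈ B, ∀ y, |K₁ x y| ≤ a⁻¹ := fun x hx y =>
    abs_sliceAvg_le hB hBb he (fun _ _ => abs_regKer_le ha he _) hx
  have hbd : ∀ (K : Plane → Plane → ℝ), (∀ x ∈ B, ∀ y, |K x y| ≤ a⁻¹) →
      ∀ x ∈ B, ∀ y ∈ B, |(m x - m y) * K x y| ≤ 2 * D * a⁻¹ := by
    intro K hK x hx y hy
    rw [abs_mul]
    exact mul_le_mul (hdb x hx y hy) (hK x hx y) (abs_nonneg _) (by positivity)
  have hb0 := hbd (fun x y => regKer a e (x - y)) (fun x _ y => abs_regKer_le ha he _)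
  have hb1 := hbd K₁ hK₁b
  have s1 := (setIntegral_swap_of_bounded hBm hfin
    (F := fun x y => (m x - m y) * regKer a e (x - y))
    (hmd.mul (hkm.comp (by fun_prop))) hb0).2
  have s2 : ∀ y ∈ B, ∫ x in B, (m x - m y) * regKer a e (x - y) = ∫ x in B, (m x - m y) * K₁ x y := by
    intro y hy
    rw [← setIntegral_sliceAvg hB hBb he (h := fun x => (m x - m y) * regKer a e (x - y))
      ((hmm.sub_const _).mul (hkm.comp (by fun_prop))) (fun x hx => hb0 x hx y hy)]
    refine setIntegral_congr_fun hBm fun x hx => ?_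
    exact sliceAvg_const_mul (c := fun x => m x - m y)
      (fun t ht => by simp only [hm, sliceMid_add ht])
  have s3 := (setIntegral_swap_of_bounded hBm hfin
    (F := fun x y => (m x - m y) * K₁ x y) (hmd.mul hK₁m) hb1)
  have s4 : ∀ x ∈ B, ∫ y in B, (m x - m y) * K₁ x y
      = ∫ y in B, (m x - m y) * sliceAvg B e (K₁ x) y := by
    intro x hx
    rw [← setIntegral_sliceAvg hB hBb he (h := fun y => (m x - m y) * K₁ x y)
      ((hmm.const_sub _).mul (hK₁x x)) (fun y hy => hb1 x hx y hy)]
    refine setIntegral_congr_fun hBm fun y hy => ?_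
    exact sliceAvg_const_mul (c := fun y => m x - m y)
      (fun t ht => by simp only [hm, sliceMid_add ht])
  rw [s1, setIntegral_congr_fun hBm s2, ← s3.2, ← integral_div]
  have s5 := (setIntegral_swap_of_bounded hBm hfin (F := fun x y => (m x - m y) ^ 2)
    (hmd.pow_const 2) (H := (2 * D) ^ 2) (fun x hx y hy => by
      rw [abs_pow]; exact pow_le_pow_left₀ (abs_nonneg _) (hdb x hx y hy) 2)).1
  have i5 : IntegrableOn (fun x => ∫ y in B, (m x - m y) ^ 2) B := s5.integral_prod_left
  have i3 : IntegrableOn (fun x => ∫ y in B, (m x - m y) * K₁ x y) B := s3.1.integral_prod_left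
  have i6 : IntegrableOn (fun x => (∫ y in B, (m x - m y) ^ 2) / (D ^ 2 + a ^ 2)) B :=
    i5.div_const _
  refine setIntegral_mono_on i6 i3 hBm fun x hx => ?_
  rw [s4 x hx, ← integral_div]
  refine setIntegral_mono_on ?_ ?_ hBm fun y hy => sliceMid_deficit_pointwise hB hBb he ha hx hy
  · refine Measure.integrableOn_of_bounded (M := (2 * D) ^ 2 / (D ^ 2 + a ^ 2)) hfin
      (((hmm.const_sub _).pow_const 2).div_const _).aestronglyMeasurable
      ((ae_restrict_iff' hBm).2 (ae_of_all _ fun y hy => ?_))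
    rw [Real.norm_of_nonneg (by positivity)]
    refine div_le_div_of_nonneg_right ?_ (by positivity)
    rw [← sq_abs]; exact pow_le_pow_left₀ (abs_nonneg _) (hdb x hx y hy) 2
  · refine Measure.integrableOn_of_bounded (M := 2 * D * a⁻¹) hfin
      ((hmm.const_sub _).mul (measurable_sliceAvg hB e
        (hK₁x x))).aestronglyMeasurable
      ((ae_restrict_iff' hBm).2 (ae_of_all _ fun y hy => ?_))
    rw [Real.norm_eq_abs, abs_mul]
    exact mul_le_mul (hdb x hx y hy) (abs_sliceAvg_le hB hBb he (fun y' _ => hK₁b x hx y') hy)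
      (abs_nonneg _) (by positivity)

end Mid

theorem le_of_forall_pos_le_of_continuous {X : ℝ} {F : ℝ → ℝ} (hF : Continuous F)
    (h : ∀ b, 0 < b → X ≤ F b) : X ≤ F 0 := by
  have h1 : Tendsto F (nhdsWithin 0 (Set.Ioi 0)) (nhds (F 0)) :=
    tendsto_nhdsWithin_of_tendsto_nhds hF.continuousAt
  exact ge_of_tendsto h1 (eventually_mem_nhdsWithin.mono fun b hb => h b hb)

theorem abs_log_one_add_sub_le {s : ℝ} (hs : |s| ≤ 1 / 2) : |log (1 + s) - s| ≤ 2 * s ^ 2 := by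
  have h := Real.abs_log_sub_add_sum_range_le (x := -s) (by rw [abs_neg]; linarith) 1
  simp only [Finset.range_one, Finset.sum_singleton, zero_add, pow_one, Nat.cast_zero,
    div_one, sub_neg_eq_add, abs_neg] at h
  have h8 : |s| ^ (1 + 1) / (1 - |s|) ≤ 2 * s ^ 2 := by
    rw [div_le_iff₀ (by linarith)]
    have : |s| ^ (1 + 1) = s ^ 2 := by rw [one_add_one_eq_two, sq_abs]
    rw [this]; nlinarith [sq_nonneg s]
  rw [sub_eq_neg_add]
  exact h.trans h8

theorem abs_reg_log_taylor {e : Plane} (he : ‖e‖ = 1) {a t : ℝ} (ha : 0 < a) (ht : 0 ≤ t)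
    (hta : t ≤ a / 8) (z : Plane) :
    |log (‖z + t • e‖ ^ 2 + a ^ 2) / 2 - log (‖z‖ ^ 2 + a ^ 2) / 2 - t * regKer a e z|
      ≤ 6 * t ^ 2 / a ^ 2 := by
  set N := ‖z‖ ^ 2 + a ^ 2 with hN
  have hN0 : 0 < N := by positivity
  have hk := abs_regKer_le ha he z
  set s := 2 * t * regKer a e z + t ^ 2 / N with hs
  have hexp : ‖z + t • e‖ ^ 2 + a ^ 2 = N * (1 + s) := by
    rw [norm_add_sq_real, inner_smul_right, norm_smul, he, hs, regKer, ← hN]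
    field_simp
    rw [Real.norm_eq_abs, sq_abs, hN]; ring
  have hNa : t ^ 2 / N ≤ t ^ 2 / a ^ 2 :=
    div_le_div_of_nonneg_left (sq_nonneg t) (by positivity) (by rw [hN]; nlinarith [sq_nonneg ‖z‖])
  have hq : t / a ≤ 1 / 8 := by rw [div_le_iff₀ ha]; linarith
  have hq0 : 0 ≤ t / a := by positivity
  have hsq : t ^ 2 / a ^ 2 = (t / a) ^ 2 := by rw [div_pow]
  have hsN : 0 ≤ t ^ 2 / N := by positivity
  have hs1 : |s| ≤ 17 / 8 * (t / a) := by
    refine (abs_add_le _ _).trans ?_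
    rw [abs_of_nonneg hsN, abs_mul, abs_of_nonneg (by linarith : 0 ≤ 2 * t)]
    have : 2 * t * |regKer a e z| ≤ 2 * t * a⁻¹ := by gcongr
    have h3 : 2 * t * a⁻¹ = 2 * (t / a) := by rw [div_eq_mul_inv]; ring
    nlinarith
  have h1s : 0 < 1 + s := by linarith [(abs_le.1 hs1).1]
  have h4 := abs_log_one_add_sub_le (s := s) (by linarith)
  rw [hexp, log_mul hN0.ne' h1s.ne']
  have h5 : (log N + log (1 + s)) / 2 - log N / 2 - t * regKer a e z
      = (log (1 + s) - s) / 2 + t ^ 2 / N / 2 := by rw [hs]; ring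
  rw [h5]
  refine (abs_add_le _ _).trans ?_
  rw [abs_div, abs_div, abs_of_nonneg hsN, abs_two, mul_div_assoc, hsq]
  have h6 : s ^ 2 ≤ (17 / 8 * (t / a)) ^ 2 := by
    rw [← sq_abs]; exact pow_le_pow_left₀ (abs_nonneg _) hs1 2
  rw [hsq] at hNa
  nlinarith

section

variable {B : Set Plane} {e : Plane} {ρ : Plane → ℝ} {P : ℝ}

/-- Minus the derivative in the direction `e` of `regPot`. -/
def regGrad (a : ℝ) (ρ : Plane → ℝ) (B : Set Plane) (e x : Plane) : ℝ :=
  ∫ y in B, ρ y * regKer a e (x - y)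

theorem integrableOn_regGrad (hBm : MeasurableSet B) (hfin : volume B ≠ ⊤) (he : ‖e‖ = 1)
    (hρ : Measurable ρ) (hP : ∀ y ∈ B, |ρ y| ≤ P) {a : ℝ} (ha : 0 < a) (x : Plane) :
    IntegrableOn (fun y => ρ y * regKer a e (x - y)) B :=
  integrableOn_bdd_mul hBm hρ hP (Measure.integrableOn_of_bounded hfin
    ((continuous_regKer ha e).comp (by fun_prop)).aestronglyMeasurable
    (ae_of_all _ fun y => abs_regKer_le ha he (x - y)))

theorem measurable_regGrad (hρ : Measurable ρ) {a : ℝ} (ha : 0 < a) :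
    Measurable (regGrad a ρ B e) := by
  have : Measurable (Function.uncurry fun x y : Plane => ρ y * regKer a e (x - y)) :=
    (hρ.comp measurable_snd).mul ((continuous_regKer ha e).measurable.comp (by fun_prop))
  exact (this.stronglyMeasurable.integral_prod_right (ν := volume.restrict B)).measurable

theorem abs_regGrad_le (hBm : MeasurableSet B) (hfin : volume B ≠ ⊤) (he : ‖e‖ = 1)
    (hP : ∀ y ∈ B, |ρ y| ≤ P) (hP0 : 0 ≤ P) {a : ℝ} (ha : 0 < a) (x : Plane) :
    |regGrad a ρ B e x| ≤ P * (volume.real B * a⁻¹) :=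
  abs_setIntegral_mul_le (g := fun _ => a⁻¹) hBm hP hP0 (integrableOn_const hfin)
    (ae_of_all _ fun y => abs_regKer_le ha he (x - y)) (by simp)

theorem abs_regPot_taylor (hBm : MeasurableSet B) (hBb : Bornology.IsBounded B) (he : ‖e‖ = 1)
    (hρ : Measurable ρ) (hP : ∀ y ∈ B, |ρ y| ≤ P) (hP0 : 0 ≤ P) {a t : ℝ} (ha : 0 < a)
    (ht : 0 ≤ t) (hta : t ≤ a / 8) (x : Plane) :
    |regPot a ρ B (x + t • e) - regPot a ρ B x + t * regGrad a ρ B e x|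
      ≤ P * (volume.real B * (6 * t ^ 2 / a ^ 2)) := by
  have hfin : volume B ≠ ⊤ := hBb.measure_lt_top.ne
  unfold regPot regGrad
  have i1 := integrableOn_regPot hBm hBb hρ hP ha (x + t • e)
  have i2 := integrableOn_regPot hBm hBb hρ hP ha x
  have i3 := integrableOn_regGrad hBm hfin he hρ hP ha x
  have i12 : IntegrableOn (fun y => ρ y * -(log (‖x + t • e - y‖ ^ 2 + a ^ 2) / 2)
      - ρ y * -(log (‖x - y‖ ^ 2 + a ^ 2) / 2)) B := i1.sub i2
  rw [← integral_const_mul, ← integral_sub i1 i2, ← integral_add i12 (i3.const_mul t)]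
  have : ∀ y, ρ y * -(log (‖x + t • e - y‖ ^ 2 + a ^ 2) / 2) - ρ y * -(log (‖x - y‖ ^ 2 + a ^ 2) / 2)
      + t * (ρ y * regKer a e (x - y)) = ρ y * -(log (‖(x - y) + t • e‖ ^ 2 + a ^ 2) / 2
        - log (‖x - y‖ ^ 2 + a ^ 2) / 2 - t * regKer a e (x - y)) := by
    intro y
    rw [show x + t • e - y = (x - y) + t • e by module]; ring
  simp_rw [this]
  refine abs_setIntegral_mul_le (g := fun _ => 6 * t ^ 2 / a ^ 2) hBm hP hP0
    (integrableOn_const hfin) (ae_of_all _ fun y => ?_) (by simp)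
  rw [abs_neg]
  exact abs_reg_log_taylor he ha ht hta (x - y)

theorem continuous_logPot (hBm : MeasurableSet B) (hBb : Bornology.IsBounded B)
    (hρ : Measurable ρ) (hP : ∀ y ∈ B, |ρ y| ≤ P) (hP0 : 0 ≤ P) : Continuous (logPot ρ B) := by
  have h0 : 0 ≤ 2 * P * (2 * π + volume.real B) := by positivity
  refine (LipschitzWith.of_dist_le_mul (K := ⟨_, h0⟩) fun x y => ?_).continuous
  rw [Real.dist_eq, dist_eq_norm]
  exact abs_logPot_sub_le hBm hBb hρ hP hP0 x y

theorem integrableOn_of_lipschitz (hB : IsOpen B) (hBb : Bornology.IsBounded B)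
    {h : Plane → ℝ} {lam : ℝ} (hlip : ∀ x ∈ B, ∀ y ∈ B, |h x - h y| ≤ lam * ‖x - y‖) :
    IntegrableOn h B := by
  rcases B.eq_empty_or_nonempty with rfl | ⟨p, hp⟩
  · simp
  have hlip' : ∀ x ∈ B, ∀ y ∈ B, |h x - h y| ≤ |lam| * ‖x - y‖ := fun x hx y hy =>
    (hlip x hx y hy).trans (mul_le_mul_of_nonneg_right (le_abs_self _) (norm_nonneg _))
  have hc : ContinuousOn h B := by
    refine (LipschitzOnWith.of_dist_le_mul (K := ⟨|lam|, abs_nonneg _⟩)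
      fun x hx y hy => ?_).continuousOn
    rw [Real.dist_eq, dist_eq_norm]
    exact hlip' x hx y hy
  refine Integrable.mono' (g := fun _ => |h p| + |lam| * Metric.diam B)
    (integrableOn_const hBb.measure_lt_top.ne) (hc.aestronglyMeasurable hB.measurableSet)
    ((ae_restrict_iff' hB.measurableSet).2 (ae_of_all _ fun x hx => ?_))
  have h1 := hlip' x hx p hp
  have h2 := Metric.dist_le_diam_of_mem hBb hx hp
  rw [dist_eq_norm] at h2
  have h3 : |lam| * ‖x - p‖ ≤ |lam| * Metric.diam B := by gcongr
  have h4 : |h x| ≤ |h x - h p| + |h p| := by simpa using abs_add_le (h x - h p) (h p)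
  rw [Real.norm_eq_abs]; linarith

theorem patch_integration_by_parts (hB : IsOpen B) (hBb : Bornology.IsBounded B) (he : ‖e‖ = 1)
    (hρ : Measurable ρ) (hP : ∀ y ∈ B, |ρ y| ≤ P) (hP0 : 0 ≤ P) {h g : Plane → ℝ}
    {c γ G lam Λ R : ℝ} (hG : 0 ≤ G) (hΛ : 0 ≤ Λ) (hlam : 0 ≤ lam) (hR : 0 < R)
    (hgm : Measurable g) (hgG : ∀ x ∈ B, |g x| ≤ G)
    (hgs : ∀ x t, (x, t) ∈ sliceSet B e → g (x + t • e) = g x + γ * t)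
    (hlip : ∀ x ∈ B, ∀ y ∈ B, |h x - h y| ≤ lam * ‖x - y‖)
    (hf0 : ∀ x ∈ B, 0 ≤ logPot ρ B x - c + h x)
    (hfΛ : ∀ x ∈ B, ∀ z ∉ B, ‖x - z‖ ≤ R → logPot ρ B x - c + h x ≤ Λ * ‖x - z‖)
    {b : ℝ} (hb : 0 < b) :
    |γ * (∫ x in B, (logPot ρ B x - c + h x)) - ∫ x in B, g x * regGrad (b ^ 2) ρ B e x|
      ≤ (lam + 2 * P * (2 * π + volume.real B) * b) * G * volume.real B := by
  have hBm := hB.measurableSet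
  have hfin : volume B ≠ ⊤ := hBb.measure_lt_top.ne
  have ha : 0 < b ^ 2 := by positivity
  have hM : 0 ≤ volume.real B := measureReal_nonneg
  have hfi : IntegrableOn (fun x => logPot ρ B x - c + h x) B := by
    refine Integrable.add (Integrable.sub ?_ (integrableOn_const hfin))
      (integrableOn_of_lipschitz hB hBb hlip)
    exact ((continuous_logPot hBm hBb hρ hP hP0).continuousOn.integrableOn_compact
      hBb.isCompact_closure).mono_set subset_closure
  have hgv : IntegrableOn (fun x => g x * regGrad (b ^ 2) ρ B e x) B :=
    integrableOn_bdd_mul hBm hgm hgG (Measure.integrableOn_of_bounded hfin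
      (measurable_regGrad hρ ha).aestronglyMeasurable
      (ae_of_all _ fun x => abs_regGrad_le hBm hfin he hP hP0 ha x))
  have key := slice_integration_by_parts hB hBb he
    (f := fun x => logPot ρ B x - c + h x) (g := g)
    (v := fun x => -regGrad (b ^ 2) ρ B e x) (γ := γ) (G := G)
    (lam := lam + 2 * P * (2 * π + volume.real B) * b) (Λ := Λ)
    (C := P * (volume.real B * (6 / (b ^ 2) ^ 2))) (V := P * (volume.real B * (b ^ 2)⁻¹))
    (R := min R (b ^ 2 / 8)) hG hΛ (by positivity) (by positivity) hgm
    (measurable_regGrad hρ ha).neg hgG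
    (fun x _ => by rw [abs_neg]; exact abs_regGrad_le hBm hfin he hP hP0 ha x) hgs hfi hf0
    (fun x hx z hz hxz => hfΛ x hx z hz (hxz.trans (min_le_left _ _))) (by
      intro x t ht htR hxt
      obtain ⟨hx1, hx2⟩ := mem_of_mem_sliceSet hxt
      have h1 := abs_regPot_taylor hBm hBb he hρ hP hP0 ha ht.le (htR.trans (min_le_right _ _)) x
      have h2 := abs_logPot_sub_regPot_sub_le hBm hBb hρ hP hP0 hb (x + t • e) x
      have h3 := hlip _ hx2 _ hx1
      rw [add_sub_cancel_left, norm_smul, he, mul_one, Real.norm_of_nonneg ht.le] at h2 h3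
      have h4 : P * (volume.real B * (6 * t ^ 2 / (b ^ 2) ^ 2))
          = t * (P * (volume.real B * (6 / (b ^ 2) ^ 2)) * t) := by ring
      rw [h4] at h1
      have h5 : logPot ρ B (x + t • e) - c + h (x + t • e) - (logPot ρ B x - c + h x)
          - t * -regGrad (b ^ 2) ρ B e x
          = (regPot (b ^ 2) ρ B (x + t • e) - regPot (b ^ 2) ρ B x + t * regGrad (b ^ 2) ρ B e x)
          + ((logPot ρ B (x + t • e) - regPot (b ^ 2) ρ B (x + t • e))
            - (logPot ρ B x - regPot (b ^ 2) ρ B x)) + (h (x + t • e) - h x) := by ring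
      rw [h5]
      refine (abs_add_le _ _).trans ((add_le_add_left (abs_add_le _ _) _).trans ?_)
      linarith)
  have hgv' : Integrable (fun x => g x * -regGrad (b ^ 2) ρ B e x) (volume.restrict B) := by
    simp only [mul_neg]
    exact Integrable.neg hgv
  rw [integral_add hgv' (hfi.const_mul γ), integral_const_mul] at key
  simp only [mul_neg, integral_neg] at key
  rwa [neg_add_eq_sub] at key

end

/-- A superlevel set of a perturbed logarithmic potential of itself: on `B` the function
`logPot ρ B - c + h` is positive and near `B` but outside of it this function is nonpositive;
the density `ρ` and the perturbation `h` are `lam`-Lipschitz. -/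
structure IsPatch (B : Set Plane) (p : Plane) (ρ h : Plane → ℝ) (c lam R : ℝ) : Prop where
  isOpen : IsOpen B
  bounded : Bornology.IsBounded B
  conn : IsPreconnected B
  mem : p ∈ B
  meas : Measurable ρ
  dens_one : ρ p = 1
  dens_lip : ∀ x ∈ B, ∀ y ∈ B, |ρ x - ρ y| ≤ lam * ‖x - y‖
  pert_zero : h p = 0
  pert_lip : ∀ x ∈ Metric.closedBall p (Metric.diam B + R),
    ∀ y ∈ Metric.closedBall p (Metric.diam B + R), |h x - h y| ≤ lam * ‖x - y‖
  lam_nonneg : 0 ≤ lam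
  one_le : 1 ≤ R
  pos : ∀ x ∈ B, 0 < logPot ρ B x - c + h x
  nonpos : ∀ x ∈ Metric.closedBall p (Metric.diam B + R), x ∉ B → logPot ρ B x - c + h x ≤ 0

namespace IsPatch

variable {B : Set Plane} {p : Plane} {ρ h : Plane → ℝ} {c lam R τ : ℝ}

theorem measurableSet (H : IsPatch B p ρ h c lam R) : MeasurableSet B := H.isOpen.measurableSet

theorem volume_ne_top (H : IsPatch B p ρ h c lam R) : volume B ≠ ⊤ := H.bounded.measure_lt_top.ne

theorem volume_pos (H : IsPatch B p ρ h c lam R) : 0 < volume.real B :=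
  ENNReal.toReal_pos (H.isOpen.measure_pos volume ⟨p, H.mem⟩).ne' H.volume_ne_top

theorem norm_sub_le (H : IsPatch B p ρ h c lam R) {x y : Plane} (hx : x ∈ B) (hy : y ∈ B) :
    ‖x - y‖ ≤ Metric.diam B := by
  rw [← dist_eq_norm]; exact Metric.dist_le_diam_of_mem H.bounded hx hy

theorem mem_closedBall (H : IsPatch B p ρ h c lam R) {x z : Plane} (hx : x ∈ B)
    (hz : ‖x - z‖ ≤ R) : z ∈ Metric.closedBall p (Metric.diam B + R) := by
  rw [mem_closedBall_iff_norm, ← norm_neg]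
  have h1 := H.norm_sub_le H.mem hx
  have h2 := norm_add_le (p - x) (x - z)
  rw [sub_add_sub_cancel] at h2
  rw [neg_sub]; linarith

theorem mem_closedBall_self (H : IsPatch B p ρ h c lam R) {x : Plane} (hx : x ∈ B) :
    x ∈ Metric.closedBall p (Metric.diam B + R) :=
  H.mem_closedBall hx (by rw [sub_self, norm_zero]; linarith [H.one_le])

theorem lam_mul_diam_le (H : IsPatch B p ρ h c lam R) (hτ : lam * (Metric.diam B + R) ≤ τ) :
    lam * Metric.diam B ≤ τ :=
  le_trans (by nlinarith [H.lam_nonneg, H.one_le]) hτ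

theorem nonneg_of_le (H : IsPatch B p ρ h c lam R) (hτ : lam * (Metric.diam B + R) ≤ τ) : 0 ≤ τ :=
  le_trans (mul_nonneg H.lam_nonneg Metric.diam_nonneg) (H.lam_mul_diam_le hτ)

theorem abs_pert_le (H : IsPatch B p ρ h c lam R) (hτ : lam * (Metric.diam B + R) ≤ τ) {x : Plane}
    (hx : x ∈ Metric.closedBall p (Metric.diam B + R)) : |h x| ≤ τ := by
  have h1 := H.pert_lip x hx p (H.mem_closedBall_self H.mem)
  rw [H.pert_zero, sub_zero] at h1
  rw [mem_closedBall_iff_norm] at hx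
  exact (h1.trans (mul_le_mul_of_nonneg_left hx H.lam_nonneg)).trans hτ

theorem abs_dens_sub_one_le (H : IsPatch B p ρ h c lam R) (hτ : lam * (Metric.diam B + R) ≤ τ)
    {x : Plane} (hx : x ∈ B) : |ρ x - 1| ≤ τ := by
  have h1 := H.dens_lip x hx p H.mem
  rw [H.dens_one] at h1
  exact (h1.trans (mul_le_mul_of_nonneg_left (H.norm_sub_le hx H.mem) H.lam_nonneg)).trans
    (H.lam_mul_diam_le hτ)

theorem abs_dens_le (H : IsPatch B p ρ h c lam R) (hτ : lam * (Metric.diam B + R) ≤ τ)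
    (hτ8 : τ ≤ 1 / 8) {x : Plane} (hx : x ∈ B) : |ρ x| ≤ 3 / 2 := by
  have h1 := abs_le.1 (H.abs_dens_sub_one_le hτ hx)
  rw [abs_le]; constructor <;> linarith

/-- Lipschitz constant of `logPot ρ B - c + h`. -/
theorem abs_sub_le (H : IsPatch B p ρ h c lam R) (hτ : lam * (Metric.diam B + R) ≤ τ)
    (hτ8 : τ ≤ 1 / 8) {x z : Plane} (hx : x ∈ Metric.closedBall p (Metric.diam B + R))
    (hz : z ∈ Metric.closedBall p (Metric.diam B + R)) :
    |(logPot ρ B x - c + h x) - (logPot ρ B z - c + h z)|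
      ≤ (3 * (2 * π + volume.real B) + lam) * ‖x - z‖ := by
  have h1 := abs_logPot_sub_le H.measurableSet H.bounded H.meas
    (fun y hy => H.abs_dens_le hτ hτ8 hy) (by norm_num) x z
  have h2 := H.pert_lip x hx z hz
  have h3 : (logPot ρ B x - c + h x) - (logPot ρ B z - c + h z)
    = (logPot ρ B x - logPot ρ B z) + (h x - h z) := by ring
  rw [h3]
  refine (abs_add_le _ _).trans ?_
  linarith

theorem le_slope_mul (H : IsPatch B p ρ h c lam R) (hτ : lam * (Metric.diam B + R) ≤ τ)
    (hτ8 : τ ≤ 1 / 8) {x z : Plane} (hx : x ∈ B) (hz : z ∉ B) (hxz : ‖x - z‖ ≤ R) :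
    logPot ρ B x - c + h x ≤ (3 * (2 * π + volume.real B) + lam) * ‖x - z‖ := by
  have h1 := le_of_abs_le (H.abs_sub_le hτ hτ8 (H.mem_closedBall_self hx) (H.mem_closedBall hx hxz))
  have h2 := H.nonpos z (H.mem_closedBall hx hxz) hz
  linarith

theorem pert_lip_self (H : IsPatch B p ρ h c lam R) :
    ∀ x ∈ B, ∀ y ∈ B, |h x - h y| ≤ lam * ‖x - y‖ := fun x hx y hy =>
  H.pert_lip x (H.mem_closedBall_self hx) y (H.mem_closedBall_self hy)

theorem integrableOn (H : IsPatch B p ρ h c lam R) (hτ : lam * (Metric.diam B + R) ≤ τ)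
    (hτ8 : τ ≤ 1 / 8) : IntegrableOn (fun x => logPot ρ B x - c + h x) B := by
  refine integrableOn_of_lipschitz H.isOpen H.bounded (lam := 3 * (2 * π + volume.real B) + lam)
    fun x hx y hy => H.abs_sub_le hτ hτ8 (H.mem_closedBall_self hx) (H.mem_closedBall_self hy)

end IsPatch

section Virial

variable {B : Set Plane}

theorem integrableOn_reg_ratio (hBb : Bornology.IsBounded B) {a : ℝ} (ha : 0 < a) (x : Plane) :
    IntegrableOn (fun y => ‖x - y‖ ^ 2 / (‖x - y‖ ^ 2 + a ^ 2)) B := by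
  refine Measure.integrableOn_of_bounded (M := 1) hBb.measure_lt_top.ne ?_ (ae_of_all _ fun y => ?_)
  · exact (Continuous.div (by fun_prop) (by fun_prop)
      (fun y => by positivity)).aestronglyMeasurable
  · rw [Real.norm_of_nonneg (by positivity)]
    exact div_le_one_of_le₀ (by nlinarith) (by positivity)

theorem setIntegral_reg_ge (hB : MeasurableSet B) (hBb : Bornology.IsBounded B) {a : ℝ}
    (ha : 0 < a) (x : Plane) :
    volume.real B - a * (2 * π + volume.real B) ≤ ∫ y in B, ‖x - y‖ ^ 2 / (‖x - y‖ ^ 2 + a ^ 2) := by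
  have hfin : volume B ≠ ⊤ := hBb.measure_lt_top.ne
  have i1 := integrableOn_inv_norm hB hfin x
  have h1 : ∫ y in B, (1 - a * ‖x - y‖⁻¹) = volume.real B - a * ∫ y in B, ‖x - y‖⁻¹ := by
    have i0 : IntegrableOn (fun _ : Plane => (1 : ℝ)) B := integrableOn_const hfin
    have i2 : Integrable (fun y => a * ‖x - y‖⁻¹) (volume.restrict B) := i1.const_mul a
    rw [integral_sub i0 i2, integral_const_mul]
    simp
  have h2 := setIntegral_inv_norm_le' hB hBb x
  have h3 : ∫ y in B, (1 - a * ‖x - y‖⁻¹) ≤ ∫ y in B, ‖x - y‖ ^ 2 / (‖x - y‖ ^ 2 + a ^ 2) := by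
    refine integral_mono_ae ((integrableOn_const hfin).sub (i1.const_mul a))
      (integrableOn_reg_ratio hBb ha x) ?_
    · filter_upwards [ae_restrict_ne B x] with y hy
      have hr : 0 < ‖x - y‖ := norm_pos_iff.2 (sub_ne_zero.2 hy.symm)
      set r := ‖x - y‖
      rw [le_div_iff₀ (by positivity)]
      have : (1 - a * r⁻¹) * (r ^ 2 + a ^ 2) = r ^ 2 - a * (r - a + a ^ 2 * r⁻¹) := by
        field_simp; ring
      rw [this]
      have h4 : 0 ≤ r - a + a ^ 2 * r⁻¹ := by
        have : r - a + a ^ 2 * r⁻¹ = (r ^ 2 - a * r + a ^ 2) / r := by field_simp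
        rw [this]
        exact div_nonneg (by nlinarith [sq_nonneg (r - a), sq_nonneg r]) hr.le
      nlinarith
  have h4 := mul_le_mul_of_nonneg_left h2 ha.le
  linarith

theorem inner_eq_coord (x y : Plane) :
    ⟪x, y⟫ = ⟪x, EuclideanSpace.single 0 1⟫ * ⟪y, EuclideanSpace.single 0 1⟫
      + ⟪x, EuclideanSpace.single 1 1⟫ * ⟪y, EuclideanSpace.single 1 1⟫ := by
  simp only [PiLp.inner_apply, Fin.sum_univ_two]
  simp; ring

end Virial

namespace IsPatch

variable {B : Set Plane} {p : Plane} {ρ h : Plane → ℝ} {c lam R τ : ℝ}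

theorem virial_double_integral (H : IsPatch B p ρ h c lam R) (hτ : lam * (Metric.diam B + R) ≤ τ)
    (hτ8 : τ ≤ 1 / 8) {a : ℝ} (ha : 0 < a) :
    (1 - 2 * τ) * (volume.real B * (volume.real B - a * (2 * π + volume.real B))) ≤
      2 * ∫ x in B, ∫ y in B, ρ y * (⟪x - p, x - y⟫ / (‖x - y‖ ^ 2 + a ^ 2)) := by
  have hBm := H.measurableSet
  have hfin := H.volume_ne_top
  set L := Metric.diam B
  have hL : 0 ≤ L := Metric.diam_nonneg
  set F : Plane → Plane → ℝ := fun x y => ρ y * (⟪x - p, x - y⟫ / (‖x - y‖ ^ 2 + a ^ 2)) with hF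
  have hkm : Measurable (fun q : Plane × Plane => ⟪q.1 - p, q.1 - q.2⟫ / (‖q.1 - q.2‖ ^ 2 + a ^ 2)) :=
    (Continuous.div (by fun_prop) (by fun_prop) (fun y => by positivity)).measurable
  have hFm : Measurable (Function.uncurry F) := (H.meas.comp measurable_snd).mul hkm
  have hFb : ∀ x ∈ B, ∀ y ∈ B, |F x y| ≤ 3 / 2 * (L * L / a ^ 2) := by
    intro x hx y hy
    rw [hF, abs_mul, abs_div]
    refine mul_le_mul (H.abs_dens_le hτ hτ8 hy) ?_ (by positivity) (by norm_num)
    refine div_le_div₀ (by positivity) ?_ (by positivity) ?_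
    · exact (abs_real_inner_le_norm _ _).trans (mul_le_mul (H.norm_sub_le hx H.mem)
        (H.norm_sub_le hx hy) (norm_nonneg _) hL)
    · exact le_trans (by nlinarith [sq_nonneg ‖x - y‖]) (le_abs_self _)
  obtain ⟨s1, s2⟩ := setIntegral_swap_of_bounded hBm hfin hFm hFb
  have i1 : IntegrableOn (fun x => ∫ y in B, F x y) B := s1.integral_prod_left
  have i2 : IntegrableOn (fun x => ∫ y in B, F y x) B := s1.integral_prod_right
  have hFx : ∀ x ∈ B, IntegrableOn (F x) B := fun x hx =>
    Integrable.mono' (g := fun _ => 3 / 2 * (L * L / a ^ 2)) (integrableOn_const hfin)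
      (hFm.of_uncurry_left).aestronglyMeasurable
      ((ae_restrict_iff' hBm).2 (ae_of_all _ fun y hy => hFb x hx y hy))
  have hFy : ∀ x ∈ B, IntegrableOn (fun y => F y x) B := fun x hx =>
    Integrable.mono' (g := fun _ => 3 / 2 * (L * L / a ^ 2)) (integrableOn_const hfin)
      (hFm.of_uncurry_right).aestronglyMeasurable
      ((ae_restrict_iff' hBm).2 (ae_of_all _ fun y hy => hFb y hy x hx))
  have e1 : 2 * ∫ x in B, ∫ y in B, F x y = ∫ x in B, ∫ y in B, (F x y + F y x) := by
    rw [two_mul]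
    nth_rewrite 2 [s2]
    rw [← integral_add i1 i2]
    refine setIntegral_congr_fun hBm fun x hx => ?_
    exact (integral_add (hFx x hx) (hFy x hx)).symm
  have hsum : ∀ x ∈ B, IntegrableOn (fun y => F x y + F y x) B := fun x hx =>
    (hFx x hx).add (hFy x hx)
  have pt : ∀ x ∈ B, ∀ y ∈ B,
      (1 - 2 * τ) * (‖x - y‖ ^ 2 / (‖x - y‖ ^ 2 + a ^ 2)) ≤ F x y + F y x := by
    intro x hx y hy
    have hxy : F x y + F y x = (ρ y * ‖x - y‖ ^ 2 + (ρ y - ρ x) * ⟪y - p, x - y⟫)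
        / (‖x - y‖ ^ 2 + a ^ 2) := by
      simp only [hF]
      rw [norm_sub_rev y x, ← neg_sub x y, inner_neg_right, ← real_inner_self_eq_norm_sq,
        show x - p = (x - y) + (y - p) by abel, inner_add_left]
      ring
    rw [hxy, ← mul_div_assoc]
    refine div_le_div_of_nonneg_right ?_ (by positivity)
    have h1 := (abs_le.1 (H.abs_dens_sub_one_le hτ hy)).1
    have h2 := H.dens_lip y hy x hx
    have h3 := (abs_real_inner_le_norm (y - p) (x - y)).trans
      (mul_le_mul_of_nonneg_right (H.norm_sub_le hy H.mem) (norm_nonneg _))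
    have h4 : |(ρ y - ρ x) * ⟪y - p, x - y⟫| ≤ τ * ‖x - y‖ ^ 2 := by
      rw [abs_mul]
      rw [norm_sub_rev] at h2
      refine (mul_le_mul h2 h3 (abs_nonneg _) (mul_nonneg H.lam_nonneg (norm_nonneg _))).trans ?_
      have := mul_le_mul_of_nonneg_right (H.lam_mul_diam_le hτ) (sq_nonneg ‖x - y‖)
      linarith
    have h5 := (abs_le.1 h4).1
    nlinarith [sq_nonneg ‖x - y‖]
  rw [e1]
  have hτ2 : 0 ≤ 1 - 2 * τ := by linarith
  have : ∫ x in B, (1 - 2 * τ) * (volume.real B - a * (2 * π + volume.real B))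
      = (1 - 2 * τ) * (volume.real B * (volume.real B - a * (2 * π + volume.real B))) := by
    rw [setIntegral_const, smul_eq_mul]; ring
  rw [← this]
  have i3 : IntegrableOn (fun x => ∫ y in B, (F x y + F y x)) B := by
    refine (i1.add i2).congr ((ae_restrict_iff' hBm).2 (ae_of_all _ fun x hx => ?_))
    exact (integral_add (hFx x hx) (hFy x hx)).symm
  refine setIntegral_mono_on (integrableOn_const hfin) i3 hBm fun x hx => ?_
  have h6 := mul_le_mul_of_nonneg_left (setIntegral_reg_ge hBm H.bounded ha x) hτ2
  refine h6.trans ?_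
  rw [← integral_const_mul]
  refine setIntegral_mono_on ?_ (hsum x hx) hBm fun y hy => pt x hx y hy
  exact (integrableOn_reg_ratio H.bounded ha x).const_mul _

theorem virial (H : IsPatch B p ρ h c lam R) (hτ : lam * (Metric.diam B + R) ≤ τ)
    (hτ8 : τ ≤ 1 / 8) (hτM : τ ≤ volume.real B / 16) :
    volume.real B ^ 2 / 8 ≤ ∫ x in B, (logPot ρ B x - c + h x) := by
  have hBm := H.measurableSet
  have hfin := H.volume_ne_top
  set L := Metric.diam B
  have hL : 0 ≤ L := Metric.diam_nonneg
  set M := volume.real B with hM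
  have hM0 : 0 < M := H.volume_pos
  set I := ∫ x in B, (logPot ρ B x - c + h x) with hI
  have hlam := H.lam_nonneg
  have main : ∀ b, 0 < b → (1 - 2 * τ) * (M * (M - b ^ 2 * (2 * π + M)))
      - 4 * ((lam + 3 * (2 * π + M) * b) * L * M) - 4 * I ≤ 0 := by
    intro b hb
    have ha : 0 < b ^ 2 := by positivity
    have hcoord : ∀ e : Plane, ‖e‖ = 1 →
        |I - ∫ x in B, ⟪x - p, e⟫ * regGrad (b ^ 2) ρ B e x|
          ≤ (lam + 3 * (2 * π + M) * b) * L * M := by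
      intro e he
      have := patch_integration_by_parts (γ := 1) (G := L) (c := c) (g := fun x => ⟪x - p, e⟫)
        H.isOpen H.bounded he H.meas (fun y hy => H.abs_dens_le hτ hτ8 hy) (by norm_num) hL
        (Λ := 3 * (2 * π + M) + lam) (by positivity) hlam (by linarith [H.one_le] : 0 < R)
        (by fun_prop)
        (fun x hx => (abs_real_inner_le_norm _ _).trans
          (by rw [he, mul_one]; exact H.norm_sub_le hx H.mem))
        (fun x t _ => by
          rw [show x + t • e - p = (x - p) + t • e by abel, inner_add_smul_self he, one_mul])
        H.pert_lip_self (fun x hx => (H.pos x hx).le)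
        (fun x hx z hz hxz => H.le_slope_mul hτ hτ8 hx hz hxz) hb
      rw [one_mul, ← hI] at this
      rwa [show (2 : ℝ) * (3 / 2) = 3 by norm_num] at this
    have n0 : ‖(EuclideanSpace.single 0 1 : Plane)‖ = 1 := by simp
    have n1 : ‖(EuclideanSpace.single 1 1 : Plane)‖ = 1 := by simp
    have c0 := (abs_le.1 (hcoord _ n0)).1
    have c1 := (abs_le.1 (hcoord _ n1)).1
    have hgi : ∀ e : Plane, ‖e‖ = 1 →
        IntegrableOn (fun x => ⟪x - p, e⟫ * regGrad (b ^ 2) ρ B e x) B := by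
      intro e he
      refine integrableOn_bdd_mul (P := L) hBm (by fun_prop)
        (fun x hx => (abs_real_inner_le_norm _ _).trans
          (by rw [he, mul_one]; exact H.norm_sub_le hx H.mem)) ?_
      exact Measure.integrableOn_of_bounded hfin (measurable_regGrad H.meas ha).aestronglyMeasurable
        (ae_of_all _ fun x => abs_regGrad_le hBm hfin he (fun y hy => H.abs_dens_le hτ hτ8 hy)
          (by norm_num) ha x)
    have hJ := H.virial_double_integral hτ hτ8 ha
    have hsplit : ∫ x in B, ∫ y in B, ρ y * (⟪x - p, x - y⟫ / (‖x - y‖ ^ 2 + (b ^ 2) ^ 2))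
        = (∫ x in B, ⟪x - p, EuclideanSpace.single 0 1⟫ * regGrad (b ^ 2) ρ B (EuclideanSpace.single 0 1) x)
        + ∫ x in B, ⟪x - p, EuclideanSpace.single 1 1⟫ * regGrad (b ^ 2) ρ B (EuclideanSpace.single 1 1) x := by
      rw [← integral_add (hgi _ n0) (hgi _ n1)]
      congr 1; funext x
      have j : ∀ e : Plane, ‖e‖ = 1 → IntegrableOn (fun y => ρ y * regKer (b ^ 2) e (x - y)) B :=
        fun e he => integrableOn_regGrad hBm hfin he H.meas (fun y hy => H.abs_dens_le hτ hτ8 hy) ha x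
      unfold regGrad
      rw [← integral_const_mul, ← integral_const_mul,
        ← integral_add ((j _ n0).const_mul _) ((j _ n1).const_mul _)]
      congr 1; funext y
      rw [inner_eq_coord (x - p) (x - y), regKer, regKer]
      ring
    rw [hsplit] at hJ
    linarith
  have hc : Continuous fun b : ℝ => -((1 - 2 * τ) * (M * (M - b ^ 2 * (2 * π + M)))
      - 4 * ((lam + 3 * (2 * π + M) * b) * L * M) - 4 * I) := by fun_prop
  have key := le_of_forall_pos_le_of_continuous hc (X := 0) (fun b hb => by linarith [main b hb])
  have h1 : lam * L * M ≤ τ * M := mul_le_mul_of_nonneg_right (H.lam_mul_diam_le hτ) hM0.le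
  norm_num at key
  nlinarith

end IsPatch

section Reflection

variable {B : Set Plane} {e : Plane}

/-- Reflection of the plane about the line `⟪x, e⟫ = s`. -/
def lineReflect (e : Plane) (s : ℝ) (x : Plane) : Plane := x + (2 * (s - ⟪x, e⟫)) • e

theorem inner_lineReflect (he : ‖e‖ = 1) (s : ℝ) (x : Plane) :
    ⟪lineReflect e s x, e⟫ = 2 * s - ⟪x, e⟫ := by
  rw [lineReflect, inner_add_smul_self he]; ring

theorem lineReflect_lineReflect (he : ‖e‖ = 1) (s : ℝ) (x : Plane) :
    lineReflect e s (lineReflect e s x) = x := by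
  conv_lhs => rw [lineReflect]
  rw [inner_lineReflect he, lineReflect]
  module

theorem norm_lineReflect_sub_lineReflect (he : ‖e‖ = 1) (s : ℝ) (x y : Plane) :
    ‖lineReflect e s x - lineReflect e s y‖ = ‖x - y‖ := by
  have h1 : lineReflect e s x - lineReflect e s y = (x - y) + (-2 * ⟪x - y, e⟫) • e := by
    rw [lineReflect, lineReflect, inner_sub_left]; module
  rw [← sq_eq_sq₀ (norm_nonneg _) (norm_nonneg _), h1, norm_add_sq_real, inner_smul_right,
    norm_smul, he, mul_one, Real.norm_eq_abs, sq_abs]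
  ring

theorem norm_lineReflect_sub (he : ‖e‖ = 1) (s : ℝ) (x y : Plane) :
    ‖lineReflect e s x - y‖ = ‖x - lineReflect e s y‖ := by
  conv_lhs => rw [← lineReflect_lineReflect he s y]
  exact norm_lineReflect_sub_lineReflect he s _ _

theorem continuous_lineReflect (e : Plane) (s : ℝ) : Continuous (lineReflect e s) := by
  unfold lineReflect; fun_prop

theorem log_reg_le {a r s : ℝ} (ha : 0 < a) (hrs : s ≤ r) :
    log (r ^ 2 + a ^ 2) / 2 - log (s ^ 2 + a ^ 2) / 2 ≤ (r - s) / a := by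
  set d := (r - s) / a with hd
  have hd0 : 0 ≤ d := div_nonneg (by linarith) ha.le
  have hr : r = s + d * a := by rw [hd]; field_simp; ring
  have h1 : r ^ 2 + a ^ 2 ≤ (s ^ 2 + a ^ 2) * (1 + d) ^ 2 := by
    rw [hr]
    nlinarith [mul_nonneg hd0 (sq_nonneg (s - a)), mul_nonneg (sq_nonneg d) (sq_nonneg s),
      mul_nonneg hd0 (sq_nonneg s), mul_nonneg hd0 (sq_nonneg a)]
  have h2 : log (r ^ 2 + a ^ 2) ≤ log (s ^ 2 + a ^ 2) + 2 * log (1 + d) := by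
    rw [show 2 * log (1 + d) = log ((1 + d) ^ 2) by rw [log_pow]; norm_num,
      ← log_mul (by positivity) (by positivity)]
    exact log_le_log (by positivity) h1
  have h3 : log (1 + d) ≤ d := by have := log_le_sub_one_of_pos (show 0 < 1 + d by linarith); linarith
  linarith

theorem abs_log_reg_sub_le {a : ℝ} (ha : 0 < a) (x y : Plane) :
    |log (‖x‖ ^ 2 + a ^ 2) / 2 - log (‖y‖ ^ 2 + a ^ 2) / 2| ≤ ‖x - y‖ / a := by
  have h0 := norm_nonneg x
  have h0' := norm_nonneg y
  have h1 := norm_sub_norm_le x y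
  have h2 := norm_sub_norm_le y x
  rw [norm_sub_rev] at h2
  have key : |log (‖x‖ ^ 2 + a ^ 2) / 2 - log (‖y‖ ^ 2 + a ^ 2) / 2| ≤ |‖x‖ - ‖y‖| / a := by
    have hm : ∀ {r s : ℝ}, 0 ≤ s → s ≤ r →
        |log (r ^ 2 + a ^ 2) / 2 - log (s ^ 2 + a ^ 2) / 2| ≤ |r - s| / a := by
      intro r s hs hrs
      rw [abs_of_nonneg (sub_nonneg.2 hrs), abs_of_nonneg]
      · exact log_reg_le ha hrs
      · have := log_le_log (show 0 < s ^ 2 + a ^ 2 by positivity)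
          (show s ^ 2 + a ^ 2 ≤ r ^ 2 + a ^ 2 by nlinarith)
        linarith
    rcases le_total ‖y‖ ‖x‖ with h | h
    · exact hm h0' h
    · rw [abs_sub_comm, abs_sub_comm ‖x‖]; exact hm h0 h
  refine key.trans ?_
  gcongr
  exact abs_norm_sub_norm_le x y

theorem abs_sliceAvg_reflect_le (hB : IsOpen B) (hBb : Bornology.IsBounded B) (he : ‖e‖ = 1)
    {a : ℝ} (ha : 0 < a) (s : ℝ) (x : Plane) {y : Plane} (hy : y ∈ B) :
    |sliceAvg B e (fun y => log (‖x - lineReflect e s y‖ ^ 2 + a ^ 2) / 2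
        - log (‖x - y‖ ^ 2 + a ^ 2) / 2) y| ≤ 2 / a * |sliceMid B e y - s| := by
  obtain ⟨α, hα, β, hβ, hs⟩ := exists_slice_eq_Ioo hB hBb he hy
  have hαβ := hα.trans hβ
  rw [(sliceAvg_eq_of_Ioo hαβ hs).2, sliceMid_eq he hαβ hs]
  set k : Plane → ℝ := fun z => log (‖z‖ ^ 2 + a ^ 2) / 2 with hk
  have hkc : Continuous k :=
    (Continuous.log (by fun_prop) (fun z => by positivity)).div_const 2
  set m := ⟪y, e⟫ + (α + β) / 2 with hm
  have e1 : ∀ t : ℝ, lineReflect e s (y + t • e)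
      = y + (α + β - t) • e + (2 * (s - m)) • e := by
    intro t
    rw [lineReflect, inner_add_smul_self he, hm]; module
  have i1 : IntervalIntegrable (fun t : ℝ => k (x - lineReflect e s (y + t • e))) volume α β :=
    (hkc.comp (continuous_const.sub ((continuous_lineReflect e s).comp
      (by fun_prop)))).intervalIntegrable _ _
  have i2 : IntervalIntegrable (fun t : ℝ => k (x - (y + t • e))) volume α β :=
    (hkc.comp (by fun_prop)).intervalIntegrable _ _
  have i3 : IntervalIntegrable (fun t : ℝ => k (x - (y + t • e + (2 * (s - m)) • e))) volume α β :=
    (hkc.comp (by fun_prop)).intervalIntegrable _ _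
  have e2 : ∫ t in α..β, k (x - lineReflect e s (y + t • e))
      = ∫ t in α..β, k (x - (y + t • e + (2 * (s - m)) • e)) := by
    simp_rw [e1]
    have := intervalIntegral.integral_comp_sub_left (a := α) (b := β)
      (fun t => k (x - (y + t • e + (2 * (s - m)) • e))) (α + β)
    rw [this]; congr 1 <;> ring
  have e3 : ∫ t in Set.Ioo α β, (k (x - lineReflect e s (y + t • e)) - k (x - (y + t • e)))
      = ∫ t in α..β, (k (x - (y + t • e + (2 * (s - m)) • e)) - k (x - (y + t • e))) := by
    rw [← integral_Ioc_eq_integral_Ioo, ← intervalIntegral.integral_of_le hαβ.le,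
      intervalIntegral.integral_sub i1 i2, intervalIntegral.integral_sub i3 i2, e2]
  have h4 : |∫ t in α..β, (k (x - (y + t • e + (2 * (s - m)) • e)) - k (x - (y + t • e)))|
      ≤ 2 / a * |m - s| * (β - α) := by
    rw [← Real.norm_eq_abs]
    refine (intervalIntegral.norm_integral_le_of_norm_le_const (C := 2 / a * |m - s|)
      fun t _ => ?_).trans (le_of_eq (by rw [abs_of_pos (sub_pos.2 hαβ)]))
    refine (abs_log_reg_sub_le ha _ _).trans (le_of_eq ?_)
    rw [show x - (y + t • e + (2 * (s - m)) • e) - (x - (y + t • e)) = (2 * (m - s)) • e by module,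
      norm_smul, he, mul_one, Real.norm_eq_abs, abs_mul, abs_two]
    ring
  change |(∫ t in Set.Ioo α β, (k (x - lineReflect e s (y + t • e)) - k (x - (y + t • e))))
    / (β - α)| ≤ _
  rw [e3, abs_div, abs_of_pos (sub_pos.2 hαβ), div_le_iff₀ (sub_pos.2 hαβ)]
  exact h4

theorem integrableOn_sliceMid_sub (hB : IsOpen B) (hBb : Bornology.IsBounded B) (he : ‖e‖ = 1)
    (s : ℝ) : IntegrableOn (fun y => sliceMid B e y - s) B := by
  rcases B.eq_empty_or_nonempty with rfl | ⟨p, hp⟩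
  · simp
  refine Integrable.mono' (g := fun _ => Metric.diam B + |⟪p, e⟫ - s|)
    (integrableOn_const hBb.measure_lt_top.ne)
    ((measurable_sliceMid hB e).sub_const s).aestronglyMeasurable
    ((ae_restrict_iff' hB.measurableSet).2 (ae_of_all _ fun y hy => ?_))
  have h1 := abs_sliceMid_sub_le hB hBb he hy hp
  have h2 := abs_sub_le (sliceMid B e y) ⟪p, e⟫ s
  rw [Real.norm_eq_abs]; linarith

theorem abs_logPot_one_sub_lineReflect_le (hB : IsOpen B) (hBb : Bornology.IsBounded B)
    (he : ‖e‖ = 1) {a : ℝ} (ha : 0 < a) (s : ℝ) (x : Plane) :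
    |logPot (fun _ => 1) B x - logPot (fun _ => 1) B (lineReflect e s x)|
      ≤ 2 * (a * (2 * π + volume.real B)) + 2 / a * ∫ y in B, |sliceMid B e y - s| := by
  have hBm := hB.measurableSet
  have h1 : ∀ x, |logPot (fun _ => 1) B x - regPot a (fun _ => 1) B x|
      ≤ 1 * (a * (2 * π + volume.real B)) := fun x =>
    abs_logPot_sub_regPot_le hBm hBb measurable_const (by simp) (by norm_num) ha x
  have h2 : |regPot a (fun _ => 1) B x - regPot a (fun _ => 1) B (lineReflect e s x)|
      ≤ 2 / a * ∫ y in B, |sliceMid B e y - s| := by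
    have i : ∀ x, IntegrableOn (fun y => (1 : ℝ) * -(log (‖x - y‖ ^ 2 + a ^ 2) / 2)) B := fun x =>
      integrableOn_regPot hBm hBb measurable_const (P := 1) (by simp) ha x
    unfold regPot
    rw [← integral_sub (i x) (i _)]
    obtain ⟨r, hr⟩ := hBb.subset_closedBall 0
    set F : Plane → ℝ := fun y => log (‖x - lineReflect e s y‖ ^ 2 + a ^ 2) / 2
        - log (‖x - y‖ ^ 2 + a ^ 2) / 2 with hF
    have hFc : Continuous F := by
      refine Continuous.sub (Continuous.div_const (Continuous.log ?_ (fun z => by positivity)) 2)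
        (Continuous.div_const (Continuous.log (by fun_prop) (fun z => by positivity)) 2)
      exact ((continuous_const.sub (continuous_lineReflect e s)).norm.pow 2).add continuous_const
    have e1 : ∫ y in B, (1 * -(log (‖x - y‖ ^ 2 + a ^ 2) / 2)
        - 1 * -(log (‖lineReflect e s x - y‖ ^ 2 + a ^ 2) / 2)) = ∫ y in B, F y := by
      congr 1; funext y
      rw [norm_lineReflect_sub he]; simp only [hF]; ring
    obtain ⟨C, hC⟩ := (hBb.isCompact_closure).exists_bound_of_continuousOn hFc.continuousOn
    rw [e1, ← setIntegral_sliceAvg hB hBb he hFc.measurable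
      (fun y hy => hC y (subset_closure hy)), ← integral_const_mul, ← Real.norm_eq_abs]
    refine norm_integral_le_of_norm_le (Integrable.const_mul
      (integrableOn_sliceMid_sub hB hBb he s).abs _)
      ((ae_restrict_iff' hBm).2 (ae_of_all _ fun y hy => ?_))
    exact abs_sliceAvg_reflect_le hB hBb he ha s x hy
  have h3 := h1 x
  have h4 := h1 (lineReflect e s x)
  rw [abs_le] at *
  constructor <;> linarith

/-- The centroid of `B`. -/
def centroid (B : Set Plane) : Plane := (volume.real B)⁻¹ • ∫ x in B, x

theorem volume_mul_inner_centroid (hBb : Bornology.IsBounded B) (hM : 0 < volume.real B) :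
    volume.real B * ⟪centroid B, e⟫ = ∫ x in B, ⟪x, e⟫ := by
  have hi : IntegrableOn (fun x : Plane => x) B :=
    (continuous_id.continuousOn.integrableOn_compact hBb.isCompact_closure).mono_set subset_closure
  rw [centroid, inner_smul_left, real_inner_comm, ← integral_inner hi]
  simp only [RCLike.conj_to_real]
  rw [mul_inv_cancel_left₀ hM.ne']
  congr 1; funext x; rw [real_inner_comm]

theorem setIntegral_abs_sliceMid_sub_centroid_le (hB : IsOpen B) (hBb : Bornology.IsBounded B)
    (hM : 0 < volume.real B) (he : ‖e‖ = 1) {δ D : ℝ} (hδ : 0 < δ)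
    (hD : ∫ x in B, ∫ y in B, (sliceMid B e x - sliceMid B e y) ^ 2 ≤ D) :
    ∫ x in B, |sliceMid B e x - ⟪centroid B, e⟫|
      ≤ (D / δ + δ * volume.real B ^ 2) / (2 * volume.real B) := by
  have hBm := hB.measurableSet
  have hfin : volume B ≠ ⊤ := hBb.measure_lt_top.ne
  set M := volume.real B with hMdef
  set m := sliceMid B e with hm
  have hmm : Measurable m := measurable_sliceMid hB e
  have hmi : IntegrableOn m B := by simpa using integrableOn_sliceMid_sub hB hBb he 0
  have hdb : ∀ x ∈ B, ∀ y ∈ B, |m x - m y| ≤ 2 * Metric.diam B := by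
    intro x hx y hy
    have h1 := abs_sliceMid_sub_le hB hBb he hx hx
    have h2 := abs_sliceMid_sub_le hB hBb he hy hx
    rw [abs_sub_comm] at h2
    have h3 := abs_sub_le (m x) ⟪x, e⟫ (m y)
    linarith
  have s5 := (setIntegral_swap_of_bounded hBm hfin (F := fun x y => (m x - m y) ^ 2)
    (((hmm.comp measurable_fst).sub (hmm.comp measurable_snd)).pow_const 2)
    (H := (2 * Metric.diam B) ^ 2) (fun x hx y hy => by
      rw [abs_pow]; exact pow_le_pow_left₀ (abs_nonneg _) (hdb x hx y hy) 2)).1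
  have i5 : IntegrableOn (fun x => ∫ y in B, (m x - m y) ^ 2) B := s5.integral_prod_left
  have i6 : ∀ x ∈ B, IntegrableOn (fun y => (m x - m y) ^ 2) B := fun x hx =>
    Integrable.mono' (g := fun _ => (2 * Metric.diam B) ^ 2) (integrableOn_const hfin)
      ((hmm.const_sub _).pow_const 2).aestronglyMeasurable
      ((ae_restrict_iff' hBm).2 (ae_of_all _ fun y hy => by
        rw [norm_pow, Real.norm_eq_abs]
        exact pow_le_pow_left₀ (abs_nonneg _) (hdb x hx y hy) 2))
  have hpt : ∀ x ∈ B, |m x - ⟪centroid B, e⟫|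
      ≤ ((∫ y in B, (m x - m y) ^ 2) / δ + δ * M) / (2 * M) := by
    intro x hx
    have e1 : M * (m x - ⟪centroid B, e⟫) = ∫ y in B, (m x - m y) := by
      have ic : IntegrableOn (fun _ : Plane => m x) B := integrableOn_const hfin
      rw [integral_sub ic hmi, setIntegral_sliceMid hB hBb he, mul_sub,
        volume_mul_inner_centroid hBb hM, setIntegral_const, smul_eq_mul]
    have e2 : |∫ y in B, (m x - m y)| ≤ ∫ y in B, ((m x - m y) ^ 2 / δ + δ) / 2 := by
      rw [← Real.norm_eq_abs]
      refine norm_integral_le_of_norm_le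
        ((((i6 x hx).div_const δ).add (integrableOn_const hfin)).div_const 2)
        (ae_of_all _ fun y => ?_)
      rw [Real.norm_eq_abs, le_div_iff₀ two_pos, div_add' _ _ _ hδ.ne', le_div_iff₀ hδ, ← sq_abs]
      nlinarith [sq_nonneg (|m x - m y| - δ)]
    have e3 : ∫ y in B, ((m x - m y) ^ 2 / δ + δ) / 2
        = ((∫ y in B, (m x - m y) ^ 2) / δ + δ * M) / 2 := by
      have ic : IntegrableOn (fun _ : Plane => δ) B := integrableOn_const hfin
      have id : IntegrableOn (fun y => (m x - m y) ^ 2 / δ) B := (i6 x hx).div_const δ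
      rw [integral_div, integral_add id ic, integral_div, setIntegral_const, smul_eq_mul]
      ring
    rw [e3, ← e1, abs_mul, abs_of_pos hM] at e2
    rw [le_div_iff₀ (by positivity)]
    linarith
  have i7 : IntegrableOn (fun x => (∫ y in B, (m x - m y) ^ 2) / δ) B := i5.div_const δ
  have ic : IntegrableOn (fun _ : Plane => δ * M) B := integrableOn_const hfin
  have i8 : IntegrableOn (fun x => ((∫ y in B, (m x - m y) ^ 2) / δ + δ * M) / (2 * M)) B :=
    (i7.add ic).div_const _
  refine (setIntegral_mono_on (integrableOn_sliceMid_sub hB hBb he _).abs i8 hBm hpt).trans ?_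
  rw [integral_div, integral_add i7 ic, integral_div, setIntegral_const, smul_eq_mul, ← hMdef]
  have h1 := div_le_div_of_nonneg_right hD hδ.le
  exact div_le_div_of_nonneg_right (by linarith) (by positivity)

end Reflection

namespace IsPatch

variable {B : Set Plane} {p : Plane} {ρ h : Plane → ℝ} {c lam R τ : ℝ}

/-- Replacing the density by `1` changes the potential by a function with small slope. -/
theorem logPot_one_sub (H : IsPatch B p ρ h c lam R) (hτ : lam * (Metric.diam B + R) ≤ τ)
    (x : Plane) : logPot ρ B x - logPot (fun _ => 1) B x = logPot (fun y => ρ y - 1) B x := by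
  unfold logPot
  have i1 : IntegrableOn (fun y => (1 : ℝ) * -log ‖x - y‖) B :=
    integrableOn_logPot H.measurableSet H.bounded measurable_const (P := 1) (by simp) x
  have i2 : IntegrableOn (fun y => (ρ y - 1) * -log ‖x - y‖) B :=
    integrableOn_logPot H.measurableSet H.bounded (H.meas.sub_const 1)
      (fun y hy => H.abs_dens_sub_one_le hτ hy) x
  rw [sub_eq_iff_eq_add, ← integral_add i2 i1]
  congr 1; funext y; ring

theorem sliceMid_deficit_le (H : IsPatch B p ρ h c lam R) (hτ : lam * (Metric.diam B + R) ≤ τ)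
    (hτ8 : τ ≤ 1 / 8) {e : Plane} (he : ‖e‖ = 1) :
    ∫ x in B, ∫ y in B, (sliceMid B e x - sliceMid B e y) ^ 2 ≤
      2 * (lam + 2 * τ * (2 * π + volume.real B)) * Metric.diam B ^ 3 * volume.real B := by
  have hBm := H.measurableSet
  have hfin := H.volume_ne_top
  set L := Metric.diam B with hLdef
  have hL : 0 ≤ L := Metric.diam_nonneg
  set M := volume.real B with hMdef
  have hM0 : 0 < M := H.volume_pos
  have hτ0 := H.nonneg_of_le hτ
  set m := sliceMid B e with hm
  have hmm : Measurable m := measurable_sliceMid H.isOpen e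
  set lam' := lam + 2 * τ * (2 * π + M) with hlam'
  have hlam0 : 0 ≤ lam' := by have := H.lam_nonneg; positivity
  set h' : Plane → ℝ := fun x => h x + logPot (fun y => ρ y - 1) B x with hh'
  have hf : ∀ x, logPot (fun _ => 1) B x - c + h' x = logPot ρ B x - c + h x := by
    intro x
    have := H.logPot_one_sub hτ x
    simp only [hh']; linarith
  have hgG : ∀ x ∈ B, |m x - ⟪p, e⟫| ≤ L := fun x hx =>
    abs_sliceMid_sub_le H.isOpen H.bounded he hx H.mem
  set D := ∫ x in B, ∫ y in B, (m x - m y) ^ 2 with hD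
  have main : ∀ b, 0 < b → D ≤
      (L ^ 2 + (b ^ 2) ^ 2) * (2 * ((lam' + 2 * 1 * (2 * π + M) * b) * L * M)) := by
    intro b hb
    have ha : 0 < b ^ 2 := by positivity
    have h1 := patch_integration_by_parts (ρ := fun _ => 1) (P := 1) (γ := 0) (G := L) (c := c)
      (h := h') (lam := lam') (g := fun x => m x - ⟪p, e⟫)
      H.isOpen H.bounded he measurable_const (by simp) (by norm_num) hL
      (Λ := 3 * (2 * π + M) + lam) (by have := H.lam_nonneg; positivity) hlam0
      (by linarith [H.one_le] : 0 < R)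
      (hmm.sub_const _) hgG
      (fun x t hxt => by simp only [hm, sliceMid_add hxt]; ring)
      (fun x hx y hy => by
        have h2 := abs_logPot_sub_le hBm H.bounded (H.meas.sub_const 1)
          (fun y hy => H.abs_dens_sub_one_le hτ hy) hτ0 x y
        have h3 := H.pert_lip_self x hx y hy
        simp only [hh']
        rw [add_sub_add_comm]
        refine (abs_add_le _ _).trans ?_
        rw [hlam']; linarith)
      (fun x hx => by rw [hf]; exact (H.pos x hx).le)
      (fun x hx z hz hxz => by rw [hf]; exact H.le_slope_mul hτ hτ8 hx hz hxz) hb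
    rw [zero_mul, zero_sub, abs_neg] at h1
    set k := regKer (b ^ 2) e with hk
    have hkm : Measurable k := (continuous_regKer ha e).measurable
    set F : Plane → Plane → ℝ := fun x y => (m x - ⟪p, e⟫) * k (x - y) with hF
    have hFm : Measurable (Function.uncurry F) :=
      ((hmm.comp measurable_fst).sub_const _).mul (hkm.comp (by fun_prop))
    have hFb : ∀ x ∈ B, ∀ y ∈ B, |F x y| ≤ L * (b ^ 2)⁻¹ := by
      intro x hx y hy
      rw [hF, abs_mul]
      exact mul_le_mul (hgG x hx) (abs_regKer_le ha he _) (abs_nonneg _) hL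
    obtain ⟨s1, s2⟩ := setIntegral_swap_of_bounded hBm hfin hFm hFb
    have i1 : IntegrableOn (fun x => ∫ y in B, F x y) B := s1.integral_prod_left
    have i2 : IntegrableOn (fun x => ∫ y in B, F y x) B := s1.integral_prod_right
    have hFx : ∀ x ∈ B, IntegrableOn (F x) B := fun x hx =>
      Integrable.mono' (g := fun _ => L * (b ^ 2)⁻¹) (integrableOn_const hfin)
        (hFm.of_uncurry_left).aestronglyMeasurable
        ((ae_restrict_iff' hBm).2 (ae_of_all _ fun y hy => hFb x hx y hy))
    have hFy : ∀ x ∈ B, IntegrableOn (fun y => F y x) B := fun x hx =>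
      Integrable.mono' (g := fun _ => L * (b ^ 2)⁻¹) (integrableOn_const hfin)
        (hFm.of_uncurry_right).aestronglyMeasurable
        ((ae_restrict_iff' hBm).2 (ae_of_all _ fun y hy => hFb y hy x hx))
    have hodd : ∀ z, k (-z) = -k z := by
      intro z; rw [hk, regKer, regKer, inner_neg_left, norm_neg, neg_div]
    have e1 : 2 * ∫ x in B, (m x - ⟪p, e⟫) * regGrad (b ^ 2) (fun _ => 1) B e x
        = ∫ x in B, ∫ y in B, (m x - m y) * k (x - y) := by
      have e2 : ∫ x in B, (m x - ⟪p, e⟫) * regGrad (b ^ 2) (fun _ => 1) B e x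
          = ∫ x in B, ∫ y in B, F x y := by
        congr 1; funext x
        rw [regGrad, ← integral_const_mul]
        congr 1; funext y; rw [one_mul]
      rw [e2, two_mul]
      nth_rewrite 2 [s2]
      rw [← integral_add i1 i2]
      refine setIntegral_congr_fun hBm fun x hx => ?_
      rw [← integral_add (hFx x hx) (hFy x hx)]
      congr 1; funext y
      simp only [hF]
      rw [← neg_sub x y, hodd]; ring
    have h4 := sliceMid_deficit H.isOpen H.bounded he ha
    rw [← hm, ← hk, ← e1, ← hD, div_le_iff₀' (by positivity)] at h4
    refine h4.trans (mul_le_mul_of_nonneg_left ?_ (by positivity))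
    exact mul_le_mul_of_nonneg_left (le_of_abs_le h1) two_pos.le
  have hc : Continuous fun b : ℝ =>
      (L ^ 2 + (b ^ 2) ^ 2) * (2 * ((lam' + 2 * 1 * (2 * π + M) * b) * L * M)) := by fun_prop
  have key := le_of_forall_pos_le_of_continuous hc (X := D) main
  refine key.trans (le_of_eq ?_)
  norm_num; ring

end IsPatch

@[simp] theorem mk2_zero (a b : ℝ) : mk2 a b 0 = a := rfl

@[simp] theorem mk2_one (a b : ℝ) : mk2 a b 1 = b := rfl

theorem norm_sq_plane (x : Plane) : ‖x‖ ^ 2 = x 0 ^ 2 + x 1 ^ 2 := by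
  rw [EuclideanSpace.norm_sq_eq, Fin.sum_univ_two, Real.norm_eq_abs, Real.norm_eq_abs, sq_abs,
    sq_abs]

theorem norm_eq_norm_complex (x : Plane) : ‖x‖ = ‖(⟨x 0, x 1⟩ : ℂ)‖ := by
  rw [← sq_eq_sq₀ (norm_nonneg _) (norm_nonneg _), norm_sq_plane, Complex.sq_norm,
    Complex.normSq_mk]
  ring

/-- The point with polar coordinates `(r, θ)` about `q`. -/
def circlePt (q : Plane) (r θ : ℝ) : Plane := q + r • mk2 (cos θ) (sin θ)

theorem norm_mk2_cos_sin (θ : ℝ) : ‖mk2 (cos θ) (sin θ)‖ = 1 := by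
  rw [← sq_eq_sq₀ (norm_nonneg _) zero_le_one, norm_sq_plane]
  simp

theorem norm_circlePt_sub {r : ℝ} (hr : 0 ≤ r) (q : Plane) (θ : ℝ) : ‖circlePt q r θ - q‖ = r := by
  rw [circlePt, add_sub_cancel_left, norm_smul, norm_mk2_cos_sin, mul_one, Real.norm_of_nonneg hr]

theorem continuous_circlePt (q : Plane) (r : ℝ) : Continuous (circlePt q r) := by
  unfold circlePt mk2
  refine continuous_const.add (Continuous.const_smul ?_ r)
  refine (PiLp.continuous_toLp 2 _).comp (continuous_pi fun i => ?_)
  fin_cases i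
  · exact continuous_cos
  · exact continuous_sin

theorem integral_log_norm_circlePt_sub {r : ℝ} (hr : 0 < r) (q y : Plane) :
    ∫ θ in (0 : ℝ)..2 * π, log ‖circlePt q r θ - y‖ = 2 * π * log (max r ‖y - q‖) := by
  have h := circleAverage_log_norm_sub_const_eq_log_radius_add_posLog (c := (⟨q 0, q 1⟩ : ℂ))
    (a := (⟨y 0, y 1⟩ : ℂ)) hr.ne'
  rw [Real.circleAverage_def, smul_eq_mul, inv_mul_eq_iff_eq_mul₀ (by positivity)] at h
  have e1 : ∀ θ, ‖circlePt q r θ - y‖ = ‖circleMap (⟨q 0, q 1⟩ : ℂ) r θ - ⟨y 0, y 1⟩‖ := by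
    intro θ
    rw [norm_eq_norm_complex]
    congr 1
    apply Complex.ext
    · simp [circlePt, circleMap, Complex.exp_ofReal_mul_I_re]
    · simp [circlePt, circleMap, Complex.exp_ofReal_mul_I_im]
  have e2 : ‖(⟨q 0, q 1⟩ : ℂ) - ⟨y 0, y 1⟩‖ = ‖y - q‖ := by
    rw [norm_sub_rev, norm_eq_norm_complex]
    congr 1
  simp_rw [e1]
  rw [h, e2, posLog_eq_log_max_one (by positivity), ← log_mul hr.ne' (by positivity),
    mul_max_of_nonneg _ _ hr.le, mul_one, mul_inv_cancel_left₀ hr.ne']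

section

variable {B : Set Plane} {q : Plane}

/-- The circular mean about `q` of the logarithmic potential of `B`. -/
def radPot (B : Set Plane) (q : Plane) (r : ℝ) : ℝ := ∫ y in B, -log (max r ‖y - q‖)

theorem integrableOn_radPot (hBb : Bornology.IsBounded B) {r : ℝ} (hr : 0 < r) :
    IntegrableOn (fun y => -log (max r ‖y - q‖)) B := by
  have hc : Continuous fun y : Plane => -log (max r ‖y - q‖) :=
    (Continuous.log (by fun_prop) (fun y => (lt_max_of_lt_left hr).ne')).neg
  exact (hc.continuousOn.integrableOn_compact hBb.isCompact_closure).mono_set subset_closure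

theorem radPot_of_subset (hBm : MeasurableSet B) {r : ℝ}
    (hB : B ⊆ Metric.closedBall q r) : radPot B q r = -(volume.real B * log r) := by
  have : radPot B q r = ∫ y in B, -log r := by
    refine setIntegral_congr_fun hBm fun y hy => ?_
    have := mem_closedBall_iff_norm.1 (hB hy)
    simp only [max_eq_left this]
  rw [this, setIntegral_const, smul_eq_mul]; ring

theorem volume_real_ball (q : Plane) {r : ℝ} (hr : 0 ≤ r) :
    volume.real (Metric.ball q r) = π * r ^ 2 := by
  rw [Measure.real, EuclideanSpace.volume_ball_fin_two]
  rw [ENNReal.toReal_mul, ENNReal.toReal_pow, ENNReal.toReal_ofReal hr, ENNReal.toReal_ofReal pi_pos.le,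
    mul_comm]

theorem volume_real_closedBall (q : Plane) {r : ℝ} (hr : 0 ≤ r) :
    volume.real (Metric.closedBall q r) = π * r ^ 2 := by
  rw [Measure.real, EuclideanSpace.volume_closedBall_fin_two]
  rw [ENNReal.toReal_mul, ENNReal.toReal_pow, ENNReal.toReal_ofReal hr, ENNReal.toReal_ofReal pi_pos.le,
    mul_comm]

theorem radPot_sub_ge (hBb : Bornology.IsBounded B) {r s : ℝ} (hr : 0 < r)
    (hrs : r ≤ s) (hrB : Metric.ball q r ⊆ B) :
    π * r ^ 2 * log (s / r) ≤ radPot B q r - radPot B q s := by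
  have i1 := integrableOn_radPot (q := q) hBb hr
  have i2 := integrableOn_radPot (q := q) hBb (hr.trans_le hrs)
  have i3 : IntegrableOn (fun y => -log (max r ‖y - q‖) - -log (max s ‖y - q‖)) B := i1.sub i2
  unfold radPot
  rw [← integral_sub i1 i2, log_div (hr.trans_le hrs).ne' hr.ne']
  have h1 : ∫ y in Metric.ball q r, (-log (max r ‖y - q‖) - -log (max s ‖y - q‖))
      = π * r ^ 2 * (log s - log r) := by
    have : ∫ y in Metric.ball q r, (-log (max r ‖y - q‖) - -log (max s ‖y - q‖))
        = ∫ y in Metric.ball q r, (log s - log r) := by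
      refine setIntegral_congr_fun measurableSet_ball fun y hy => ?_
      have := mem_ball_iff_norm.1 hy
      simp only [max_eq_left this.le, max_eq_left (this.le.trans hrs)]; ring
    rw [this, setIntegral_const, volume_real_ball q hr.le, smul_eq_mul]
  rw [← h1]
  refine setIntegral_mono_set i3 ?_ hrB.eventuallyLE
  refine ae_of_all _ fun y => ?_
  have := log_le_log (lt_max_of_lt_left hr) (max_le_max_right ‖y - q‖ hrs)
  simp only [Pi.zero_apply]; linarith

theorem setIntegral_abs_log_norm_le (hBm : MeasurableSet B) (hBb : Bornology.IsBounded B) {D : ℝ}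
    (x : Plane) (hD : ∀ y ∈ B, ‖x - y‖ ≤ D) :
    ∫ y in B, |log ‖x - y‖| ≤ 2 * π + volume.real B + D * volume.real B := by
  have hfin : volume B ≠ ⊤ := hBb.measure_lt_top.ne
  have i1 := integrableOn_inv_norm hBm hfin x
  have ic : IntegrableOn (fun _ : Plane => D) B := integrableOn_const hfin
  have h1 : ∫ y in B, |log ‖x - y‖| ≤ ∫ y in B, (‖x - y‖⁻¹ + D) :=
    setIntegral_mono_on (integrableOn_log_norm hBm hBb x).abs (i1.add ic) hBm fun y hy =>
      (abs_log_le_inv_add (norm_nonneg _)).trans (add_le_add_right (hD y hy) _)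
  rw [integral_add i1 ic, setIntegral_const, smul_eq_mul] at h1
  have := setIntegral_inv_norm_le' hBm hBb x
  linarith

theorem integral_logPot_circlePt (hBm : MeasurableSet B) (hBb : Bornology.IsBounded B) {r : ℝ}
    (hr : 0 < r) :
    ∫ θ in (0 : ℝ)..2 * π, logPot (fun _ => 1) B (circlePt q r θ) = 2 * π * radPot B q r := by
  have h2π : (0 : ℝ) ≤ 2 * π := by positivity
  have hfin : volume B ≠ ⊤ := hBb.measure_lt_top.ne
  rw [intervalIntegral.integral_of_le h2π]
  unfold logPot radPot
  simp only [one_mul]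
  have hm : Measurable
      (Function.uncurry fun (θ : ℝ) (y : Plane) => -log ‖circlePt q r θ - y‖) :=
    (measurable_log.comp (((continuous_circlePt q r).comp continuous_fst).sub
      continuous_snd).norm.measurable).neg
  obtain ⟨D, hD⟩ := hBb.subset_closedBall q
  have hint : Integrable (Function.uncurry fun (θ : ℝ) (y : Plane) => -log ‖circlePt q r θ - y‖)
      ((volume.restrict (Set.Ioc 0 (2 * π))).prod (volume.restrict B)) := by
    have hms := hm.aestronglyMeasurable
      (μ := (volume.restrict (Set.Ioc 0 (2 * π))).prod (volume.restrict B))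
    have hi : ∀ θ, IntegrableOn (fun y => -log ‖circlePt q r θ - y‖) B := fun θ =>
      (integrableOn_log_norm hBm hBb (circlePt q r θ)).neg
    rw [integrable_prod_iff hms]
    refine ⟨ae_of_all _ hi, ?_⟩
    have hm' : StronglyMeasurable fun θ : ℝ => ∫ y in B, ‖-log ‖circlePt q r θ - y‖‖ :=
      StronglyMeasurable.integral_prod_right (ν := volume.restrict B)
        hm.norm.stronglyMeasurable
    have hic : IntegrableOn (fun _ : ℝ => 2 * π + volume.real B + (r + D) * volume.real B)
      (Set.Ioc 0 (2 * π)) := integrableOn_const measure_Ioc_lt_top.ne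
    refine Integrable.mono' hic hm'.aestronglyMeasurable (ae_of_all _ fun θ => ?_)
    rw [Real.norm_eq_abs]
    simp only [Function.uncurry_apply_pair, norm_neg, Real.norm_eq_abs]
    rw [abs_of_nonneg (integral_nonneg fun _ => abs_nonneg _)]
    refine setIntegral_abs_log_norm_le hBm hBb _ fun y hy => ?_
    have h1 := norm_sub_le_norm_sub_add_norm_sub (circlePt q r θ) q y
    have h2 := mem_closedBall_iff_norm.1 (hD hy)
    rw [norm_circlePt_sub hr.le, norm_sub_rev q y] at h1
    linarith
  rw [integral_integral_swap hint, ← integral_const_mul]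
  congr 1; funext y
  rw [← intervalIntegral.integral_of_le h2π, intervalIntegral.integral_neg,
    integral_log_norm_circlePt_sub hr]
  ring

theorem abs_logPot_one_sub_radPot_le (hBm : MeasurableSet B) (hBb : Bornology.IsBounded B)
    {τ r : ℝ} (hr : 0 < r)
    (hsym : ∀ x x', ‖x - q‖ = r → ‖x' - q‖ = r →
      |logPot (fun _ => 1) B x - logPot (fun _ => 1) B x'| ≤ τ) {x : Plane} (hx : ‖x - q‖ = r) :
    |logPot (fun _ => 1) B x - radPot B q r| ≤ τ := by
  have hc : Continuous (logPot (fun _ => 1) B) :=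
    continuous_logPot hBm hBb measurable_const (P := 1) (by simp) (by norm_num)
  have h1 := integral_logPot_circlePt (q := q) hBm hBb hr
  have i1 : IntervalIntegrable (fun θ => logPot (fun _ => 1) B (circlePt q r θ)) volume 0 (2 * π) :=
    (hc.comp (continuous_circlePt q r)).intervalIntegrable _ _
  have h2 : ∫ θ in (0 : ℝ)..2 * π,
      (logPot (fun _ => 1) B x - logPot (fun _ => 1) B (circlePt q r θ))
      = 2 * π * (logPot (fun _ => 1) B x - radPot B q r) := by
    rw [intervalIntegral.integral_sub (by simp) i1, h1, intervalIntegral.integral_const,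
      smul_eq_mul]
    ring
  have h3 := intervalIntegral.norm_integral_le_of_norm_le_const (a := 0) (b := 2 * π) (C := τ)
    (f := fun θ => logPot (fun _ => 1) B x - logPot (fun _ => 1) B (circlePt q r θ))
    fun θ _ => hsym x _ hx (norm_circlePt_sub hr.le q θ)
  have h2π : (0 : ℝ) < 2 * π := by positivity
  rw [h2, Real.norm_eq_abs, abs_mul, sub_zero, abs_of_pos h2π, mul_comm τ] at h3
  exact le_of_mul_le_mul_left h3 h2π

theorem eq_lineReflect_of_norm_eq {x x' : Plane} (hne : x ≠ x') (hxx : ‖x - q‖ = ‖x' - q‖) :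
    ∃ e : Plane, ‖e‖ = 1 ∧ lineReflect e ⟪q, e⟫ x = x' := by
  have hd : 0 < ‖x - x'‖ := norm_pos_iff.2 (sub_ne_zero.2 hne)
  set d := ‖x - x'‖ with hdd
  refine ⟨d⁻¹ • (x - x'), ?_, ?_⟩
  · rw [norm_smul, norm_inv, Real.norm_of_nonneg hd.le, ← hdd, inv_mul_cancel₀ hd.ne']
  · rw [lineReflect, ← inner_sub_left, inner_smul_right]
    have h1 : x' - q = (x - q) - (x - x') := by abel
    have h2 : ‖x' - q‖ ^ 2 = ‖x - q‖ ^ 2 - 2 * ⟪x - q, x - x'⟫ + d ^ 2 := by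
      rw [h1, norm_sub_sq_real]
    rw [← hxx] at h2
    have h3 : ⟪q - x, x - x'⟫ = -(d ^ 2 / 2) := by
      rw [← neg_sub x q, inner_neg_left]; linarith
    rw [h3, smul_smul]
    have h4 : 2 * (d⁻¹ * -(d ^ 2 / 2)) * d⁻¹ = -1 := by field_simp
    rw [h4]; module

end

theorem integral_log_sub (D s : ℝ) :
    ∫ t in (0 : ℝ)..D, log (t - s) = (D - s) * log (D - s) + s * log s - D := by
  rw [intervalIntegral.integral_comp_sub_right (fun t => log t) s, integral_log, zero_sub,
    log_neg_eq_log]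
  ring

theorem integral_log_sub_ge {D s : ℝ} (hD : 0 < D) (hs : 0 ≤ s) :
    D * (log D - 2) ≤ ∫ t in (0 : ℝ)..D, log (t - s) := by
  rw [integral_log_sub]
  have key : ∀ u : ℝ, 0 ≤ u → u * log D + u - D ≤ u * log u := by
    intro u hu
    rcases hu.eq_or_lt with rfl | hu
    · simp; exact hD.le
    · have h1 := log_le_sub_one_of_pos (div_pos hD hu)
      rw [log_div hD.ne' hu.ne'] at h1
      have h2 := mul_le_mul_of_nonneg_left h1 hu.le
      have h3 : u * (D / u - 1) = D - u := by field_simp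
      rw [h3] at h2
      linarith
  rcases le_or_gt s D with h | h
  · have h1 := key s hs
    have h2 := key (D - s) (by linarith)
    linarith
  · have h1 : (s - D) * log (s - D) ≤ (s - D) * log s :=
      mul_le_mul_of_nonneg_left (log_le_log (by linarith) (by linarith)) (by linarith)
    have h2 : D * log D ≤ D * log s := mul_le_mul_of_nonneg_left (log_le_log hD h.le) hD.le
    have h3 : log (D - s) = log (s - D) := by rw [← log_neg_eq_log, neg_sub]
    rw [h3]
    linarith

theorem abs_log_le_two_mul_abs_sub_log (u : ℝ) : |log u| ≤ 2 * |u| - log u := by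
  rcases eq_or_ne u 0 with rfl | hu
  · simp
  have h := log_le_sub_one_of_pos (abs_pos.2 hu)
  rw [log_abs] at h
  rcases abs_cases (log u) with ⟨h1, h2⟩ | ⟨h1, h2⟩ <;> rw [h1] <;> linarith [abs_nonneg u]

theorem intervalIntegrable_log_sub (D s : ℝ) :
    IntervalIntegrable (fun t => log (t - s)) volume 0 D := by
  have h : IntervalIntegrable log volume (0 - s) (D - s) := intervalIntegral.intervalIntegrable_log'
  simpa using h.comp_sub_right s

section

variable {B : Set Plane} {ρ : Plane → ℝ} {P : ℝ}

theorem integrable_log_dist (hBm : MeasurableSet B) (hBb : Bornology.IsBounded B)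
    (hρ : Measurable ρ) (hP : ∀ y ∈ B, |ρ y| ≤ P) (x : Plane) {D : ℝ} (hD : 0 < D) :
    Integrable (Function.uncurry fun (t : ℝ) (y : Plane) => ρ y * log (t - ‖y - x‖))
      ((volume.restrict (Set.Ioc 0 D)).prod (volume.restrict B)) := by
  have hfin : volume B ≠ ⊤ := hBb.measure_lt_top.ne
  have hm : Measurable
      (Function.uncurry fun (t : ℝ) (y : Plane) => ρ y * log (t - ‖y - x‖)) := by
    refine (hρ.comp measurable_snd).mul (measurable_log.comp ?_)
    exact (measurable_fst.sub (measurable_snd.sub_const x).norm)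
  have hms := hm.aestronglyMeasurable
    (μ := (volume.restrict (Set.Ioc 0 D)).prod (volume.restrict B))
  obtain ⟨E, hE⟩ := hBb.subset_closedBall x
  have hi : ∀ y, IntegrableOn (fun t => ρ y * log (t - ‖y - x‖)) (Set.Ioc 0 D) := fun y =>
    ((intervalIntegrable_iff_integrableOn_Ioc_of_le hD.le).1
      (intervalIntegrable_log_sub D ‖y - x‖)).const_mul (ρ y)
  rw [integrable_prod_iff' hms]
  refine ⟨ae_of_all _ hi, ?_⟩
  have hm' : StronglyMeasurable fun y : Plane =>
      ∫ t in Set.Ioc 0 D, ‖ρ y * log (t - ‖y - x‖)‖ :=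
    StronglyMeasurable.integral_prod_left (μ := volume.restrict (Set.Ioc 0 D))
      (f := fun t y => ‖ρ y * log (t - ‖y - x‖)‖) hm.norm.stronglyMeasurable
  have hic : IntegrableOn (fun _ : Plane => P * (2 * (D + E) * D - D * (log D - 2))) B :=
    integrableOn_const hfin
  refine Integrable.mono' hic hm'.aestronglyMeasurable
    ((ae_restrict_iff' hBm).2 (ae_of_all _ fun y hy => ?_))
  rw [Real.norm_eq_abs]
  simp only [Function.uncurry_apply_pair, Real.norm_eq_abs, abs_mul]
  rw [abs_of_nonneg (integral_nonneg fun _ => by positivity), integral_const_mul,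
    ← intervalIntegral.integral_of_le hD.le]
  have hyE : ‖y - x‖ ≤ E := mem_closedBall_iff_norm.1 (hE hy)
  have i1 := intervalIntegrable_log_sub D ‖y - x‖
  have h1 : ∫ t in (0 : ℝ)..D, |log (t - ‖y - x‖)|
      ≤ ∫ t in (0 : ℝ)..D, (2 * (D + E) - log (t - ‖y - x‖)) := by
    refine intervalIntegral.integral_mono_on hD.le i1.abs (intervalIntegrable_const.sub i1)
      fun t ht => (abs_log_le_two_mul_abs_sub_log _).trans ?_
    have : |t - ‖y - x‖| ≤ D + E :=
      abs_le.2 ⟨by linarith [ht.1], by linarith [ht.2, norm_nonneg (y - x)]⟩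
    linarith
  rw [intervalIntegral.integral_sub (by simp) i1, intervalIntegral.integral_const, smul_eq_mul]
    at h1
  have h2 := integral_log_sub_ge hD (norm_nonneg (y - x))
  have h0 : 0 ≤ ∫ t in (0 : ℝ)..D, |log (t - ‖y - x‖)| :=
    intervalIntegral.integral_nonneg hD.le fun _ _ => abs_nonneg _
  refine mul_le_mul (hP y hy) ?_ h0 ((abs_nonneg _).trans (hP y hy))
  linarith

/-- A connected set has logarithmic capacity comparable to its diameter: a logarithmic potential
of a positive mass cannot be large on the whole of a connected set of large diameter. -/
theorem le_mul_of_le_logPot (hBm : MeasurableSet B) (hBb : Bornology.IsBounded B)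
    (hconn : IsPreconnected B) (hρ : Measurable ρ) (hP : ∀ y ∈ B, |ρ y| ≤ P)
    (hρ0 : ∀ y ∈ B, 0 ≤ ρ y) {b : ℝ} (hb : ∀ x ∈ B, b ≤ logPot ρ B x) {x x' : Plane} (hx : x ∈ B)
    (hx' : x' ∈ B) (hne : x ≠ x') :
    b ≤ (∫ y in B, ρ y) * (2 - log ‖x' - x‖) := by
  set D := ‖x' - x‖ with hDdef
  have hD : 0 < D := norm_pos_iff.2 (sub_ne_zero.2 hne.symm)
  have hint := integrable_log_dist hBm hBb hρ hP x hD
  have hae : ∀ᵐ t ∂volume.restrict (Set.Ioc 0 D),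
      IntegrableOn (fun y => ρ y * log (t - ‖y - x‖)) B := hint.prod_right_ae
  have hbt : ∀ᵐ t ∂volume.restrict (Set.Ioc 0 D),
      (∫ y in B, ρ y * log (t - ‖y - x‖)) ≤ -b := by
    filter_upwards [hae, ae_restrict_mem measurableSet_Ioc] with t ht htD
    obtain ⟨z, hz, hzt⟩ : t ∈ (fun z => ‖z - x‖) '' B := by
      refine hconn.intermediate_value hx hx'
        (continuous_id.sub continuous_const).norm.continuousOn ⟨?_, htD.2⟩
      simpa using htD.1.le
    have h1 := hb z hz
    have h2 : (∫ y in B, ρ y * log (t - ‖y - x‖)) ≤ ∫ y in B, -(ρ y * -log ‖z - y‖) := by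
      refine setIntegral_mono_ae_restrict ht (integrableOn_logPot hBm hBb hρ hP z).neg ?_
      have hs : ∀ᵐ y ∂volume.restrict B, y ∉ Metric.sphere x t :=
        ae_restrict_of_ae (measure_eq_zero_iff_ae_notMem.1 (Measure.addHaar_sphere _ x t))
      filter_upwards [hs, ae_restrict_mem hBm] with y hy hyB
      have hne : t - ‖y - x‖ ≠ 0 := by
        intro h; exact hy (mem_sphere_iff_norm.2 (by linarith))
      have h3 : |t - ‖y - x‖| ≤ ‖z - y‖ := by
        have := abs_norm_sub_norm_le (z - x) (y - x)
        simp only at hzt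
        rwa [hzt, sub_sub_sub_cancel_right] at this
      have h4 : log (t - ‖y - x‖) ≤ log ‖z - y‖ := by
        rw [← log_abs]; exact log_le_log (abs_pos.2 hne) h3
      have := mul_le_mul_of_nonneg_left h4 (hρ0 y hyB)
      linarith
    rw [integral_neg] at h2
    unfold logPot at h1
    linarith
  have h1 : ∫ t in Set.Ioc 0 D, ∫ y in B, ρ y * log (t - ‖y - x‖) ≤ ∫ t in Set.Ioc 0 D, -b := by
    have ic : IntegrableOn (fun _ : ℝ => -b) (Set.Ioc 0 D) := integrableOn_const measure_Ioc_lt_top.ne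
    exact integral_mono_ae hint.integral_prod_left ic hbt
  have hfin : volume B ≠ ⊤ := hBb.measure_lt_top.ne
  have iρ : IntegrableOn ρ B := Integrable.mono' (g := fun _ => P) (integrableOn_const hfin)
    hρ.aestronglyMeasurable ((ae_restrict_iff' hBm).2 (ae_of_all _ fun y hy => hP y hy))
  rw [integral_integral_swap hint, setIntegral_const, smul_eq_mul, Real.volume_real_Ioc_of_le hD.le]
    at h1
  have h2 : ∫ y in B, ρ y * (D * (log D - 2)) ≤
      ∫ y in B, ∫ t in Set.Ioc 0 D, ρ y * log (t - ‖y - x‖) := by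
    refine setIntegral_mono_on (iρ.mul_const _) hint.integral_prod_right hBm fun y hy => ?_
    rw [integral_const_mul, ← intervalIntegral.integral_of_le hD.le]
    exact mul_le_mul_of_nonneg_left (integral_log_sub_ge hD (norm_nonneg _)) (hρ0 y hy)
  rw [integral_mul_const] at h2
  have h3 : D * b ≤ D * ((∫ y in B, ρ y) * (2 - log D)) := by linarith
  exact le_of_mul_le_mul_left h3 hD

theorem exists_lt_norm_sub_of_lt_diam {B : Set Plane} {d : ℝ} (hd0 : 0 ≤ d)
    (hd : d < Metric.diam B) : ∃ x ∈ B, ∃ x' ∈ B, d < ‖x' - x‖ := by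
  by_contra! h
  refine absurd (Metric.diam_le_of_forall_dist_le hd0 fun x hx y hy => ?_) (not_le.2 hd)
  rw [dist_eq_norm, norm_sub_rev]; exact h x hx y hy

theorem le_mul_log_diam_of_le_logPot (hBm : MeasurableSet B) (hBb : Bornology.IsBounded B)
    (hconn : IsPreconnected B) (hρ : Measurable ρ) (hP : ∀ y ∈ B, |ρ y| ≤ P)
    (hρ0 : ∀ y ∈ B, 0 ≤ ρ y) {b : ℝ} (hb : ∀ x ∈ B, b ≤ logPot ρ B x)
    (hL : 0 < Metric.diam B) :
    b ≤ (∫ y in B, ρ y) * (2 - log (Metric.diam B / 2)) := by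
  obtain ⟨x, hx, x', hx', h⟩ := exists_lt_norm_sub_of_lt_diam (B := B) (d := Metric.diam B / 2)
    (by linarith) (by linarith)
  have hxx : x ≠ x' := by
    rintro rfl; simp at h; linarith
  refine (le_mul_of_le_logPot hBm hBb hconn hρ hP hρ0 hb hx hx' hxx).trans ?_
  refine mul_le_mul_of_nonneg_left ?_ (setIntegral_nonneg hBm hρ0)
  linarith [log_le_log (by linarith) h.le]

end

namespace IsPatch

variable {B : Set Plane} {p : Plane} {ρ h : Plane → ℝ} {c lam R τ : ℝ}

theorem lam_le (H : IsPatch B p ρ h c lam R) (hτ : lam * (Metric.diam B + R) ≤ τ) : lam ≤ τ :=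
  le_trans (by nlinarith [H.lam_nonneg, H.one_le, Metric.diam_nonneg (s := B)]) hτ

theorem half_le_dens (H : IsPatch B p ρ h c lam R) (hτ : lam * (Metric.diam B + R) ≤ τ)
    (hτ8 : τ ≤ 1 / 8) {x : Plane} (hx : x ∈ B) : 1 / 2 ≤ ρ x := by
  have h1 := abs_le.1 (H.abs_dens_sub_one_le hτ hx)
  linarith

theorem setIntegral_dens_le (H : IsPatch B p ρ h c lam R) (hτ : lam * (Metric.diam B + R) ≤ τ)
    (hτ8 : τ ≤ 1 / 8) : ∫ x in B, ρ x ≤ 3 / 2 * volume.real B := by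
  have hBm := H.measurableSet
  have ic : IntegrableOn (fun _ : Plane => (3 / 2 : ℝ)) B := integrableOn_const H.volume_ne_top
  have iρ : IntegrableOn ρ B := Integrable.mono' (g := fun _ => 3 / 2) ic
    H.meas.aestronglyMeasurable
    ((ae_restrict_iff' hBm).2 (ae_of_all _ fun y hy => H.abs_dens_le hτ hτ8 hy))
  have h1 := setIntegral_mono_on iρ ic hBm fun y hy => le_of_abs_le (H.abs_dens_le hτ hτ8 hy)
  rw [setIntegral_const, smul_eq_mul] at h1
  linarith

theorem exists_large (H : IsPatch B p ρ h c lam R) (hτ : lam * (Metric.diam B + R) ≤ τ)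
    (hτ8 : τ ≤ 1 / 8) (hτM : τ ≤ volume.real B / 16) :
    ∃ x ∈ B, volume.real B / 16 ≤ logPot ρ B x - c + h x := by
  by_contra! hc
  have h1 := H.virial hτ hτ8 hτM
  have ic : IntegrableOn (fun _ : Plane => volume.real B / 16) B := integrableOn_const H.volume_ne_top
  have h2 := setIntegral_mono_on (H.integrableOn hτ hτ8) ic H.measurableSet fun x hx => (hc x hx).le
  rw [setIntegral_const, smul_eq_mul] at h2
  nlinarith [H.volume_pos]

theorem exists_notMem_closedBall (H : IsPatch B p ρ h c lam R) (hR : volume.real B < π * R ^ 2)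
    (x : Plane) : ∃ z, z ∉ B ∧ ‖z - x‖ ≤ R := by
  by_contra! hc
  have h1 : Metric.closedBall x R ⊆ B := by
    intro z hz
    by_contra hzB
    exact absurd (mem_closedBall_iff_norm.1 hz) (not_le.2 (hc z hzB))
  have h2 := measureReal_mono h1 H.volume_ne_top
  rw [volume_real_closedBall x (by linarith [H.one_le])] at h2
  linarith

theorem logPot_sub_logPot_le (H : IsPatch B p ρ h c lam R) (hτ : lam * (Metric.diam B + R) ≤ τ)
    (hτ8 : τ ≤ 1 / 8) {x z : Plane} (hxz : ‖z - x‖ ≤ R) :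
    logPot ρ B x - logPot ρ B z ≤ 3 / 2 * ∫ y in B, R * ‖x - y‖⁻¹ := by
  have hBm := H.measurableSet
  have hP : ∀ y ∈ B, |ρ y| ≤ 3 / 2 := fun y hy => H.abs_dens_le hτ hτ8 hy
  have i1 := integrableOn_logPot hBm H.bounded H.meas hP x
  have i2 := integrableOn_logPot hBm H.bounded H.meas hP z
  have i3 : IntegrableOn (fun y => R * ‖x - y‖⁻¹) B :=
    (integrableOn_inv_norm hBm H.volume_ne_top x).const_mul R
  unfold logPot
  rw [← integral_sub i1 i2, ← integral_const_mul]
  refine setIntegral_mono_ae_restrict (i1.sub i2) (i3.const_mul _) ?_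
  filter_upwards [ae_restrict_ne B x, ae_restrict_ne B z, ae_restrict_mem hBm] with y hyx hyz hy
  have hx0 : 0 < ‖x - y‖ := norm_pos_iff.2 (sub_ne_zero.2 hyx.symm)
  have hz0 : 0 < ‖z - y‖ := norm_pos_iff.2 (sub_ne_zero.2 hyz.symm)
  have h1 : log ‖z - y‖ - log ‖x - y‖ ≤ R * ‖x - y‖⁻¹ := by
    rw [← log_div hz0.ne' hx0.ne']
    refine (log_le_sub_one_of_pos (div_pos hz0 hx0)).trans ?_
    rw [← div_eq_mul_inv, div_sub_one hx0.ne']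
    refine div_le_div_of_nonneg_right ?_ hx0.le
    have := norm_sub_le_norm_sub_add_norm_sub z x y
    linarith
  have h2 := H.half_le_dens hτ hτ8 hy
  have h3 := le_of_abs_le (hP y hy)
  have h4 : 0 ≤ R * ‖x - y‖⁻¹ := by have := H.one_le; positivity
  calc ρ y * -log ‖x - y‖ - ρ y * -log ‖z - y‖
      = ρ y * (log ‖z - y‖ - log ‖x - y‖) := by ring
    _ ≤ ρ y * (R * ‖x - y‖⁻¹) := mul_le_mul_of_nonneg_left h1 (by linarith)
    _ ≤ 3 / 2 * (R * ‖x - y‖⁻¹) := mul_le_mul_of_nonneg_right h3 h4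

/-- Near a point where the potential is large there is a definite part of the mass. -/
theorem volume_inter_closedBall_ge (H : IsPatch B p ρ h c lam R)
    (hτ : lam * (Metric.diam B + R) ≤ τ)
    (hτ8 : τ ≤ 1 / 8) (hτM : τ ≤ volume.real B / 64) (hR : volume.real B < π * R ^ 2) {x : Plane}
    (hx : x ∈ B) (hfx : volume.real B / 16 ≤ logPot ρ B x - c + h x) :
    volume.real B ^ 2 / (128000 * R ^ 2) ≤ volume.real (B ∩ Metric.closedBall x (64 * R)) := by
  have hBm := H.measurableSet
  have hR1 := H.one_le
  have hM0 := H.volume_pos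
  obtain ⟨z, hzB, hzx⟩ := H.exists_notMem_closedBall hR x
  have hzb := H.mem_closedBall hx (z := z) (by rwa [norm_sub_rev])
  have h1 := H.nonpos z hzb hzB
  have h2 : h x - h z ≤ τ := by
    refine (le_of_abs_le (H.pert_lip x (H.mem_closedBall_self hx) z hzb)).trans (le_trans ?_ hτ)
    rw [norm_sub_rev]
    exact mul_le_mul_of_nonneg_left (by linarith [Metric.diam_nonneg (s := B)]) H.lam_nonneg
  have h3 := H.logPot_sub_logPot_le hτ hτ8 hzx
  set M := volume.real B with hM
  set N := B ∩ Metric.closedBall x (64 * R) with hN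
  have hNm : MeasurableSet N := hBm.inter measurableSet_closedBall
  have hNB : N ⊆ B := Set.inter_subset_left
  have hNfin : volume N ≠ ⊤ := measure_ne_top_of_subset hNB H.volume_ne_top
  have i3 : IntegrableOn (fun y => R * ‖x - y‖⁻¹) B :=
    (integrableOn_inv_norm hBm H.volume_ne_top x).const_mul R
  have h4 : ∫ y in B \ N, R * ‖x - y‖⁻¹ ≤ M / 64 := by
    have hfin : volume (B \ N) ≠ ⊤ := measure_ne_top_of_subset Set.sdiff_subset H.volume_ne_top
    have ic : IntegrableOn (fun _ : Plane => (1 / 64 : ℝ)) (B \ N) := integrableOn_const hfin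
    have := setIntegral_mono_on (i3.mono_set Set.sdiff_subset) ic (hBm.diff hNm) fun y hy => by
      have : ¬ ‖y - x‖ ≤ 64 * R := fun h => hy.2 ⟨hy.1, mem_closedBall_iff_norm.2 h⟩
      rw [norm_sub_rev, not_le] at this
      show R * ‖x - y‖⁻¹ ≤ 1 / 64
      rw [← div_eq_mul_inv, div_le_iff₀ (by linarith)]
      linarith
    rw [setIntegral_const, smul_eq_mul] at this
    have h5 : volume.real (B \ N) ≤ M := measureReal_mono Set.sdiff_subset H.volume_ne_top
    linarith
  have h5 : ∫ y in B, R * ‖x - y‖⁻¹ = (∫ y in N, R * ‖x - y‖⁻¹) + ∫ y in B \ N, R * ‖x - y‖⁻¹ := by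
    have := integral_inter_add_sdiff (s := B) hNm i3
    rw [Set.inter_eq_self_of_subset_right hNB] at this
    exact this.symm
  have hr : 0 < M / (1000 * R) := by positivity
  have h6 := setIntegral_inv_norm_le hNm hNfin x hr
  rw [integral_const_mul R] at h5
  have h7 : R * ∫ y in N, ‖x - y‖⁻¹
      ≤ R * (2 * π * (M / (1000 * R)) + volume.real N / (M / (1000 * R))) :=
    mul_le_mul_of_nonneg_left h6 (by linarith)
  have h8 : R * (2 * π * (M / (1000 * R)) + volume.real N / (M / (1000 * R)))
      = 2 * π * M / 1000 + volume.real N * (1000 * R ^ 2) / M := by field_simp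
  have h9 : π * M ≤ 3.15 * M := mul_le_mul_of_nonneg_right pi_lt_d2.le hM0.le
  have h10 : M / 128 ≤ volume.real N * (1000 * R ^ 2) / M := by
    rw [integral_const_mul R] at h3
    rw [integral_const_mul R] at h5
    linarith
  rw [le_div_iff₀ hM0] at h10
  rw [div_le_iff₀ (by positivity)]
  linarith

theorem diam_le (H : IsPatch B p ρ h c lam R) (hτ : lam * (Metric.diam B + R) ≤ τ)
    (hτ8 : τ ≤ 1 / 8) (hτM : τ ≤ volume.real B / 64) (hR : volume.real B < π * R ^ 2) :
    Metric.diam B ≤ 64 * R * exp (256000 * R ^ 2 / volume.real B ^ 2 *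
      (5 * volume.real B + (3 * (2 * π + volume.real B) + 1) * R + 1)) := by
  have hBm := H.measurableSet
  have hR1 := H.one_le
  have hM0 := H.volume_pos
  have hτ0 := H.nonneg_of_le hτ
  by_contra! hc
  set L := Metric.diam B with hL
  have hKL : 64 * R < L := by
    refine lt_of_le_of_lt ?_ hc
    have h0 : (1 : ℝ) ≤ exp (256000 * R ^ 2 / volume.real B ^ 2 *
      (5 * volume.real B + (3 * (2 * π + volume.real B) + 1) * R + 1)) :=
      one_le_exp (by positivity)
    nlinarith
  have hL0 : 0 < L := by linarith
  obtain ⟨x, hx, hfx⟩ := H.exists_large hτ hτ8 (by linarith)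
  have hN := H.volume_inter_closedBall_ge hτ hτ8 hτM hR hx hfx
  obtain ⟨z, hzB, hzx⟩ := H.exists_notMem_closedBall hR x
  have h1 := H.le_slope_mul hτ hτ8 hx hzB (by rwa [norm_sub_rev])
  have hP : ∀ y ∈ B, |ρ y| ≤ 3 / 2 := fun y hy => H.abs_dens_le hτ hτ8 hy
  have hhalf : ∀ y ∈ B, 1 / 2 ≤ ρ y := fun y hy => H.half_le_dens hτ hτ8 hy
  have h2 := le_mul_log_diam_of_le_logPot hBm H.bounded H.conn H.meas hP
    (fun y hy => by linarith [hhalf y hy]) (b := c - τ) (fun y hy => by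
      have h3 := H.pos y hy
      have h4 := le_of_abs_le (H.abs_pert_le hτ (H.mem_closedBall_self hy))
      linarith) hL0
  have h3 := (abs_le.1 (H.abs_pert_le hτ (H.mem_closedBall_self hx))).1
  have h4 := H.setIntegral_dens_le hτ hτ8
  have hlam := H.lam_le hτ
  set M := volume.real B with hM
  have h5 : (3 * (2 * π + M) + lam) * ‖x - z‖ ≤ (3 * (2 * π + M) + 1) * R := by
    rw [norm_sub_rev]
    exact mul_le_mul (by linarith) hzx (norm_nonneg _) (by positivity)
  have ic : IntegrableOn (fun _ : Plane => (3 / 2 : ℝ)) B := integrableOn_const H.volume_ne_top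
  have iρ : IntegrableOn ρ B := Integrable.mono' (g := fun _ => 3 / 2) ic
    H.meas.aestronglyMeasurable
    ((ae_restrict_iff' hBm).2 (ae_of_all _ fun y hy => hP y hy))
  have i1 := integrableOn_logPot hBm H.bounded H.meas hP x
  have i2 : IntegrableOn (fun y => ρ y * log L) B := iρ.mul_const _
  have i3 : IntegrableOn (fun y => ρ y * log L + ρ y * -log ‖x - y‖) B := i2.add i1
  set N := B ∩ Metric.closedBall x (64 * R) with hNdef
  have hNm : MeasurableSet N := hBm.inter measurableSet_closedBall
  have hNB : N ⊆ B := Set.inter_subset_left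
  have hNfin : volume N ≠ ⊤ := measure_ne_top_of_subset hNB H.volume_ne_top
  have hpos : ∀ y ∈ B, y ≠ x → 0 ≤ log L - log ‖x - y‖ := fun y hy hyx => by
    have := log_le_log (norm_pos_iff.2 (sub_ne_zero.2 hyx.symm)) (H.norm_sub_le hx hy)
    linarith
  have h6 : ∫ y in N, (ρ y * log L + ρ y * -log ‖x - y‖)
      ≤ ∫ y in B, (ρ y * log L + ρ y * -log ‖x - y‖) := by
    refine setIntegral_mono_set i3 ?_ hNB.eventuallyLE
    filter_upwards [ae_restrict_ne B x, ae_restrict_mem hBm] with y hyx hy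
    have := mul_nonneg (show 0 ≤ ρ y by linarith [hhalf y hy]) (hpos y hy hyx)
    simp only [Pi.zero_apply]; linarith
  have iN : IntegrableOn (fun _ : Plane => 1 / 2 * (log L - log (64 * R))) N :=
    integrableOn_const hNfin
  have hlogK : 0 ≤ log L - log (64 * R) := by
    linarith [log_le_log (by positivity) hKL.le]
  have h7 : ∫ y in N, 1 / 2 * (log L - log (64 * R))
      ≤ ∫ y in N, (ρ y * log L + ρ y * -log ‖x - y‖) := by
    refine setIntegral_mono_ae_restrict iN (i3.mono_set hNB) ?_
    filter_upwards [ae_restrict_ne N x, ae_restrict_mem hNm] with y hyx hy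
    have h8 : log ‖x - y‖ ≤ log (64 * R) := by
      refine log_le_log (norm_pos_iff.2 (sub_ne_zero.2 hyx.symm)) ?_
      rw [norm_sub_rev]; exact mem_closedBall_iff_norm.1 hy.2
    have h9 : 1 / 2 * (log L - log (64 * R)) ≤ ρ y * (log L - log ‖x - y‖) :=
      mul_le_mul (hhalf y hy.1) (by linarith) hlogK (by linarith [hhalf y hy.1])
    linarith
  rw [setIntegral_const, smul_eq_mul] at h7
  have h8 : ∫ y in B, (ρ y * log L + ρ y * -log ‖x - y‖)
      = (∫ y in B, ρ y) * log L + logPot ρ B x := by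
    rw [integral_add i2 i1, integral_mul_const]; rfl
  rw [log_div hL0.ne' two_ne_zero] at h2
  have h9 : (∫ y in B, ρ y) * (2 + log 2) ≤ 3 / 2 * M * 3 := by
    refine mul_le_mul h4 (by linarith [log_two_lt_d9]) (by linarith [log_two_gt_d9]) (by positivity)
  set Q := 5 * M + (3 * (2 * π + M) + 1) * R + 1 with hQ
  have h10 : volume.real N * (1 / 2 * (log L - log (64 * R))) ≤ Q := by
    linarith
  have h11 : M ^ 2 / (128000 * R ^ 2) * (log L - log (64 * R)) ≤ 2 * Q := by
    have := mul_le_mul_of_nonneg_right hN hlogK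
    linarith
  have h12 : log L ≤ log (64 * R) + 256000 * R ^ 2 / M ^ 2 * Q := by
    have h13 : log L - log (64 * R)
        = 128000 * R ^ 2 / M ^ 2 * (M ^ 2 / (128000 * R ^ 2) * (log L - log (64 * R))) := by
      field_simp
    have h14 := mul_le_mul_of_nonneg_left h11 (show 0 ≤ 128000 * R ^ 2 / M ^ 2 by positivity)
    rw [← h13] at h14
    have h15 : 128000 * R ^ 2 / M ^ 2 * (2 * Q) = 256000 * R ^ 2 / M ^ 2 * Q := by ring
    linarith
  have h13 := exp_le_exp.2 h12
  rw [exp_add, exp_log hL0, exp_log (by positivity)] at h13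
  linarith

end IsPatch

theorem centroid_mem_closedBall {B : Set Plane} {x : Plane} {r : ℝ} (hBm : MeasurableSet B)
    (hBb : Bornology.IsBounded B) (hM : 0 < volume.real B) (h : B ⊆ Metric.closedBall x r) :
    centroid B ∈ Metric.closedBall x r := by
  have hi : IntegrableOn (fun x : Plane => x) B :=
    (continuous_id.continuousOn.integrableOn_compact hBb.isCompact_closure).mono_set subset_closure
  have h0 : volume B ≠ 0 := fun h0 => by simp [Measure.real, h0] at hM
  have := Convex.set_average_mem (convex_closedBall x r) Metric.isClosed_closedBall h0
    hBb.measure_lt_top.ne (f := fun y => y) ((ae_restrict_iff' hBm).2 (ae_of_all _ h)) hi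
  rwa [setAverage_eq] at this

theorem radPot_le_logPot {B : Set Plane} {q : Plane} (hBm : MeasurableSet B)
    (hBb : Bornology.IsBounded B) {r : ℝ} (hr : 0 < r) :
    radPot B q r ≤ logPot (fun _ => 1) B q := by
  unfold radPot logPot
  simp only [one_mul]
  refine setIntegral_mono_ae_restrict (integrableOn_radPot hBb hr)
    (integrableOn_log_norm hBm hBb q).neg ?_
  filter_upwards [ae_restrict_ne B q] with y hy
  rw [neg_le_neg_iff, norm_sub_rev q y]
  exact log_le_log (norm_pos_iff.2 (sub_ne_zero.2 hy)) (le_max_right _ _)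

theorem two_mul_le_diam_of_ball_subset {B : Set Plane} {q : Plane} (hBb : Bornology.IsBounded B)
    {r : ℝ} (hr : 0 ≤ r) (h : Metric.ball q r ⊆ B) : 2 * r ≤ Metric.diam B := by
  rcases hr.eq_or_lt with rfl | hr
  · simpa using Metric.diam_nonneg
  have h1 : Metric.closedBall q r ⊆ closure B := by
    rw [← closure_ball q hr.ne']; exact closure_mono h
  set e := mk2 (cos 0) (sin 0) with he
  have he1 : ‖e‖ = 1 := norm_mk2_cos_sin 0
  have h2 := Metric.dist_le_diam_of_mem hBb.closure
    (h1 (show q + r • e ∈ Metric.closedBall q r by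
      rw [mem_closedBall_iff_norm, add_sub_cancel_left, norm_smul, he1, mul_one,
        Real.norm_of_nonneg hr.le]))
    (h1 (show q - r • e ∈ Metric.closedBall q r by
      rw [mem_closedBall_iff_norm, sub_sub_cancel_left, norm_neg, norm_smul, he1, mul_one,
        Real.norm_of_nonneg hr.le]))
  rw [Metric.diam_closure, dist_eq_norm] at h2
  have h3 : q + r • e - (q - r • e) = (2 * r) • e := by module
  rwa [h3, norm_smul, he1, mul_one, Real.norm_of_nonneg (by linarith)] at h2

namespace IsPatch

variable {B : Set Plane} {p : Plane} {ρ h : Plane → ℝ} {c lam R τ : ℝ}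

theorem subset_closedBall (H : IsPatch B p ρ h c lam R) {x : Plane} (hx : x ∈ B) :
    B ⊆ Metric.closedBall x (Metric.diam B) := fun _ hy =>
  mem_closedBall_iff_norm.2 (H.norm_sub_le hy hx)

theorem closure_subset_closedBall (H : IsPatch B p ρ h c lam R) :
    closure B ⊆ Metric.closedBall p (Metric.diam B) :=
  closure_minimal (H.subset_closedBall H.mem) Metric.isClosed_closedBall

theorem abs_sub_logPot_one_le (H : IsPatch B p ρ h c lam R) (hτ : lam * (Metric.diam B + R) ≤ τ)
    {x : Plane} (hx : x ∈ Metric.closedBall p (Metric.diam B + R)) :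
    |(logPot ρ B x - c + h x) - (logPot (fun _ => 1) B x - c)|
      ≤ τ * (1 + 2 * π + volume.real B + (2 * Metric.diam B + R) * volume.real B) := by
  have hBm := H.measurableSet
  have h1 := H.logPot_one_sub hτ x
  have h2 := H.abs_pert_le hτ hx
  have hD : ∀ y ∈ B, ‖x - y‖ ≤ 2 * Metric.diam B + R := fun y hy => by
    have h3 := norm_sub_le_norm_sub_add_norm_sub x p y
    have h4 := H.norm_sub_le H.mem hy
    have h5 := mem_closedBall_iff_norm.1 hx
    linarith
  have h3 := setIntegral_abs_log_norm_le hBm H.bounded x hD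
  have h4 : |logPot (fun y => ρ y - 1) B x| ≤ τ * ∫ y in B, |log ‖x - y‖| := by
    unfold logPot
    refine abs_setIntegral_mul_le hBm (fun y hy => H.abs_dens_sub_one_le hτ hy)
      (H.nonneg_of_le hτ) (integrableOn_log_norm hBm H.bounded x).abs
      (ae_of_all _ fun y => by simp) le_rfl
  have h5 := mul_le_mul_of_nonneg_left h3 (H.nonneg_of_le hτ)
  have h6 : (logPot ρ B x - c + h x) - (logPot (fun _ => 1) B x - c)
      = logPot (fun y => ρ y - 1) B x + h x := by rw [← h1]; ring
  rw [h6]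
  refine (abs_add_le _ _).trans ?_
  linarith

theorem abs_logPot_one_sub_le (H : IsPatch B p ρ h c lam R)
    (hτ : lam * (Metric.diam B + R) ≤ τ) (hτ8 : τ ≤ 1 / 8) {a δ : ℝ} (ha : 0 < a) (hδ : 0 < δ)
    {x x' : Plane} (hxx : ‖x - centroid B‖ = ‖x' - centroid B‖) :
    |logPot (fun _ => 1) B x - logPot (fun _ => 1) B x'| ≤
      2 * (a * (2 * π + volume.real B)) + 2 / a *
        ((2 * (τ + 2 * τ * (2 * π + volume.real B)) * Metric.diam B ^ 3 * volume.real B / δ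
          + δ * volume.real B ^ 2) / (2 * volume.real B)) := by
  have hM := H.volume_pos
  have hτ0 := H.nonneg_of_le hτ
  have hL : 0 ≤ Metric.diam B := Metric.diam_nonneg
  rcases eq_or_ne x x' with rfl | hne
  · rw [sub_self, abs_zero]; positivity
  obtain ⟨e, he, hex⟩ := eq_lineReflect_of_norm_eq hne hxx
  have h1 := abs_logPot_one_sub_lineReflect_le H.isOpen H.bounded he ha ⟪centroid B, e⟫ x
  rw [hex] at h1
  have hD : ∫ x in B, ∫ y in B, (sliceMid B e x - sliceMid B e y) ^ 2 ≤
      2 * (τ + 2 * τ * (2 * π + volume.real B)) * Metric.diam B ^ 3 * volume.real B := by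
    refine (H.sliceMid_deficit_le hτ hτ8 he).trans ?_
    have := H.lam_le hτ
    gcongr
  have h2 := setIntegral_abs_sliceMid_sub_centroid_le H.isOpen H.bounded hM he hδ hD
  refine h1.trans ?_
  gcongr

/-- Almost radial symmetry of the potential forces a patch to lie between two close discs. -/
theorem exists_radii (H : IsPatch B p ρ h c lam R) (hτ : lam * (Metric.diam B + R) ≤ τ)
    (hτ8 : τ ≤ 1 / 8) (hτM : τ ≤ volume.real B / 16) (hR : volume.real B < π * R ^ 2) {T : ℝ}
    (hsym : ∀ x x', ‖x - centroid B‖ = ‖x' - centroid B‖ →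
      |logPot (fun _ => 1) B x - logPot (fun _ => 1) B x'| ≤ T / 2)
    (hT : τ * (1 + 2 * π + volume.real B + (2 * Metric.diam B + R) * volume.real B) ≤ T / 2)
    (hTM : T ≤ volume.real B / 64) :
    ∃ r s : ℝ, volume.real B / (64 * (2 * π + volume.real B)) ≤ r ∧ 2 * r ≤ Metric.diam B ∧
      Metric.diam B ≤ 2 * s ∧ π * r ^ 2 ≤ volume.real B ∧ volume.real B ≤ π * s ^ 2 ∧
      π * r ^ 2 * log (s / r) ≤ 2 * T ∧ |c + volume.real B * log s| ≤ T := by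
  have hBm := H.measurableSet
  have hBb := H.bounded
  have hM := H.volume_pos
  have hR1 := H.one_le
  have hL : 0 ≤ Metric.diam B := Metric.diam_nonneg
  have hclose : ∀ x ∈ Metric.closedBall p (Metric.diam B + R),
      |(logPot ρ B x - c + h x) - (logPot (fun _ => 1) B x - c)| ≤ T / 2 := fun x hx =>
    (H.abs_sub_logPot_one_le hτ hx).trans hT
  have hT0 : 0 ≤ T / 2 := (abs_nonneg _).trans (hclose p (H.mem_closedBall_self H.mem))
  set q := centroid B with hq
  have hqp : q ∈ Metric.closedBall p (Metric.diam B) :=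
    centroid_mem_closedBall hBm hBb hM (H.subset_closedBall H.mem)
  have hrad : ∀ {r : ℝ} {x : Plane}, 0 < r → ‖x - q‖ = r →
      |logPot (fun _ => 1) B x - radPot B q r| ≤ T / 2 := fun hr hx =>
    abs_logPot_one_sub_radPot_le hBm hBb hr (fun x x' h1 h2 => hsym x x' (h1.trans h2.symm)) hx
  -- the circumscribed circle
  obtain ⟨x₂, hx₂, hmax⟩ := hBb.isCompact_closure.exists_isMaxOn
    (closure_nonempty_iff.2 ⟨p, H.mem⟩)
    (continuous_id.sub continuous_const).norm.continuousOn (f := fun x => ‖x - q‖)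
  set s := ‖x₂ - q‖ with hs
  have hBs : B ⊆ Metric.closedBall q s := fun y hy =>
    mem_closedBall_iff_norm.2 (hmax (subset_closure hy))
  have hs0 : 0 ≤ s := norm_nonneg _
  have hMs : volume.real B ≤ π * s ^ 2 := by
    rw [← volume_real_closedBall q hs0]
    exact measureReal_mono hBs measure_closedBall_lt_top.ne
  have hspos : 0 < s := by
    rcases hs0.eq_or_lt with h0 | h0
    · rw [← h0] at hMs; norm_num at hMs; linarith
    · exact h0
  have hx₂B : x₂ ∉ B := by
    intro hB
    obtain ⟨ε, hε, hball⟩ := Metric.isOpen_iff.1 H.isOpen x₂ hB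
    have h1 : x₂ + (ε / 2 / s) • (x₂ - q) ∈ B := by
      refine hball (mem_ball_iff_norm.2 ?_)
      rw [add_sub_cancel_left, norm_smul, Real.norm_of_nonneg (by positivity), ← hs,
        div_mul_cancel₀ _ hspos.ne']
      linarith
    have h2 := mem_closedBall_iff_norm.1 (hBs h1)
    have h3 : x₂ + (ε / 2 / s) • (x₂ - q) - q = (1 + ε / 2 / s) • (x₂ - q) := by module
    rw [h3, norm_smul, Real.norm_of_nonneg (by positivity), ← hs, add_mul,
      div_mul_cancel₀ _ hspos.ne'] at h2
    linarith
  have hx₂p : x₂ ∈ Metric.closedBall p (Metric.diam B + R) :=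
    Metric.closedBall_subset_closedBall (by linarith) (H.closure_subset_closedBall hx₂)
  have hf₂ := H.nonpos x₂ hx₂p hx₂B
  have hf₂' : 0 ≤ logPot ρ B x₂ - c + h x₂ := by
    refine le_of_forall_pos_lt_add fun ε hε => ?_
    have hΛ : 0 < 3 * (2 * π + volume.real B) + lam := by have := H.lam_nonneg; positivity
    obtain ⟨y, hy, hyx⟩ := Metric.mem_closure_iff.1 hx₂
      (ε / (3 * (2 * π + volume.real B) + lam)) (by positivity)
    have h1 := H.pos y hy
    have h2 := le_of_abs_le (H.abs_sub_le hτ hτ8 (H.mem_closedBall_self hy) hx₂p)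
    rw [dist_eq_norm, norm_sub_rev, lt_div_iff₀ hΛ] at hyx
    linarith
  have hu₂ := abs_le.1 (hclose x₂ hx₂p)
  have hU₂ := abs_le.1 (hrad hspos rfl (x := x₂))
  rw [radPot_of_subset hBm hBs] at hU₂
  -- the inscribed circle
  have hBc : (Bᶜ : Set Plane).Nonempty := by
    obtain ⟨z, hz, -⟩ := H.exists_notMem_closedBall hR q
    exact ⟨z, hz⟩
  obtain ⟨x₁, hx₁, hd⟩ := H.isOpen.isClosed_compl.exists_infDist_eq_dist hBc q
  rw [dist_eq_norm, norm_sub_rev] at hd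
  set r := ‖x₁ - q‖ with hr
  have hrB : Metric.ball q r ⊆ B := by
    intro y hy
    by_contra hyB
    have h1 := Metric.infDist_le_dist_of_mem (x := q) (show y ∈ Bᶜ from hyB)
    rw [hd, dist_comm] at h1
    exact absurd (Metric.mem_ball.1 hy) (not_lt.2 h1)
  have hrR : r ≤ R := by
    obtain ⟨z, hz, hzq⟩ := H.exists_notMem_closedBall hR q
    have h1 := Metric.infDist_le_dist_of_mem (x := q) (show z ∈ Bᶜ from hz)
    rw [hd, dist_eq_norm, norm_sub_rev] at h1
    linarith
  have hx₁p : x₁ ∈ Metric.closedBall p (Metric.diam B + R) := by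
    rw [mem_closedBall_iff_norm] at hqp ⊢
    have := norm_sub_le_norm_sub_add_norm_sub x₁ q p
    linarith
  have hf₁ := H.nonpos x₁ hx₁p hx₁
  have hu₁ := abs_le.1 (hclose x₁ hx₁p)
  -- lower bound for the inner radius
  obtain ⟨x₀, hx₀, hfx₀⟩ := H.exists_large hτ hτ8 hτM
  have hu₀ := abs_le.1 (hclose x₀ (H.mem_closedBall_self hx₀))
  have huq : logPot (fun _ => 1) B x₀ - T / 2 ≤ logPot (fun _ => 1) B q := by
    rcases eq_or_ne x₀ q with h0 | h0
    · rw [h0]; linarith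
    · have h1 : 0 < ‖x₀ - q‖ := norm_pos_iff.2 (sub_ne_zero.2 h0)
      have h2 := abs_le.1 (hrad h1 rfl (x := x₀))
      have h3 := radPot_le_logPot (q := q) hBm hBb h1
      linarith
  have hlip := le_of_abs_le (abs_logPot_sub_le hBm hBb measurable_const (P := 1)
    (ρ := fun _ => 1) (by simp) (by norm_num) q x₁)
  rw [norm_sub_rev q x₁, ← hr] at hlip
  have hrlow : volume.real B / (64 * (2 * π + volume.real B)) ≤ r := by
    rw [div_le_iff₀ (by positivity)]
    linarith
  have hrpos : 0 < r := lt_of_lt_of_le (by positivity) hrlow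
  have hU₁ := abs_le.1 (hrad hrpos rfl (x := x₁))
  have h2r := two_mul_le_diam_of_ball_subset hBb hrpos.le hrB
  have hL2s : Metric.diam B ≤ 2 * s :=
    (Metric.diam_mono hBs Metric.isBounded_closedBall).trans (Metric.diam_closedBall hs0)
  have hrs : r ≤ s := by linarith
  have hgap := radPot_sub_ge (q := q) hBb hrpos hrs hrB
  rw [radPot_of_subset hBm hBs] at hgap
  refine ⟨r, s, hrlow, h2r, hL2s, ?_, hMs, ?_, ?_⟩
  · rw [← volume_real_ball q hrpos.le]
    exact measureReal_mono hrB H.volume_ne_top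
  · linarith
  · rw [abs_le]; constructor <;> linarith

end IsPatch

/-- The area and half diameter of a set lying between two close discs. -/
theorem abs_area_div_sq_sub_pi_le {M r s σ ω : ℝ} (hr : 0 < r) (h1 : r ≤ σ) (h2 : σ ≤ s)
    (hMr : π * r ^ 2 ≤ M) (hMs : M ≤ π * s ^ 2) (hω : log (s / r) ≤ ω) (hω4 : ω ≤ 1 / 4) :
    |M / σ ^ 2 - π| ≤ 16 * ω := by
  have hσ : 0 < σ := hr.trans_le h1
  have hs : 0 < s := hσ.trans_le h2
  have hω0 : 0 ≤ ω := (log_nonneg ((one_le_div hr).2 (h1.trans h2))).trans hω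
  have hsr : s / r ≤ exp ω := by rw [← log_le_iff_le_exp (by positivity)]; exact hω
  have h3 : (s / r) ^ 2 ≤ exp (2 * ω) := by
    rw [two_mul, exp_add, ← sq]
    exact pow_le_pow_left₀ (by positivity) hsr 2
  have h4 : 1 - 2 * ω ≤ exp (-(2 * ω)) := by linarith [add_one_le_exp (-(2 * ω))]
  have h5 : exp (2 * ω) ≤ 1 + 4 * ω := by
    have : exp (2 * ω) * exp (-(2 * ω)) = 1 := by rw [← exp_add]; simp
    have h6 : exp (2 * ω) * (1 - 2 * ω) ≤ 1 := by
      exact (mul_le_mul_of_nonneg_left h4 (exp_nonneg _)).trans this.le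
    nlinarith [exp_nonneg (2 * ω)]
  have hpi : π ≤ 4 := pi_le_four
  have hs2 : s ^ 2 ≤ (1 + 4 * ω) * r ^ 2 := by
    have := h3.trans h5
    rwa [div_pow, div_le_iff₀ (by positivity)] at this
  have hup : M ≤ (π + 16 * ω) * σ ^ 2 := by
    have h7 : r ^ 2 ≤ σ ^ 2 := pow_le_pow_left₀ hr.le h1 2
    calc M ≤ π * s ^ 2 := hMs
      _ ≤ π * ((1 + 4 * ω) * σ ^ 2) :=
        mul_le_mul_of_nonneg_left (hs2.trans (mul_le_mul_of_nonneg_left h7 (by linarith)))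
          pi_pos.le
      _ = (π + (4 * ω) * π) * σ ^ 2 := by ring
      _ ≤ (π + (4 * ω) * 4) * σ ^ 2 := by gcongr
      _ = (π + 16 * ω) * σ ^ 2 := by ring
  have hlow : (π - 16 * ω) * σ ^ 2 ≤ M := by
    have h7 : σ ^ 2 ≤ s ^ 2 := pow_le_pow_left₀ hσ.le h2 2
    have h8 : (1 - 4 * ω) * σ ^ 2 ≤ r ^ 2 := by
      have : (1 - 4 * ω) * σ ^ 2 ≤ (1 - 4 * ω) * ((1 + 4 * ω) * r ^ 2) :=
        mul_le_mul_of_nonneg_left (h7.trans hs2) (by linarith)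
      nlinarith [sq_nonneg (ω * r)]
    calc (π - 16 * ω) * σ ^ 2 ≤ (π - (4 * ω) * π) * σ ^ 2 := by
          refine mul_le_mul_of_nonneg_right ?_ (by positivity)
          nlinarith
      _ = π * ((1 - 4 * ω) * σ ^ 2) := by ring
      _ ≤ π * r ^ 2 := mul_le_mul_of_nonneg_left h8 pi_pos.le
      _ ≤ M := hMr
  have hσ2 : 0 < σ ^ 2 := by positivity
  rw [abs_le]
  constructor
  · have := (le_div_iff₀ hσ2).2 hlow
    linarith
  · have := (div_le_iff₀ hσ2).2 hup
    linarith

set_option maxHeartbeats 800000 in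
/-- A patch whose density and perturbation are almost constant at its own scale is almost a
disc. -/
theorem exists_forall_isPatch_almost_disc {M₁ M₂ η : ℝ} (hM₁ : 0 < M₁) (hM : M₁ ≤ M₂)
    (hη : 0 < η) :
    ∃ τ > (0 : ℝ), ∀ (B : Set Plane) (p : Plane) (ρ h : Plane → ℝ) (c lam : ℝ),
      IsPatch B p ρ h c lam (1 + M₂) → lam * (Metric.diam B + (1 + M₂)) ≤ τ →
      M₁ ≤ volume.real B → volume.real B ≤ M₂ →
      |volume.real B / (Metric.diam B / 2) ^ 2 - π| ≤ η ∧
        |c + volume.real B * log (Metric.diam B / 2)| ≤ η := by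
  have hM₂ : 0 < M₂ := hM₁.trans_le hM
  set R := 1 + M₂ with hR
  set S := 2 * π + M₂ with hS
  have hS0 : 0 < S := by positivity
  set Ls := 64 * R * exp (256000 * R ^ 2 / M₁ ^ 2 * (5 * M₂ + (3 * S + 1) * R + 1)) with hLs
  have hLs0 : 0 < Ls := by positivity
  set k := (M₁ / (64 * S)) ^ 2 with hk
  have hk0 : 0 < k := by positivity
  obtain ⟨T, hT0, hT1, hT2, hT3, hT4, hT5⟩ : ∃ T > (0 : ℝ), T ≤ M₁ / 64 ∧ T ≤ k / 4 ∧
      T ≤ k * η / 16 ∧ T ≤ η / 2 ∧ T ≤ k * η / (2 * M₂) :=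
    ⟨min (M₁ / 64) (min (k / 4) (min (k * η / 16) (min (η / 2) (k * η / (2 * M₂))))),
      by positivity, by simp, by simp, by simp, by simp, by simp⟩
  set a := T / (16 * S) with ha
  have ha0 : 0 < a := by positivity
  set δ := a * T / (8 * M₂) with hδ
  have hδ0 : 0 < δ := by positivity
  set Q := 1 + 2 * π + M₂ + (2 * Ls + R) * M₂ with hQ
  have hQ0 : 0 < Q := by positivity
  obtain ⟨τ, hτ0, hτ1, hτ2, hτ3, hτ4⟩ : ∃ τ > (0 : ℝ), τ ≤ 1 / 8 ∧ τ ≤ M₁ / 64 ∧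
      τ ≤ T / (2 * Q) ∧ τ ≤ a * T * δ / (16 * (1 + 2 * S) * Ls ^ 3) :=
    ⟨min (1 / 8) (min (M₁ / 64) (min (T / (2 * Q)) (a * T * δ / (16 * (1 + 2 * S) * Ls ^ 3)))),
      by positivity, by simp, by simp, by simp, by simp⟩
  refine ⟨τ, hτ0, fun B p ρ h c lam H hτ hMB hMB' => ?_⟩
  have hM0 := H.volume_pos
  have hL0 : 0 ≤ Metric.diam B := Metric.diam_nonneg
  have hRM : volume.real B < π * R ^ 2 := by
    have := pi_gt_three
    nlinarith
  have hL : Metric.diam B ≤ Ls := by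
    refine (H.diam_le hτ hτ1 (by linarith) hRM).trans ?_
    rw [hLs, hS]
    gcongr
  set M := volume.real B with hMdef
  set L := Metric.diam B with hLdef
  have hsym : ∀ x x', ‖x - centroid B‖ = ‖x' - centroid B‖ →
      |logPot (fun _ => 1) B x - logPot (fun _ => 1) B x'| ≤ T / 2 := by
    intro x x' hxx
    refine (H.abs_logPot_one_sub_le hτ hτ1 ha0 hδ0 hxx).trans ?_
    rw [← hMdef, ← hLdef]
    have e1 : 2 * (a * (2 * π + M)) + 2 / a *
        ((2 * (τ + 2 * τ * (2 * π + M)) * L ^ 3 * M / δ + δ * M ^ 2) / (2 * M))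
        = 2 * a * (2 * π + M) + 1 / a * (2 * τ * (1 + 2 * (2 * π + M)) * L ^ 3 / δ + δ * M) := by
      field_simp
    rw [e1]
    have e2 : 2 * a * (2 * π + M) + 1 / a * (2 * τ * (1 + 2 * (2 * π + M)) * L ^ 3 / δ + δ * M)
        ≤ 2 * a * S + 1 / a * (2 * τ * (1 + 2 * S) * Ls ^ 3 / δ + δ * M₂) := by
      rw [hS]; gcongr
    refine e2.trans ?_
    have e3 : 2 * a * S = T / 8 := by rw [ha]; field_simp; ring
    have e4 : 1 / a * (δ * M₂) = T / 8 := by rw [hδ]; field_simp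
    have e5 : 2 * τ * (1 + 2 * S) * Ls ^ 3 / δ ≤ a * (T / 8) := by
      rw [le_div_iff₀ (by positivity)] at hτ4
      rw [div_le_iff₀ hδ0]
      linarith
    have e6 : 1 / a * (2 * τ * (1 + 2 * S) * Ls ^ 3 / δ) ≤ T / 8 := by
      rw [one_div, inv_mul_le_iff₀ ha0]; exact e5
    linarith
  have hTT : τ * (1 + 2 * π + M + (2 * L + R) * M) ≤ T / 2 := by
    have e1 : τ * (1 + 2 * π + M + (2 * L + R) * M) ≤ τ * Q := by rw [hQ]; gcongr
    rw [le_div_iff₀ (by positivity)] at hτ3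
    linarith
  obtain ⟨r, s, h1, h2, h3, h4, h5, h6, h7⟩ := H.exists_radii hτ hτ1 (by linarith) hRM hsym hTT
    (by linarith)
  rw [← hMdef] at h1 h4 h5 h7
  have hrk : M₁ / (64 * S) ≤ r := by
    refine le_trans ?_ h1
    rw [hS]; gcongr
  have hr0 : 0 < r := lt_of_lt_of_le (by positivity) hrk
  have hrs : r ≤ s := by linarith
  have hs0 : 0 < s := hr0.trans_le hrs
  have hlog : 0 ≤ log (s / r) := log_nonneg ((one_le_div hr0).2 hrs)
  have hω : log (s / r) ≤ T / k := by
    rw [le_div_iff₀ hk0]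
    have e1 : k ≤ r ^ 2 := pow_le_pow_left₀ (by positivity) hrk 2
    have e2 : 2 * k ≤ π * r ^ 2 := mul_le_mul two_le_pi e1 hk0.le pi_pos.le
    have e3 := mul_le_mul_of_nonneg_right e2 hlog
    linarith
  refine ⟨(abs_area_div_sq_sub_pi_le hr0 (by linarith) (by linarith) h4 h5 hω ?_).trans ?_, ?_⟩
  · rw [div_le_iff₀ hk0]; linarith
  · have : T / k ≤ η / 16 := by rw [div_le_iff₀ hk0]; linarith
    linarith
  · have hσ : 0 < L / 2 := by linarith
    have e1 : 0 ≤ log s - log (L / 2) := by linarith [log_le_log hσ (show L / 2 ≤ s by linarith)]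
    have e2 : log s - log (L / 2) ≤ T / k := by
      have := log_le_log hr0 (show r ≤ L / 2 by linarith)
      rw [log_div hs0.ne' hr0.ne'] at hω
      linarith
    have e3 : M * (log s - log (L / 2)) ≤ η / 2 := by
      have e4 : M * (log s - log (L / 2)) ≤ M₂ * (T / k) :=
        mul_le_mul hMB' e2 e1 hM₂.le
      have e5 : M₂ * (T / k) ≤ η / 2 := by
        rw [le_div_iff₀ (by positivity)] at hT5
        rw [← mul_div_assoc, div_le_iff₀ hk0]
        linarith
      linarith
    have e6 := mul_nonneg hM0.le e1
    have e7 := abs_le.1 h7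
    rw [abs_le]; constructor <;> linarith

/-- The integrand of the regular part of the ring kernel. -/
def ringRem (t θ : ℝ) : ℝ :=
  (cos θ - cos (θ / 2)) / √(t ^ 2 + 4 * sin (θ / 2) ^ 2)

/-- The regular part of the ring kernel as a function of the scaled distance. -/
def ringReg (t : ℝ) : ℝ :=
  log (2 + √(t ^ 2 + 4)) + (∫ θ in (-π)..π, ringRem t θ) / 2

theorem abs_sqrt_sq_add_sub_le {b : ℝ} (hb : 0 ≤ b) (s t : ℝ) :
    |√(s ^ 2 + b) - √(t ^ 2 + b)| ≤ |s - t| := by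
  have h0 : 0 ≤ √(s ^ 2 + b) + √(t ^ 2 + b) := by positivity
  have hs : |s| ≤ √(s ^ 2 + b) := abs_le_sqrt (by linarith)
  have ht : |t| ≤ √(t ^ 2 + b) := abs_le_sqrt (by linarith)
  have h1 : (√(s ^ 2 + b) - √(t ^ 2 + b)) * (√(s ^ 2 + b) + √(t ^ 2 + b)) = (s - t) * (s + t) := by
    have e1 := sq_sqrt (show 0 ≤ s ^ 2 + b by positivity)
    have e2 := sq_sqrt (show 0 ≤ t ^ 2 + b by positivity)
    linear_combination e1 - e2
  rcases h0.eq_or_lt with h | h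
  · have : √(s ^ 2 + b) = √(t ^ 2 + b) := by
      have := sqrt_nonneg (s ^ 2 + b); have := sqrt_nonneg (t ^ 2 + b); linarith
    rw [this, sub_self, abs_zero]; exact abs_nonneg _
  · have h2 := congrArg abs h1
    rw [abs_mul, abs_mul, abs_of_pos h] at h2
    have h3 : |s + t| ≤ √(s ^ 2 + b) + √(t ^ 2 + b) := (abs_add_le s t).trans (by linarith)
    refine le_of_mul_le_mul_right ?_ h
    rw [h2]
    exact mul_le_mul_of_nonneg_left h3 (abs_nonneg _)

theorem abs_cos_sub_cos_half_le {θ : ℝ} (h1 : -π ≤ θ) (h2 : θ ≤ π) :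
    |cos θ - cos (θ / 2)| ≤ 3 * sin (θ / 2) ^ 2 := by
  have hc0 : 0 ≤ cos (θ / 2) := cos_nonneg_of_neg_pi_div_two_le_of_le (by linarith) (by linarith)
  have hc1 := cos_le_one (θ / 2)
  have h3 : cos θ = 2 * cos (θ / 2) ^ 2 - 1 := by rw [← cos_two_mul]; congr 1; ring
  rw [h3, sin_sq]
  rw [abs_le]; constructor <;> nlinarith

theorem measurable_ringRem (t : ℝ) : Measurable (ringRem t) := by
  unfold ringRem
  fun_prop

theorem abs_ringRem_le (t : ℝ) {θ : ℝ} (h1 : -π ≤ θ) (h2 : θ ≤ π) : |ringRem t θ| ≤ 3 / 2 := by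
  unfold ringRem
  rw [abs_div, abs_of_nonneg (sqrt_nonneg _)]
  refine div_le_of_le_mul₀ (sqrt_nonneg _) (by norm_num) ?_
  have h3 := abs_cos_sub_cos_half_le h1 h2
  have h4 : |2 * sin (θ / 2)| ≤ √(t ^ 2 + 4 * sin (θ / 2) ^ 2) :=
    abs_le_sqrt (by nlinarith [sq_nonneg t])
  rw [abs_mul, abs_two] at h4
  have h5 := abs_sin_le_one (θ / 2)
  have h6 : sin (θ / 2) ^ 2 = |sin (θ / 2)| * |sin (θ / 2)| := by rw [abs_mul_abs_self, sq]
  nlinarith [abs_nonneg (sin (θ / 2))]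

theorem intervalIntegrable_ringRem (t : ℝ) : IntervalIntegrable (ringRem t) volume (-π) π := by
  have hπ : -π ≤ π := by linarith [pi_pos]
  rw [intervalIntegrable_iff_integrableOn_Ioc_of_le hπ]
  refine Integrable.mono' (g := fun _ => (3 / 2 : ℝ)) (integrableOn_const measure_Ioc_lt_top.ne)
    (measurable_ringRem t).aestronglyMeasurable
    ((ae_restrict_iff' measurableSet_Ioc).2 (ae_of_all _ fun θ hθ => ?_))
  exact abs_ringRem_le t hθ.1.le hθ.2

theorem abs_ringRem_sub_le {s t : ℝ} {θ : ℝ} (h1 : -π ≤ θ) (h2 : θ ≤ π) :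
    |ringRem s θ - ringRem t θ| ≤ 3 / 4 * |s - t| := by
  unfold ringRem
  have h3 := abs_cos_sub_cos_half_le h1 h2
  rcases eq_or_ne (sin (θ / 2)) 0 with h0 | h0
  · rw [h0] at h3
    have : cos θ - cos (θ / 2) = 0 := by
      have := abs_nonpos_iff.1 (h3.trans_eq (by norm_num)); exact this
    rw [this]; simp
  have hw : 0 < 4 * sin (θ / 2) ^ 2 := by positivity
  set b := 4 * sin (θ / 2) ^ 2 with hb
  have hs : 0 < √(s ^ 2 + b) := sqrt_pos.2 (by positivity)
  have ht : 0 < √(t ^ 2 + b) := sqrt_pos.2 (by positivity)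
  have e1 : (cos θ - cos (θ / 2)) / √(s ^ 2 + b) - (cos θ - cos (θ / 2)) / √(t ^ 2 + b)
      = (cos θ - cos (θ / 2)) * (√(t ^ 2 + b) - √(s ^ 2 + b)) / (√(s ^ 2 + b) * √(t ^ 2 + b)) := by
    field_simp
  rw [e1, abs_div, abs_mul, abs_of_pos (mul_pos hs ht), div_le_iff₀ (mul_pos hs ht)]
  have h4 := abs_sqrt_sq_add_sub_le hw.le t s
  have h5 : b ≤ √(s ^ 2 + b) * √(t ^ 2 + b) := by
    rw [← sqrt_mul (by positivity)]
    refine le_sqrt_of_sq_le ?_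
    nlinarith [sq_nonneg s, sq_nonneg t, mul_nonneg (sq_nonneg s) (sq_nonneg t)]
  rw [abs_sub_comm t s] at h4
  calc |cos θ - cos (θ / 2)| * |√(t ^ 2 + b) - √(s ^ 2 + b)|
      ≤ (3 / 4 * b) * |s - t| := mul_le_mul (by linarith) h4 (abs_nonneg _) (by positivity)
    _ = 3 / 4 * |s - t| * b := by ring
    _ ≤ 3 / 4 * |s - t| * (√(s ^ 2 + b) * √(t ^ 2 + b)) :=
        mul_le_mul_of_nonneg_left h5 (by positivity)

theorem abs_ringReg_sub_le (s t : ℝ) : |ringReg s - ringReg t| ≤ 4 * |s - t| := by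
  have hπ : -π ≤ π := by linarith [pi_pos]
  have h1 : |log (2 + √(s ^ 2 + 4)) - log (2 + √(t ^ 2 + 4))| ≤ |s - t| := by
    have key : ∀ a b : ℝ, log (2 + √(a ^ 2 + 4)) - log (2 + √(b ^ 2 + 4)) ≤ |a - b| := by
      intro a b
      have ha : 0 < 2 + √(a ^ 2 + 4) := by positivity
      have hb : 0 < 2 + √(b ^ 2 + 4) := by positivity
      rw [← log_div ha.ne' hb.ne']
      refine (log_le_sub_one_of_pos (div_pos ha hb)).trans ?_
      rw [div_sub_one hb.ne', div_le_iff₀ hb]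
      have h1 := le_of_abs_le (abs_sqrt_sq_add_sub_le (show (0 : ℝ) ≤ 4 by norm_num) a b)
      nlinarith [abs_nonneg (a - b), sqrt_nonneg (b ^ 2 + 4)]
    rw [abs_le]
    have h2 := key t s
    rw [abs_sub_comm] at h2
    exact ⟨by linarith, key s t⟩
  have h2 := intervalIntegral.norm_integral_le_of_norm_le_const (a := -π) (b := π)
    (C := 3 / 4 * |s - t|) (f := fun θ => ringRem s θ - ringRem t θ) fun θ hθ => by
      rw [Set.uIoc_of_le hπ] at hθ
      exact abs_ringRem_sub_le hθ.1.le hθ.2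
  rw [intervalIntegral.integral_sub (intervalIntegrable_ringRem s) (intervalIntegrable_ringRem t),
    Real.norm_eq_abs, show π - -π = 2 * π by ring, abs_of_pos (show 0 < 2 * π by positivity)] at h2
  have h3 : 3 / 4 * |s - t| * (2 * π) ≤ 3 / 4 * |s - t| * (2 * 4) := by
    have := pi_le_four; gcongr
  unfold ringReg
  rw [abs_le] at *
  constructor <;> linarith

theorem integral_cos_half_div {t : ℝ} (ht : 0 < t) :
    ∫ θ in (-π)..π, cos (θ / 2) / √(t ^ 2 + 4 * sin (θ / 2) ^ 2)
      = 2 * (-log t + log (2 + √(t ^ 2 + 4))) := by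
  have hpos : ∀ θ : ℝ, 0 < t ^ 2 + 4 * sin (θ / 2) ^ 2 := fun θ => by positivity
  have hd : ∀ θ ∈ Set.uIcc (-π) π, HasDerivAt (fun θ => arsinh (2 * sin (θ / 2) / t))
      (cos (θ / 2) / √(t ^ 2 + 4 * sin (θ / 2) ^ 2)) θ := by
    intro θ _
    have h1 : HasDerivAt (fun θ : ℝ => 2 * sin (θ / 2) / t) (2 * (cos (θ / 2) * (1 / 2)) / t) θ :=
      (((hasDerivAt_id θ).div_const 2).sin.const_mul 2).div_const t
    have h2 := h1.arsinh
    convert h2 using 1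
    have e : 1 + (2 * sin (θ / 2) / t) ^ 2 = (t ^ 2 + 4 * sin (θ / 2) ^ 2) / t ^ 2 := by
      field_simp; ring
    rw [e, sqrt_div (hpos θ).le, sqrt_sq ht.le, smul_eq_mul]
    have := sqrt_pos.2 (hpos θ)
    field_simp
  rw [intervalIntegral.integral_eq_sub_of_hasDerivAt hd]
  · have e1 : sin (-π / 2) = -1 := by rw [neg_div, sin_neg, sin_pi_div_two]
    rw [e1, sin_pi_div_two, mul_neg, neg_div, arsinh_neg, mul_one, sub_neg_eq_add, ← two_mul,
      arsinh]
    have e2 : 2 / t + √(1 + (2 / t) ^ 2) = (2 + √(t ^ 2 + 4)) / t := by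
      have : 1 + (2 / t) ^ 2 = (t ^ 2 + 4) / t ^ 2 := by field_simp; ring
      rw [this, sqrt_div (by positivity), sqrt_sq ht.le]
      ring
    rw [e2, log_div (by positivity) ht.ne']
    ring
  · refine Continuous.intervalIntegrable ?_ _ _
    exact Continuous.div (by fun_prop) (by fun_prop) fun θ => (sqrt_pos.2 (hpos θ)).ne'

theorem integral_cos_div {t : ℝ} (ht : 0 < t) :
    ∫ θ in (-π)..π, cos θ / √(t ^ 2 + 4 * sin (θ / 2) ^ 2) = 2 * (-log t + ringReg t) := by
  have hpos : ∀ θ : ℝ, 0 < t ^ 2 + 4 * sin (θ / 2) ^ 2 := fun θ => by positivity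
  have i1 : IntervalIntegrable (fun θ => cos (θ / 2) / √(t ^ 2 + 4 * sin (θ / 2) ^ 2))
      volume (-π) π :=
    (Continuous.div (by fun_prop) (by fun_prop)
      fun θ => (sqrt_pos.2 (hpos θ)).ne').intervalIntegrable _ _
  have h1 : ∀ θ, cos θ / √(t ^ 2 + 4 * sin (θ / 2) ^ 2)
      = cos (θ / 2) / √(t ^ 2 + 4 * sin (θ / 2) ^ 2) + ringRem t θ := fun θ => by
    unfold ringRem; ring
  simp_rw [h1]
  rw [intervalIntegral.integral_add i1 (intervalIntegrable_ringRem t), integral_cos_half_div ht,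
    ringReg]
  ring

theorem norm_sub_sq_plane (x y : Plane) : ‖x - y‖ ^ 2 = (x 0 - y 0) ^ 2 + (x 1 - y 1) ^ 2 := by
  rw [norm_sq_plane]; rfl

theorem Gstar_eq {x y : Plane} (hx : 0 < x 0) (hy : 0 < y 0) (hne : x ≠ y) :
    Gstar x y = √(x 0) * (y 0 * √(y 0)) / (2 * π) *
      (-log (‖x - y‖ / √(x 0 * y 0)) + ringReg (‖x - y‖ / √(x 0 * y 0))) := by
  have hab : 0 < x 0 * y 0 := mul_pos hx hy
  have hs : 0 < √(x 0 * y 0) := sqrt_pos.2 hab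
  have hd : 0 < ‖x - y‖ := norm_pos_iff.2 (sub_ne_zero.2 hne)
  have ht : 0 < ‖x - y‖ / √(x 0 * y 0) := div_pos hd hs
  have h1 := integral_cos_div ht
  set t := ‖x - y‖ / √(x 0 * y 0) with htdef
  have h2 : ∀ θ : ℝ, cos θ / √((x 1 - y 1) ^ 2 + x 0 ^ 2 + y 0 ^ 2 - 2 * x 0 * y 0 * cos θ)
      = 1 / √(x 0 * y 0) * (cos θ / √(t ^ 2 + 4 * sin (θ / 2) ^ 2)) := by
    intro θ
    have e1 : (x 1 - y 1) ^ 2 + x 0 ^ 2 + y 0 ^ 2 - 2 * x 0 * y 0 * cos θ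
        = (x 0 * y 0) * (t ^ 2 + 4 * sin (θ / 2) ^ 2) := by
      have e2 : cos θ = 1 - 2 * sin (θ / 2) ^ 2 := by
        have := cos_two_mul (θ / 2)
        rw [mul_div_cancel₀ θ two_ne_zero] at this
        rw [this, cos_sq']; ring
      rw [htdef, div_pow, sq_sqrt hab.le, norm_sub_sq_plane, e2]
      field_simp
      ring
    rw [e1, sqrt_mul hab.le]
    ring
  unfold Gstar
  simp_rw [h2]
  rw [intervalIntegral.integral_const_mul, h1]
  rw [sqrt_mul hx.le]
  have e1 := sq_sqrt hx.le
  have e2 := sq_sqrt hy.le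
  have p1 := sqrt_pos.2 hx
  have p2 := sqrt_pos.2 hy
  have e3 : x 0 * y 0 ^ 2 / (4 * π) * (1 / (√(x 0) * √(y 0)) * (2 * (-log t + ringReg t)))
      = (x 0 / √(x 0)) * (y 0 * (y 0 / √(y 0))) / (2 * π) * (-log t + ringReg t) := by
    field_simp; ring
  rw [e3, div_sqrt, div_sqrt]

theorem continuous_ringReg : Continuous ringReg := by
  refine continuous_iff_continuousAt.2 fun t => ?_
  refine tendsto_iff_dist_tendsto_zero.2 ?_
  have h1 : Tendsto (fun s : ℝ => 4 * |s - t|) (nhds t) (nhds 0) := by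
    have : Continuous fun s : ℝ => 4 * |s - t| := by fun_prop
    simpa using this.tendsto t
  exact squeeze_zero (fun _ => dist_nonneg) (fun s => abs_ringReg_sub_le s t) h1

theorem Gfun_eq {x y : Plane} (hx : 0 < x 0) (hy : 0 < y 0) (hne : x ≠ y) :
    Gfun x y = 1 / (4 * π) * (log (‖x - y‖ ^ 2 + 4 * (x 0 * y 0)) - 2 * log ‖x - y‖) := by
  have hd : 0 < ‖x - y‖ := norm_pos_iff.2 (sub_ne_zero.2 hne)
  unfold Gfun
  have e1 : (x 0 + y 0) ^ 2 + (x 1 - y 1) ^ 2 = ‖x - y‖ ^ 2 + 4 * (x 0 * y 0) := by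
    rw [norm_sub_sq_plane]; ring
  rw [e1, ← norm_sub_sq_plane, log_div (by positivity) (by positivity), log_pow]
  norm_num

theorem tendsto_Hker {y : Plane} (hy : 0 < y 0) :
    Tendsto (fun x => Hker (y 0) x y) (nhdsWithin y {y}ᶜ)
      (nhds (y 0 ^ 2 / (2 * π) * (ringReg 0 - log 2))) := by
  set b := y 0 with hb
  have hsb : 0 < √b := sqrt_pos.2 hy
  have hsq := sq_sqrt hy.le
  have hpos : ∀ᶠ x : Plane in nhdsWithin y {y}ᶜ, 0 < x 0 := by
    have hc : Continuous fun x : Plane => x 0 := by fun_prop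
    exact mem_nhdsWithin_of_mem_nhds ((isOpen_lt continuous_const hc).mem_nhds hy)
  have heq : ∀ᶠ x : Plane in nhdsWithin y {y}ᶜ,
      √(x 0) * (b * √b) / (2 * π) * (log √(x 0 * b) + ringReg (‖x - y‖ / √(x 0 * b)))
        - b ^ 2 * (1 / (4 * π) * log (‖x - y‖ ^ 2 + 4 * (x 0 * b)))
        + b * √b / (2 * π) * ((√b - √(x 0)) * log ‖x - y‖) = Hker b x y := by
    filter_upwards [hpos, self_mem_nhdsWithin] with x hx hxy
    have hne : x ≠ y := hxy
    have hd : 0 < ‖x - y‖ := norm_pos_iff.2 (sub_ne_zero.2 hne)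
    have hs : 0 < √(x 0 * b) := sqrt_pos.2 (mul_pos hx hy)
    rw [Hker, Gstar_eq hx hy hne, Gfun_eq hx hy hne, ← hb, log_div hd.ne' hs.ne']
    have e : b ^ 2 = b * √b * √b := by rw [sq]; nth_rw 2 [← hsq]; ring
    rw [e]
    field_simp
    ring
  refine Tendsto.congr' heq ?_
  have hc1 : ContinuousAt (fun x : Plane =>
      √(x 0) * (b * √b) / (2 * π) * (log √(x 0 * b) + ringReg (‖x - y‖ / √(x 0 * b)))
        - b ^ 2 * (1 / (4 * π) * log (‖x - y‖ ^ 2 + 4 * (x 0 * b)))) y := by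
    have c0 : ContinuousAt (fun x : Plane => √(x 0 * b)) y := by fun_prop
    have hne : √(y 0 * b) ≠ 0 := (sqrt_pos.2 (mul_pos hy hy)).ne'
    have c1 : ContinuousAt (fun x : Plane => ringReg (‖x - y‖ / √(x 0 * b))) y := by
      refine continuous_ringReg.continuousAt.comp ?_
      exact ContinuousAt.div (by fun_prop) c0 hne
    have c2 : ContinuousAt (fun x : Plane => log √(x 0 * b)) y := c0.log hne
    have c3 : ContinuousAt (fun x : Plane => log (‖x - y‖ ^ 2 + 4 * (x 0 * b))) y := by
      refine ContinuousAt.log (by fun_prop) ?_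
      rw [sub_self, norm_zero]
      have : 0 < y 0 * b := mul_pos hy hy
      positivity
    have c4 : ContinuousAt (fun x : Plane => √(x 0) * (b * √b) / (2 * π)) y := by fun_prop
    exact (c4.mul (c2.add c1)).sub (continuousAt_const.mul (continuousAt_const.mul c3))
  have hc2 : Tendsto (fun x : Plane => (√b - √(x 0)) * log ‖x - y‖) (nhdsWithin y {y}ᶜ)
      (nhds 0) := by
    have h1 : Tendsto (fun x : Plane => (√b)⁻¹ * |‖x - y‖ * log ‖x - y‖|) (nhdsWithin y {y}ᶜ)
        (nhds 0) := by
      have : Continuous fun x : Plane => (√b)⁻¹ * |‖x - y‖ * log ‖x - y‖| :=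
        continuous_const.mul ((continuous_mul_log.comp (by fun_prop)).abs)
      have h2 := (this.tendsto y).mono_left (nhdsWithin_le_nhds (s := {y}ᶜ))
      simpa using h2
    refine squeeze_zero_norm' ?_ h1
    filter_upwards [hpos] with x hx
    rw [Real.norm_eq_abs, abs_mul, abs_mul, ← mul_assoc]
    refine mul_le_mul_of_nonneg_right ?_ (abs_nonneg _)
    rw [abs_of_nonneg (norm_nonneg _), inv_mul_eq_div, le_div_iff₀ hsb]
    have hsx : 0 ≤ √(x 0) := sqrt_nonneg _
    have e1 : (√b - √(x 0)) * (√b + √(x 0)) = b - x 0 := by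
      linear_combination hsq - sq_sqrt hx.le
    have e2 : |b - x 0| ≤ ‖x - y‖ := by
      rw [abs_sub_comm]; exact PiLp.norm_apply_le (x - y) 0
    calc |√b - √(x 0)| * √b ≤ |√b - √(x 0)| * (√b + √(x 0)) :=
          mul_le_mul_of_nonneg_left (by linarith) (abs_nonneg _)
      _ = |b - x 0| := by rw [← e1, abs_mul, abs_of_nonneg (show 0 ≤ √b + √(x 0) by linarith)]
      _ ≤ ‖x - y‖ := e2
  have h := (hc1.tendsto.mono_left (nhdsWithin_le_nhds (s := {y}ᶜ))).add
    (hc2.const_mul (b * √b / (2 * π)))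
  convert h using 2
  rw [← hb, sub_self, norm_zero, zero_div, mul_zero, add_zero, sqrt_mul_self hy.le]
  have e1 : log (0 ^ 2 + 4 * (b * b)) = 2 * log 2 + 2 * log b := by
    rw [show (0 : ℝ) ^ 2 + 4 * (b * b) = (2 * b) ^ 2 by ring, log_pow, log_mul two_ne_zero hy.ne']
    push_cast; ring
  have e2 : √b * (b * √b) = b ^ 2 := by linear_combination b * hsq
  rw [e1, e2]
  field_simp
  ring

theorem HkerExt_self {y : Plane} (hy : 0 < y 0) :
    HkerExt (y 0) y y = y 0 ^ 2 / (2 * π) * (ringReg 0 - log 2) := by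
  unfold HkerExt
  rw [if_pos rfl]
  exact (tendsto_Hker hy).limUnder_eq

/-- The ring kernel without its weight and its logarithmic singularity. -/
def ringCore (x y : Plane) : ℝ := log (x 0 * y 0) / 2 + ringReg (‖x - y‖ / √(x 0 * y 0))

theorem ringCore_comm (x y : Plane) : ringCore x y = ringCore y x := by
  unfold ringCore
  rw [mul_comm, norm_sub_rev]

theorem measurable_ringCore (x : Plane) : Measurable (ringCore x) := by
  unfold ringCore
  have h0 : Measurable fun y : Plane => x 0 * y 0 := by fun_prop
  exact ((measurable_log.comp h0).div_const 2).add
    (continuous_ringReg.measurable.comp (by fun_prop))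

theorem Gstar_eq_ringCore {x y : Plane} (hx : 0 < x 0) (hy : 0 < y 0) (hne : x ≠ y) :
    Gstar x y = √(x 0) * (y 0 * √(y 0)) / (2 * π) * (-log ‖x - y‖ + ringCore x y) := by
  have h1 : 0 < ‖x - y‖ := norm_pos_iff.2 (sub_ne_zero.2 hne)
  rw [Gstar_eq hx hy hne, ringCore, log_div h1.ne' (sqrt_pos.2 (mul_pos hx hy)).ne',
    log_sqrt (mul_pos hx hy).le]
  ring

theorem exists_lipschitz_of_contDiffOn {f : ℝ → ℝ} {a b : ℝ} (hf : ContDiffOn ℝ 1 f (Set.Icc a b)) :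
    ∃ C : ℝ, 0 ≤ C ∧ ∀ s ∈ Set.Icc a b, ∀ t ∈ Set.Icc a b, |f s - f t| ≤ C * |s - t| := by
  obtain ⟨K, hK⟩ := hf.exists_lipschitzOnWith one_ne_zero (convex_Icc a b) isCompact_Icc
  refine ⟨K, K.2, fun s hs t ht => ?_⟩
  simpa [Real.dist_eq] using hK.dist_le_mul s hs t ht

theorem exists_lipschitz_mul_sqrt {a : ℝ} (ha : 0 < a) (b : ℝ) :
    ∃ C : ℝ, 0 ≤ C ∧ ∀ s ∈ Set.Icc a b, ∀ t ∈ Set.Icc a b, |s * √s - t * √t| ≤ C * |s - t| :=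
  exists_lipschitz_of_contDiffOn <| contDiffOn_id.mul <|
    contDiffOn_id.sqrt fun _ hx => (ha.trans_le hx.1).ne'

theorem exists_lipschitz_inv_sqrt {a : ℝ} (ha : 0 < a) (b : ℝ) :
    ∃ C : ℝ, 0 ≤ C ∧ ∀ s ∈ Set.Icc a b, ∀ t ∈ Set.Icc a b, |(√s)⁻¹ - (√t)⁻¹| ≤ C * |s - t| :=
  exists_lipschitz_of_contDiffOn <|
    (contDiffOn_id.sqrt fun _ hx => (ha.trans_le hx.1).ne').inv
      fun _ hx => (sqrt_pos.2 (ha.trans_le hx.1)).ne'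

theorem exists_lipschitz_log {a : ℝ} (ha : 0 < a) (b : ℝ) :
    ∃ C : ℝ, 0 ≤ C ∧ ∀ s ∈ Set.Icc a b, ∀ t ∈ Set.Icc a b, |log s - log t| ≤ C * |s - t| :=
  exists_lipschitz_of_contDiffOn <| contDiffOn_id.log fun _ hx => (ha.trans_le hx.1).ne'

theorem exists_lipschitz_ringCore {a : ℝ} (ha : 0 < a) (b : ℝ) :
    ∃ C : ℝ, 0 ≤ C ∧ ∀ x y z : Plane, x 0 ∈ Set.Icc a b → y 0 ∈ Set.Icc a b → z 0 ∈ Set.Icc a b →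
      ‖y - z‖ ≤ 1 → |ringCore x z - ringCore y z| ≤ C * ‖x - y‖ := by
  obtain ⟨C₁, h₁, H₁⟩ := exists_lipschitz_inv_sqrt ha b
  obtain ⟨C₂, h₂, H₂⟩ := exists_lipschitz_log ha b
  set k := (√a)⁻¹ with hk
  have hk0 : 0 ≤ k := by positivity
  refine ⟨C₂ / 2 + 4 * (k * k + C₁ * k), by positivity, fun x y z hx hy hz hyz => ?_⟩
  have hx0 := ha.trans_le hx.1
  have hy0 := ha.trans_le hy.1
  have hz0 := ha.trans_le hz.1
  have hxy : |x 0 - y 0| ≤ ‖x - y‖ := PiLp.norm_apply_le (x - y) 0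
  have e1 := (H₂ _ hx _ hy).trans (mul_le_mul_of_nonneg_left hxy h₂)
  have e2 := (H₁ _ hx _ hy).trans (mul_le_mul_of_nonneg_left hxy h₁)
  have kx : (√(x 0))⁻¹ ≤ k := inv_anti₀ (sqrt_pos.2 ha) (sqrt_le_sqrt hx.1)
  have kz : (√(z 0))⁻¹ ≤ k := inv_anti₀ (sqrt_pos.2 ha) (sqrt_le_sqrt hz.1)
  have px : 0 ≤ (√(x 0))⁻¹ := by positivity
  have pz : 0 ≤ (√(z 0))⁻¹ := by positivity
  have e3 : |‖x - z‖ - ‖y - z‖| ≤ ‖x - y‖ := by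
    have := abs_norm_sub_norm_le (x - z) (y - z); rwa [sub_sub_sub_cancel_right] at this
  have e4 : ‖x - z‖ / √(x 0 * z 0) - ‖y - z‖ / √(y 0 * z 0)
      = (‖x - z‖ - ‖y - z‖) * ((√(x 0))⁻¹ * (√(z 0))⁻¹)
        + ((√(x 0))⁻¹ - (√(y 0))⁻¹) * (‖y - z‖ * (√(z 0))⁻¹) := by
    rw [sqrt_mul hx0.le, sqrt_mul hy0.le, div_eq_mul_inv, div_eq_mul_inv, mul_inv, mul_inv]; ring
  have e5 : |‖x - z‖ / √(x 0 * z 0) - ‖y - z‖ / √(y 0 * z 0)| ≤ (k * k + C₁ * k) * ‖x - y‖ := by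
    rw [e4]
    refine (abs_add_le _ _).trans ?_
    rw [abs_mul (_ - _) ((√(x 0))⁻¹ * _), abs_mul (_ - _) (‖y - z‖ * _),
      abs_of_nonneg (mul_nonneg px pz),
      abs_of_nonneg (mul_nonneg (norm_nonneg (y - z)) pz)]
    have a1 : |‖x - z‖ - ‖y - z‖| * ((√(x 0))⁻¹ * (√(z 0))⁻¹) ≤ ‖x - y‖ * (k * k) := by gcongr
    have a2 : |(√(x 0))⁻¹ - (√(y 0))⁻¹| * (‖y - z‖ * (√(z 0))⁻¹) ≤ (C₁ * ‖x - y‖) * (1 * k) := by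
      gcongr
    linarith
  have e6 := (abs_ringReg_sub_le (‖x - z‖ / √(x 0 * z 0)) (‖y - z‖ / √(y 0 * z 0))).trans
    (mul_le_mul_of_nonneg_left e5 (by norm_num))
  have e7 : ringCore x z - ringCore y z = (log (x 0) - log (y 0)) / 2
      + (ringReg (‖x - z‖ / √(x 0 * z 0)) - ringReg (‖y - z‖ / √(y 0 * z 0))) := by
    unfold ringCore
    rw [log_mul hx0.ne' hz0.ne', log_mul hy0.ne' hz0.ne']; ring
  rw [e7]
  refine (abs_add_le _ _).trans ?_
  rw [abs_div, abs_two]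
  linarith

theorem ringCore_self {x : Plane} (hx : 0 < x 0) : ringCore x x = log (x 0) + ringReg 0 := by
  unfold ringCore
  rw [log_mul hx.ne' hx.ne', sub_self, norm_zero, zero_div]; ring

theorem exists_abs_ringCore_le {a : ℝ} (ha : 0 < a) (b : ℝ) :
    ∃ C : ℝ, 0 ≤ C ∧ ∀ x y : Plane, x 0 ∈ Set.Icc a b → y 0 ∈ Set.Icc a b → ‖x - y‖ ≤ 1 →
      |ringCore x y| ≤ C := by
  obtain ⟨C, h, H⟩ := exists_lipschitz_ringCore ha b
  obtain ⟨C₂, h₂, H₂⟩ := exists_lipschitz_log ha b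
  refine ⟨C + |log a| + C₂ * |b - a| + |ringReg 0|, by positivity, fun x y hx hy hxy => ?_⟩
  have h1 := (H x y y hx hy hy (by simp)).trans (mul_le_of_le_one_right h hxy)
  have hab : a ≤ b := hy.1.trans hy.2
  have h2 := H₂ _ hy a ⟨le_rfl, hab⟩
  have h3 : |y 0 - a| ≤ |b - a| := by
    rw [abs_of_nonneg (sub_nonneg.2 hy.1), abs_of_nonneg (sub_nonneg.2 hab)]; linarith [hy.2]
  have h4 := mul_le_mul_of_nonneg_left h3 h₂
  rw [ringCore_self (ha.trans_le hy.1)] at h1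
  have e : ringCore x y = (ringCore x y - (log (y 0) + ringReg 0)) + ((log (y 0) - log a) + log a)
      + ringReg 0 := by ring
  rw [e]
  refine (abs_add_le _ _).trans ?_
  have h5 := (abs_add_le (ringCore x y - (log (y 0) + ringReg 0)) ((log (y 0) - log a) + log a))
  have h6 := abs_add_le (log (y 0) - log a) (log a)
  linarith

/-- The cross-section of a vortex ring in coordinates rescaled by `ε`. -/
structure IsScaledRing (B : Set Plane) (ε W μ κ δ : ℝ) : Prop where
  eps_pos : 0 < ε
  isOpen : IsOpen B
  bounded : Bornology.IsBounded B
  conn : IsPreconnected B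
  coord : ∀ z ∈ B, ε * z 0 ∈ Set.Icc δ (1 / δ)
  diam_le : ε * Metric.diam B ≤ 1
  circ : ∫ y in B, ε * y 0 = κ
  mem_iff : ∀ z : Plane, 0 < z 0 → (z ∈ B ↔ μ + W / 2 * (ε * z 0) ^ 2 * log (1 / ε) <
    √(ε * z 0) / (2 * π) * ∫ y in B, ε * y 0 * √(ε * y 0) *
      (-log ‖z - y‖ + (log (1 / ε) + ringCore (ε • z) (ε • y))))

section
open scoped Pointwise

variable {ψ : Plane → ℝ} {ε W μ : ℝ}

theorem isOpen_halfPlane : IsOpen halfPlane :=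
  isOpen_lt continuous_const (by fun_prop)

theorem IsVortexRingStream.isOpen_crossSection (H : IsVortexRingStream ψ ε W μ) :
    IsOpen (crossSection ψ ε W μ) := by
  have h1 : ContinuousOn (fun x : Plane => ψ x - W / 2 * x 0 ^ 2 * log (1 / ε)) halfPlane :=
    H.continuousOn.sub (by fun_prop)
  exact h1.isOpen_inter_preimage isOpen_halfPlane isOpen_Ioi

theorem mem_inv_smul_iff {A : Set Plane} (hε : 0 < ε) (z : Plane) : z ∈ ε⁻¹ • A ↔ ε • z ∈ A :=
  Set.mem_inv_smul_set_iff₀ hε.ne' A z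

theorem setIntegral_inv_smul {A : Set Plane} (hε : 0 < ε) (f : Plane → ℝ) :
    (∫ x in A, f x) = ε ^ 2 * ∫ y in ε⁻¹ • A, f (ε • y) := by
  rw [Measure.setIntegral_comp_smul_of_pos volume f _ hε, smul_inv_smul₀ hε.ne', finrank_euclideanSpace,
    Fintype.card_fin, smul_eq_mul, mul_inv_cancel_left₀ (by positivity)]

theorem volume_real_inv_smul (A : Set Plane) :
    volume.real (ε⁻¹ • A) = volume.real A / ε ^ 2 := by
  rw [measureReal_def, Measure.addHaar_smul, ENNReal.toReal_mul, finrank_euclideanSpace,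
    Fintype.card_fin, ENNReal.toReal_ofReal (abs_nonneg _), abs_of_nonneg (by positivity),
    measureReal_def]
  ring

theorem diam_inv_smul (hε : 0 < ε) (A : Set Plane) :
    Metric.diam (ε⁻¹ • A) = Metric.diam A / ε := by
  rw [diam_smul₀, Real.norm_of_nonneg (inv_nonneg.2 hε.le)]
  ring

theorem IsVortexRingStream.isScaledRing (H : IsVortexRingStream ψ ε W μ) (hε : 0 < ε) {κ δ : ℝ}
    (hκ : circulation ψ ε W μ = κ) (hconn : IsPreconnected (crossSection ψ ε W μ))
    (hsub : crossSection ψ ε W μ ⊆ {x : Plane | δ ≤ x 0 ∧ x 0 ≤ 1 / δ})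
    (hdiam : Metric.diam (crossSection ψ ε W μ) ≤ 1) :
    IsScaledRing (ε⁻¹ • crossSection ψ ε W μ) ε W μ κ δ := by
  have ho := H.isOpen_crossSection
  set A := crossSection ψ ε W μ with hA
  have hAsub : A ⊆ halfPlane := fun x hx => hx.1
  have hε2 : ε ^ 2 ≠ 0 := by positivity
  refine ⟨hε, ho.smul₀ (inv_ne_zero hε.ne'), H.bounded.smul₀ _, ?_, ?_, ?_, ?_, ?_⟩
  · exact hconn.image _ (continuous_const_smul ε⁻¹).continuousOn
  · intro z hz
    exact hsub ((mem_inv_smul_iff hε z).1 hz)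
  · rw [diam_inv_smul hε, mul_div_cancel₀ _ hε.ne']; exact hdiam
  · rw [← hκ, circulation, setIntegral_inv_smul (A := A) hε (fun x => x 0),
      mul_div_cancel_left₀ _ hε2]
    rfl
  · intro z hz
    have hz' : 0 < (ε • z) 0 := mul_pos hε hz
    rw [mem_inv_smul_iff hε]
    have e1 : ψ (ε • z) = √(ε * z 0) / (2 * π) * ∫ y in ε⁻¹ • A, ε * y 0 * √(ε * y 0) *
        (-log ‖z - y‖ + (log (1 / ε) + ringCore (ε • z) (ε • y))) := by
      rw [H.repr _ hz', ← hA, setIntegral_inv_smul hε, mul_div_cancel_left₀ _ hε2,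
        ← integral_const_mul]
      refine setIntegral_congr_ae (ho.smul₀ (inv_ne_zero hε.ne')).measurableSet ?_
      have hne : ∀ᵐ y : Plane, y ≠ z := by simp [ae_iff]
      filter_upwards [hne] with y hy hyB
      have hy' : 0 < (ε • y) 0 := hAsub ((mem_inv_smul_iff hε y).1 hyB)
      have hne' : ε • z ≠ ε • y := fun h => hy ((smul_right_injective Plane hε.ne') h).symm
      rw [Gstar_eq_ringCore hz' hy' hne', ← smul_sub, norm_smul, Real.norm_of_nonneg hε.le,
        log_mul hε.ne' (norm_ne_zero_iff.2 (sub_ne_zero.2 hy.symm)), one_div, log_inv]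
      simp only [PiLp.smul_apply, smul_eq_mul]
      ring
    rw [← e1]
    constructor
    · intro h
      have := h.2
      simp only [PiLp.smul_apply, smul_eq_mul] at this
      linarith
    · intro h
      refine ⟨hz', ?_⟩
      simp only [PiLp.smul_apply, smul_eq_mul]
      linarith

end

namespace IsScaledRing

variable {B : Set Plane} {ε W μ κ δ : ℝ}

theorem measurableSet (H : IsScaledRing B ε W μ κ δ) : MeasurableSet B := H.isOpen.measurableSet

theorem volume_ne_top (H : IsScaledRing B ε W μ κ δ) : volume B ≠ ⊤ := H.bounded.measure_lt_top.ne

theorem norm_sub_le (H : IsScaledRing B ε W μ κ δ) {x y : Plane} (hx : x ∈ B) (hy : y ∈ B) :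
    ‖x - y‖ ≤ Metric.diam B := by
  rw [← dist_eq_norm]; exact Metric.dist_le_diam_of_mem H.bounded hx hy

theorem norm_smul_sub_le (H : IsScaledRing B ε W μ κ δ) {x y : Plane} (hx : x ∈ B) (hy : y ∈ B) :
    ‖ε • x - ε • y‖ ≤ 1 := by
  rw [← smul_sub, norm_smul, Real.norm_of_nonneg H.eps_pos.le]
  exact (mul_le_mul_of_nonneg_left (H.norm_sub_le hx hy) H.eps_pos.le).trans H.diam_le

theorem coord_pos (H : IsScaledRing B ε W μ κ δ) (hδ : 0 < δ) {x : Plane} (hx : x ∈ B) :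
    0 < x 0 :=
  pos_of_mul_pos_right (hδ.trans_le (H.coord x hx).1) H.eps_pos.le

theorem integrableOn_of_le (H : IsScaledRing B ε W μ κ δ) {f : Plane → ℝ} (hf : Measurable f)
    {C : ℝ} (hC : ∀ y ∈ B, |f y| ≤ C) : IntegrableOn f B :=
  Integrable.mono' (g := fun _ => C) (integrableOn_const H.volume_ne_top) hf.aestronglyMeasurable
    ((ae_restrict_iff' H.measurableSet).2 (ae_of_all _ hC))

theorem abs_coord_le (H : IsScaledRing B ε W μ κ δ) (hδ : 0 < δ) {x : Plane} (hx : x ∈ B) :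
    |ε * x 0| ≤ 1 / δ := by
  rw [abs_of_pos (hδ.trans_le (H.coord x hx).1)]; exact (H.coord x hx).2

theorem volume_mem_Icc (H : IsScaledRing B ε W μ κ δ) (hδ : 0 < δ) :
    volume.real B ∈ Set.Icc (κ * δ) (κ / δ) := by
  have i1 : IntegrableOn (fun y : Plane => ε * y 0) B :=
    H.integrableOn_of_le (by fun_prop) fun y hy => H.abs_coord_le hδ hy
  have ic : ∀ c : ℝ, IntegrableOn (fun _ : Plane => c) B :=
    fun c => integrableOn_const H.volume_ne_top
  have h1 := setIntegral_mono_on (ic δ) i1 H.measurableSet fun y hy => (H.coord y hy).1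
  have h2 := setIntegral_mono_on i1 (ic (1 / δ)) H.measurableSet fun y hy => (H.coord y hy).2
  rw [setIntegral_const, smul_eq_mul, H.circ] at h1 h2
  constructor
  · have : κ ≤ volume.real B / δ := by rw [div_eq_mul_one_div]; exact h2
    exact (le_div_iff₀ hδ).1 this
  · rw [le_div_iff₀ hδ]; exact h1

theorem le_logPot (H : IsScaledRing B ε W μ κ δ) (hδ : 0 < δ) (hW : 0 < W) (hε : ε ≤ 1) {K : ℝ}
    (hK : ∀ x y : Plane, x 0 ∈ Set.Icc δ (1 / δ) → y 0 ∈ Set.Icc δ (1 / δ) → ‖x - y‖ ≤ 1 →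
      |ringCore x y| ≤ K) {z : Plane} (hz : z ∈ B) :
    μ + W / 2 * δ ^ 2 * log (1 / ε) ≤ (1 / δ) ^ 2 / (2 * π) *
      (logPot (fun _ => 1) B z + volume.real B * (log (1 / ε) + K)) := by
  have hε0 := H.eps_pos
  have hl : 0 ≤ log (1 / ε) := log_nonneg (by rw [le_div_iff₀ hε0]; linarith)
  have hX := H.coord z hz
  have hX0 : 0 < ε * z 0 := hδ.trans_le hX.1
  have hπ := pi_pos
  have h1 := ((H.mem_iff z (H.coord_pos hδ hz)).1 hz).le
  have hm : ∀ (f : Plane → ℝ), Measurable f → Measurable fun y : Plane => f (ε • y) :=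
    fun f hf => hf.comp (measurable_const_smul ε)
  have iL : IntegrableOn (fun y : Plane => -log ‖z - y‖) B :=
    (integrableOn_log_norm H.measurableSet H.bounded z).neg
  have iR : IntegrableOn (fun y : Plane => log (1 / ε) + ringCore (ε • z) (ε • y)) B := by
    refine H.integrableOn_of_le (C := |log (1 / ε)| + K)
      ((hm _ (measurable_ringCore (ε • z))).const_add _) fun y hy => ?_
    refine (abs_add_le _ _).trans (add_le_add le_rfl (hK _ _ ?_ ?_ (H.norm_smul_sub_le hz hy)))
    exacts [hX, H.coord y hy]
  have ic : IntegrableOn (fun _ : Plane => log (1 / ε) + K) B := integrableOn_const H.volume_ne_top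
  have iLR : IntegrableOn (fun y : Plane =>
      -log ‖z - y‖ + (log (1 / ε) + ringCore (ε • z) (ε • y))) B := iL.add iR
  have iLc : IntegrableOn (fun y : Plane => -log ‖z - y‖ + (log (1 / ε) + K)) B := iL.add ic
  have hw : ∀ y ∈ B, |ε * y 0 * √(ε * y 0)| ≤ 1 / δ * √(1 / δ) := fun y hy => by
    have h := H.coord y hy
    have h0 := hδ.trans_le h.1
    rw [abs_of_nonneg (by positivity)]
    exact mul_le_mul h.2 (sqrt_le_sqrt h.2) (sqrt_nonneg _) (by positivity)
  have h2 : √(ε * z 0) / (2 * π) * ∫ y in B, ε * y 0 * √(ε * y 0) *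
      (-log ‖z - y‖ + (log (1 / ε) + ringCore (ε • z) (ε • y))) ≤
      √(1 / δ) / (2 * π) * ∫ y in B, 1 / δ * √(1 / δ) * (-log ‖z - y‖ + (log (1 / ε) + K)) := by
    have hnn : ∀ y ∈ B, 0 ≤ -log ‖z - y‖ + (log (1 / ε) + K) ∧
        -log ‖z - y‖ + (log (1 / ε) + ringCore (ε • z) (ε • y)) ≤
          -log ‖z - y‖ + (log (1 / ε) + K) := fun y hy => by
      have hk := hK (ε • z) (ε • y) hX (H.coord y hy) (H.norm_smul_sub_le hz hy)
      have hk0 := (abs_nonneg _).trans hk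
      refine ⟨?_, by linarith [le_of_abs_le hk]⟩
      rcases eq_or_ne z y with rfl | hne
      · rw [sub_self, norm_zero, log_zero]; linarith
      · have h3 := H.norm_smul_sub_le hz hy
        rw [← smul_sub, norm_smul, Real.norm_of_nonneg hε0.le] at h3
        have h4 : 0 < ‖z - y‖ := norm_pos_iff.2 (sub_ne_zero.2 hne)
        have h5 := log_nonpos (by positivity) h3
        rw [log_mul hε0.ne' h4.ne'] at h5
        rw [one_div, log_inv] at *
        linarith
    have h6 : ∫ y in B, ε * y 0 * √(ε * y 0) *
        (-log ‖z - y‖ + (log (1 / ε) + ringCore (ε • z) (ε • y))) ≤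
        ∫ y in B, 1 / δ * √(1 / δ) * (-log ‖z - y‖ + (log (1 / ε) + K)) := by
      refine setIntegral_mono_on (integrableOn_bdd_mul H.measurableSet (by fun_prop) hw iLR)
        (iLc.const_mul _) H.measurableSet fun y hy => ?_
      have h := H.coord y hy
      have h0 := hδ.trans_le h.1
      exact (mul_le_mul_of_nonneg_left (hnn y hy).2 (by positivity)).trans
        (mul_le_mul_of_nonneg_right (le_of_abs_le (hw y hy)) (hnn y hy).1)
    have h7 : 0 ≤ ∫ y in B, 1 / δ * √(1 / δ) * (-log ‖z - y‖ + (log (1 / ε) + K)) :=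
      setIntegral_nonneg H.measurableSet fun y hy => mul_nonneg (by positivity) (hnn y hy).1
    have h8 : √(ε * z 0) ≤ √(1 / δ) := sqrt_le_sqrt hX.2
    refine (mul_le_mul_of_nonneg_left h6 (by positivity)).trans
      (mul_le_mul_of_nonneg_right ?_ h7)
    gcongr
  have h3 : √(1 / δ) / (2 * π) * ∫ y in B, 1 / δ * √(1 / δ) * (-log ‖z - y‖ + (log (1 / ε) + K))
      = (1 / δ) ^ 2 / (2 * π) *
      (logPot (fun _ => 1) B z + volume.real B * (log (1 / ε) + K)) := by
    rw [integral_const_mul, integral_add iL ic, setIntegral_const, smul_eq_mul]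
    simp only [logPot, one_mul]
    have := mul_self_sqrt (show 0 ≤ 1 / δ by positivity)
    linear_combination (1 / δ) / (2 * π) * ((∫ y in B, -log ‖z - y‖)
      + volume.real B * (log (1 / ε) + K)) * this
  have h4 : W / 2 * δ ^ 2 * log (1 / ε) ≤ W / 2 * (ε * z 0) ^ 2 * log (1 / ε) := by
    have := hX.1
    gcongr
  linarith

theorem diam_pos (H : IsScaledRing B ε W μ κ δ) (hδ : 0 < δ) (hκ : 0 < κ) :
    0 < Metric.diam B := by
  refine Metric.diam_nonneg.lt_of_ne fun h => ?_
  have hs : B.Subsingleton := by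
    intro x hx y hy
    have := H.norm_sub_le hx hy
    rw [← h] at this
    exact sub_eq_zero.1 (norm_le_zero_iff.1 this)
  have h0 : volume B = 0 := hs.measure_zero volume
  have := (H.volume_mem_Icc hδ).1
  rw [measureReal_def, h0, ENNReal.toReal_zero] at this
  have := mul_pos hκ hδ
  linarith

end IsScaledRing

theorem exists_diam_le_and_flux_le {κ W δ : ℝ} (hκ : 0 < κ) (hW : 0 < W) (hδ : 0 < δ) :
    ∃ C > (0 : ℝ), ∃ θ > (0 : ℝ), ∀ B ε μ, IsScaledRing B ε W μ κ δ → ε ≤ 1 → 0 ≤ μ → B.Nonempty →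
      ε * Metric.diam B ≤ C * rexp (-θ * log (1 / ε)) ∧ μ ≤ C * (1 + log (1 / ε)) := by
  obtain ⟨K, hK0, hK⟩ := exists_abs_ringCore_le hδ (1 / δ)
  have hπ := pi_pos
  set a := (1 / δ) ^ 2 / (2 * π) with ha
  have ha0 : 0 < a := by positivity
  set M := κ / δ with hM
  have hM0 : 0 < M := by positivity
  refine ⟨2 * rexp (2 + K) + a * (2 * π + M + M * (1 + K)), by positivity,
    W / 2 * δ ^ 2 / (a * M), by positivity, ?_⟩
  rintro B ε μ H hε hμ ⟨z, hz⟩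
  have hε0 := H.eps_pos
  have hl : 0 ≤ log (1 / ε) := log_nonneg (by rw [le_div_iff₀ hε0]; linarith)
  have hm := H.volume_mem_Icc hδ
  have hm0 : 0 ≤ volume.real B := measureReal_nonneg
  have hL := H.diam_pos hδ hκ
  have hb := fun x hx => H.le_logPot hδ hW hε hK (z := x) hx
  constructor
  · have h1 := le_mul_log_diam_of_le_logPot (ρ := fun _ => 1) (P := 1)
      (b := (W / 2 * δ ^ 2 * log (1 / ε)) / a - volume.real B * (log (1 / ε) + K))
      H.measurableSet H.bounded H.conn measurable_const (by simp) (by simp) (fun x hx => by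
        have h2 := hb x hx
        have h3 : (W / 2 * δ ^ 2 * log (1 / ε)) / a ≤
            logPot (fun _ => 1) B x + volume.real B * (log (1 / ε) + K) := by
          rw [div_le_iff₀' ha0]; linarith
        linarith) hL
    rw [setIntegral_const, smul_eq_mul, mul_one] at h1
    have h2 : log (ε * Metric.diam B / 2) = -log (1 / ε) + log (Metric.diam B / 2) := by
      rw [mul_div_assoc, log_mul hε0.ne' (by positivity), one_div, log_inv]; ring
    have h3 : log (ε * Metric.diam B / 2) ≤ 0 :=
      log_nonpos (by positivity) (by linarith [H.diam_le])
    have h4 : (W / 2 * δ ^ 2 * log (1 / ε)) / a ≤ M * (2 + K - log (ε * Metric.diam B / 2)) := by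
      have h5 : (W / 2 * δ ^ 2 * log (1 / ε)) / a
          ≤ volume.real B * (2 + K - log (ε * Metric.diam B / 2)) := by
        rw [h2]; linarith
      exact h5.trans (mul_le_mul_of_nonneg_right hm.2 (by linarith))
    have h5 : log (ε * Metric.diam B / 2)
        ≤ (2 + K) + -(W / 2 * δ ^ 2 / (a * M)) * log (1 / ε) := by
      have h6 : W / 2 * δ ^ 2 / (a * M) * log (1 / ε) * M = (W / 2 * δ ^ 2 * log (1 / ε)) / a := by
        field_simp
      have h7 : W / 2 * δ ^ 2 / (a * M) * log (1 / ε)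
          ≤ 2 + K - log (ε * Metric.diam B / 2) := by
        refine le_of_mul_le_mul_right ?_ hM0
        rw [h6]; linarith
      linarith
    have h6 := (log_le_iff_le_exp (by positivity)).1 h5
    rw [exp_add] at h6
    have h7 : 0 ≤ a * (2 * π + M + M * (1 + K)) * rexp (-(W / 2 * δ ^ 2 / (a * M)) * log (1 / ε)) := by
      positivity
    linarith
  · have h1 := hb z hz
    have h2 : logPot (fun _ => 1) B z ≤ 2 * π + volume.real B := by
      refine le_trans ?_ (setIntegral_inv_norm_le' H.measurableSet H.bounded z)
      unfold logPot
      refine setIntegral_mono_on (integrableOn_logPot (P := 1) H.measurableSet H.bounded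
        measurable_const (by simp) z) (integrableOn_inv_norm H.measurableSet H.volume_ne_top z)
        H.measurableSet fun y _ => ?_
      rw [one_mul, ← log_inv]
      exact (log_le_self (by positivity))
    have h3 : μ ≤ a * (2 * π + M + M * (log (1 / ε) + K)) := by
      have h4 : μ ≤ a * (logPot (fun _ => 1) B z + volume.real B * (log (1 / ε) + K)) := by
        have : 0 ≤ W / 2 * δ ^ 2 * log (1 / ε) := by positivity
        linarith
      refine h4.trans (mul_le_mul_of_nonneg_left ?_ ha0.le)
      have := mul_le_mul_of_nonneg_right hm.2 (show 0 ≤ log (1 / ε) + K by linarith)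
      linarith [hm.2]
    have e1 : 0 ≤ rexp (2 + K) * (1 + log (1 / ε)) := by positivity
    have e2 : 0 ≤ a * (2 * π + M + M * K) * log (1 / ε) := by positivity
    have e3 : 0 ≤ a * M := by positivity
    nlinarith

/-- The normalised density of the scaled ring problem. -/
def ringDens (ε : ℝ) (q y : Plane) : ℝ := ε * y 0 * √(ε * y 0) / (ε * q 0 * √(ε * q 0))

/-- The smooth part of the normalised potential of the scaled ring problem. -/
def ringPert (B : Set Plane) (ε W μ : ℝ) (q z : Plane) : ℝ :=
  (∫ y in B, ringDens ε q y * (log (1 / ε) + ringCore (ε • z) (ε • y))) -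
    2 * π / (ε * q 0 * √(ε * q 0)) *
      (W / 2 * log (1 / ε) * (ε * z 0 * √(ε * z 0)) + μ * (√(ε * z 0))⁻¹)

theorem measurable_ringDens (ε : ℝ) (q : Plane) : Measurable (ringDens ε q) := by
  unfold ringDens; fun_prop

theorem measurable_ringCore_smul (ε : ℝ) (x : Plane) :
    Measurable fun y : Plane => ringCore x (ε • y) :=
  (measurable_ringCore x).comp (measurable_const_smul ε)

namespace IsScaledRing

variable {B : Set Plane} {ε W μ κ δ R : ℝ} {q z : Plane}

theorem ringDens_pos (H : IsScaledRing B ε W μ κ δ) (hδ : 0 < δ) (hq : q ∈ B) {y : Plane}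
    (hy : y ∈ B) : 0 < ringDens ε q y := by
  have h1 := hδ.trans_le (H.coord q hq).1
  have h2 := hδ.trans_le (H.coord y hy).1
  unfold ringDens; positivity

theorem mul_sqrt_le (H : IsScaledRing B ε W μ κ δ) (hδ : 0 < δ) (hq : q ∈ B) :
    δ * √δ ≤ ε * q 0 * √(ε * q 0) := by
  have h := (H.coord q hq).1
  have h0 := hδ.trans_le h
  gcongr

theorem abs_ringDens_le (H : IsScaledRing B ε W μ κ δ) (hδ : 0 < δ) (hq : q ∈ B) {y : Plane}
    (hy : y ∈ B) : |ringDens ε q y| ≤ 1 / δ * √(1 / δ) / (δ * √δ) := by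
  rw [abs_of_pos (H.ringDens_pos hδ hq hy)]
  have h := (H.coord y hy)
  have h0 := hδ.trans_le h.1
  have h1 : ε * y 0 * √(ε * y 0) ≤ 1 / δ * √(1 / δ) :=
    mul_le_mul h.2 (sqrt_le_sqrt h.2) (sqrt_nonneg _) (by positivity)
  exact div_le_div₀ (by positivity) h1 (by positivity) (H.mul_sqrt_le hδ hq)

/-- The points near the scaled cross-section stay in a fixed box after undoing the scaling. -/
theorem near (H : IsScaledRing B ε W μ κ δ) (hq : q ∈ B) (h1 : ε * (Metric.diam B + R) ≤ 1 / 2)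
    (h2 : ε * (Metric.diam B + R) ≤ δ / 2) (hR : 0 ≤ R)
    (hz : z ∈ Metric.closedBall q (Metric.diam B + R)) :
    ε * z 0 ∈ Set.Icc (δ / 2) (1 / δ + δ / 2) ∧ ∀ y ∈ B, ‖ε • z - ε • y‖ ≤ 1 := by
  rw [mem_closedBall_iff_norm] at hz
  have hε0 := H.eps_pos
  have hzq : ε * ‖z - q‖ ≤ ε * (Metric.diam B + R) := mul_le_mul_of_nonneg_left hz hε0.le
  constructor
  · have h3 : |z 0 - q 0| ≤ ‖z - q‖ := PiLp.norm_apply_le (z - q) 0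
    have h4 : |ε * z 0 - ε * q 0| ≤ δ / 2 := by
      rw [← mul_sub, abs_mul, abs_of_pos hε0]
      exact (mul_le_mul_of_nonneg_left h3 hε0.le).trans (hzq.trans h2)
    have h5 := H.coord q hq
    rw [abs_le] at h4
    constructor <;> linarith [h5.1, h5.2]
  · intro y hy
    rw [← smul_sub, norm_smul, Real.norm_of_nonneg hε0.le]
    have h3 := norm_add_le (z - q) (q - y)
    rw [sub_add_sub_cancel] at h3
    have h4 := mul_le_mul_of_nonneg_left (h3.trans (add_le_add_right (H.norm_sub_le hq hy) _)) hε0.le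
    have h5 : 0 ≤ ε * R := by positivity
    rw [mul_add] at *
    linarith

theorem coord_mem_wide (H : IsScaledRing B ε W μ κ δ) (hδ : 0 < δ) {y : Plane} (hy : y ∈ B) :
    ε * y 0 ∈ Set.Icc (δ / 2) (1 / δ + δ / 2) := by
  have := H.coord y hy
  constructor <;> linarith [this.1, this.2]

theorem integrableOn_ringDens_mul_ringCore (H : IsScaledRing B ε W μ κ δ) (hδ : 0 < δ) (hq : q ∈ B)
    (hz : ε * z 0 ∈ Set.Icc (δ / 2) (1 / δ + δ / 2) ∧ ∀ y ∈ B, ‖ε • z - ε • y‖ ≤ 1) :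
    IntegrableOn (fun y => ringDens ε q y * (log (1 / ε) + ringCore (ε • z) (ε • y))) B := by
  obtain ⟨K, hK0, hK⟩ := exists_abs_ringCore_le (half_pos hδ) (1 / δ + δ / 2)
  refine integrableOn_bdd_mul H.measurableSet (measurable_ringDens ε q)
    (fun y hy => H.abs_ringDens_le hδ hq hy) ?_
  refine H.integrableOn_of_le (C := |log (1 / ε)| + K)
    ((measurable_ringCore_smul ε _).const_add _) fun y hy => ?_
  exact (abs_add_le _ _).trans (add_le_add le_rfl
    (hK _ _ hz.1 (H.coord_mem_wide hδ hy) (hz.2 y hy)))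

theorem mem_iff_logPot (H : IsScaledRing B ε W μ κ δ) (hδ : 0 < δ) (hq : q ∈ B)
    (hz : ε * z 0 ∈ Set.Icc (δ / 2) (1 / δ + δ / 2) ∧ ∀ y ∈ B, ‖ε • z - ε • y‖ ≤ 1) :
    z ∈ B ↔ 0 < logPot (ringDens ε q) B z + ringPert B ε W μ q z := by
  have hε0 := H.eps_pos
  have hX0 : 0 < ε * z 0 := (half_pos hδ).trans_le hz.1.1
  have hz0 : 0 < z 0 := pos_of_mul_pos_right hX0 hε0.le
  have hP0 : 0 < ε * q 0 := hδ.trans_le (H.coord q hq).1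
  have hq0 : q 0 ≠ 0 := (pos_of_mul_pos_right hP0 hε0.le).ne'
  have hπ := pi_pos
  have hsX := sqrt_pos.2 hX0
  have hsP := sqrt_pos.2 hP0
  rw [H.mem_iff z hz0]
  have i1 := integrableOn_logPot H.measurableSet H.bounded (measurable_ringDens ε q)
    (fun y hy => H.abs_ringDens_le hδ hq hy) z
  have i2 := H.integrableOn_ringDens_mul_ringCore hδ hq hz
  have e1 : ∫ y in B, ε * y 0 * √(ε * y 0) *
      (-log ‖z - y‖ + (log (1 / ε) + ringCore (ε • z) (ε • y))) = (ε * q 0 * √(ε * q 0)) *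
      (logPot (ringDens ε q) B z +
        ∫ y in B, ringDens ε q y * (log (1 / ε) + ringCore (ε • z) (ε • y))) := by
    rw [logPot, ← integral_add i1 i2, ← integral_const_mul]
    refine integral_congr_ae (ae_of_all _ fun y => ?_)
    simp only [ringDens]
    field_simp
  have e2 : logPot (ringDens ε q) B z + ringPert B ε W μ q z
      = 2 * π / (√(ε * z 0) * (ε * q 0 * √(ε * q 0))) *
        (√(ε * z 0) / (2 * π) * (∫ y in B, ε * y 0 * √(ε * y 0) *
      (-log ‖z - y‖ + (log (1 / ε) + ringCore (ε • z) (ε • y)))) -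
      (μ + W / 2 * (ε * z 0) ^ 2 * log (1 / ε))) := by
    rw [e1, ringPert]
    have e3 := sq_sqrt hX0.le
    generalize (∫ y in B, ringDens ε q y * (log (1 / ε) + ringCore (ε • z) (ε • y))) = I
    generalize √(ε * z 0) = u at *
    rw [← e3]
    field_simp
    ring
  rw [e2, mul_pos_iff_of_pos_left (by positivity), sub_pos]

end IsScaledRing

theorem exists_ringDens_lipschitz {δ : ℝ} (hδ : 0 < δ) : ∃ C : ℝ, 0 ≤ C ∧
    ∀ (B : Set Plane) (ε W μ κ : ℝ) (q : Plane), IsScaledRing B ε W μ κ δ → q ∈ B →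
      ∀ x ∈ B, ∀ y ∈ B, |ringDens ε q x - ringDens ε q y| ≤ C * ε * ‖x - y‖ := by
  obtain ⟨C, hC0, hC⟩ := exists_lipschitz_mul_sqrt hδ (1 / δ)
  refine ⟨C / (δ * √δ), by positivity, fun B ε W μ κ q H hq x hx y hy => ?_⟩
  have h1 : |x 0 - y 0| ≤ ‖x - y‖ := PiLp.norm_apply_le (x - y) 0
  have h2 := hC _ (H.coord x hx) _ (H.coord y hy)
  have hε0 := H.eps_pos
  have h3 := H.mul_sqrt_le hδ hq
  have h4 : 0 < δ * √δ := by positivity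
  unfold ringDens
  rw [← sub_div, abs_div, abs_of_pos (h4.trans_le h3)]
  have h5 : |ε * x 0 - ε * y 0| ≤ ε * ‖x - y‖ := by
    rw [← mul_sub, abs_mul, abs_of_pos hε0]; exact mul_le_mul_of_nonneg_left h1 hε0.le
  have h6 := h2.trans (mul_le_mul_of_nonneg_left h5 hC0)
  exact (div_le_div₀ (by positivity) h6 h4 h3).trans_eq (by ring)

theorem exists_ringPert_lipschitz {κ W δ C₀ : ℝ} (hκ : 0 < κ) (hW : 0 < W) (hδ : 0 < δ)
    (hC₀ : 0 ≤ C₀) : ∃ C : ℝ, 0 ≤ C ∧ ∀ (B : Set Plane) (ε μ R : ℝ) (q : Plane),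
      IsScaledRing B ε W μ κ δ → q ∈ B → ε ≤ 1 → 0 ≤ μ → μ ≤ C₀ * (1 + log (1 / ε)) → 0 ≤ R →
      ε * (Metric.diam B + R) ≤ 1 / 2 → ε * (Metric.diam B + R) ≤ δ / 2 →
      ∀ x ∈ Metric.closedBall q (Metric.diam B + R), ∀ y ∈ Metric.closedBall q (Metric.diam B + R),
        |ringPert B ε W μ q x - ringPert B ε W μ q y| ≤ C * (ε * (1 + log (1 / ε))) * ‖x - y‖ := by
  obtain ⟨C₁, h₁, H₁⟩ := exists_lipschitz_ringCore (half_pos hδ) (1 / δ + δ / 2)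
  obtain ⟨C₂, h₂, H₂⟩ := exists_lipschitz_mul_sqrt (half_pos hδ) (1 / δ + δ / 2)
  obtain ⟨C₃, h₃, H₃⟩ := exists_lipschitz_inv_sqrt (half_pos hδ) (1 / δ + δ / 2)
  have hπ := pi_pos
  set P := 1 / δ * √(1 / δ) / (δ * √δ) with hP
  have hP0 : 0 ≤ P := by positivity
  refine ⟨P * (κ / δ) * C₁ + 2 * π / (δ * √δ) * (W / 2 * C₂ + C₀ * C₃), by positivity,
    fun B ε μ R q H hq hε hμ hμC hR hs1 hs2 x hx y hy => ?_⟩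
  have hε0 := H.eps_pos
  have hl : 0 ≤ log (1 / ε) := log_nonneg (by rw [le_div_iff₀ hε0]; linarith)
  have nx := H.near hq hs1 hs2 hR hx
  have ny := H.near hq hs1 hs2 hR hy
  have h1 : |x 0 - y 0| ≤ ‖x - y‖ := PiLp.norm_apply_le (x - y) 0
  have h5 : |ε * x 0 - ε * y 0| ≤ ε * ‖x - y‖ := by
    rw [← mul_sub, abs_mul, abs_of_pos hε0]; exact mul_le_mul_of_nonneg_left h1 hε0.le
  have a2 := (H₂ _ nx.1 _ ny.1).trans (mul_le_mul_of_nonneg_left h5 h₂)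
  have a3 := (H₃ _ nx.1 _ ny.1).trans (mul_le_mul_of_nonneg_left h5 h₃)
  have i1 := H.integrableOn_ringDens_mul_ringCore hδ hq nx
  have i2 := H.integrableOn_ringDens_mul_ringCore hδ hq ny
  set c := C₁ * (ε * ‖x - y‖) with hc
  have hc0 : 0 ≤ c := by positivity
  have ic : IntegrableOn (fun _ : Plane => c) B := integrableOn_const H.volume_ne_top
  have b1 : |(∫ z in B, ringDens ε q z * (log (1 / ε) + ringCore (ε • x) (ε • z))) -
      ∫ z in B, ringDens ε q z * (log (1 / ε) + ringCore (ε • y) (ε • z))| ≤ P * (κ / δ * c) := by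
    rw [← integral_sub i1 i2]
    simp_rw [← mul_sub]
    refine abs_setIntegral_mul_le H.measurableSet (fun z hz => H.abs_ringDens_le hδ hq hz) hP0 ic
      ((ae_restrict_iff' H.measurableSet).2 (ae_of_all _ fun z hz => ?_)) ?_
    · rw [add_sub_add_left_eq_sub]
      have := H₁ (ε • x) (ε • y) (ε • z) nx.1 ny.1 (H.coord_mem_wide hδ hz) (ny.2 z hz)
      rwa [← smul_sub, norm_smul, Real.norm_of_nonneg hε0.le] at this
    · rw [setIntegral_const, smul_eq_mul]
      exact mul_le_mul_of_nonneg_right (H.volume_mem_Icc hδ).2 hc0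
  have h4 : 0 < δ * √δ := by positivity
  have h6 := H.mul_sqrt_le hδ hq
  set u := ε * ‖x - y‖ with hu
  have hu0 : 0 ≤ u := by positivity
  have b2 : |(W / 2 * log (1 / ε) * (ε * x 0 * √(ε * x 0)) + μ * (√(ε * x 0))⁻¹) -
      (W / 2 * log (1 / ε) * (ε * y 0 * √(ε * y 0)) + μ * (√(ε * y 0))⁻¹)| ≤
      (W / 2 * C₂ + C₀ * C₃) * ((1 + log (1 / ε)) * u) := by
    have e : (W / 2 * log (1 / ε) * (ε * x 0 * √(ε * x 0)) + μ * (√(ε * x 0))⁻¹) -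
      (W / 2 * log (1 / ε) * (ε * y 0 * √(ε * y 0)) + μ * (√(ε * y 0))⁻¹)
      = W / 2 * log (1 / ε) * (ε * x 0 * √(ε * x 0) - ε * y 0 * √(ε * y 0))
        + μ * ((√(ε * x 0))⁻¹ - (√(ε * y 0))⁻¹) := by ring
    rw [e]
    refine (abs_add_le _ _).trans ?_
    rw [abs_mul (W / 2 * _), abs_mul μ, abs_of_nonneg hμ,
      abs_of_nonneg (show 0 ≤ W / 2 * log (1 / ε) by positivity)]
    have c1 := mul_le_mul_of_nonneg_left a2 (show 0 ≤ W / 2 * log (1 / ε) by positivity)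
    have c2 := mul_le_mul hμC a3 (abs_nonneg _) (hμ.trans hμC)
    have c3 : 0 ≤ W / 2 * (C₂ * u) := by positivity
    nlinarith
  have b3 := mul_le_mul (div_le_div_of_nonneg_left (by positivity : 0 ≤ 2 * π) h4 h6) b2
    (abs_nonneg _) (by positivity)
  unfold ringPert
  set I₁ := ∫ z in B, ringDens ε q z * (log (1 / ε) + ringCore (ε • x) (ε • z))
  set I₂ := ∫ z in B, ringDens ε q z * (log (1 / ε) + ringCore (ε • y) (ε • z))
  set N₁ := (W / 2 * log (1 / ε) * (ε * x 0 * √(ε * x 0)) + μ * (√(ε * x 0))⁻¹)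
  set N₂ := (W / 2 * log (1 / ε) * (ε * y 0 * √(ε * y 0)) + μ * (√(ε * y 0))⁻¹)
  set k := 2 * π / (ε * q 0 * √(ε * q 0))
  have hk : 0 ≤ k := div_nonneg (by positivity) (h4.trans_le h6).le
  have e : I₁ - k * N₁ - (I₂ - k * N₂) = (I₁ - I₂) + -(k * (N₁ - N₂)) := by ring
  rw [e]
  refine (abs_add_le _ _).trans ?_
  rw [abs_neg, abs_mul, abs_of_nonneg hk]
  have c4 : 0 ≤ P * (κ / δ * (C₁ * u)) * log (1 / ε) := by positivity
  refine (add_le_add b1 b3).trans ?_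
  rw [hc]
  have e5 : (P * (κ / δ) * C₁ + 2 * π / (δ * √δ) * (W / 2 * C₂ + C₀ * C₃)) *
      (ε * (1 + log (1 / ε))) * ‖x - y‖ = P * (κ / δ * (C₁ * u)) + P * (κ / δ * (C₁ * u)) * log (1 / ε)
        + 2 * π / (δ * √δ) * ((W / 2 * C₂ + C₀ * C₃) * ((1 + log (1 / ε)) * u)) := by
    rw [hu]; ring
  rw [e5]
  linarith

/-- The scaled cross-section is a patch whose parameters are almost constant. -/
theorem exists_isPatch {κ W δ C₀ : ℝ} (hκ : 0 < κ) (hW : 0 < W) (hδ : 0 < δ)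
    (hC₀ : 0 ≤ C₀) : ∃ C : ℝ, 0 ≤ C ∧ ∀ (B : Set Plane) (ε μ R : ℝ) (q : Plane),
      IsScaledRing B ε W μ κ δ → q ∈ B → ε ≤ 1 → 0 ≤ μ → μ ≤ C₀ * (1 + log (1 / ε)) → 1 ≤ R →
      ε * (Metric.diam B + R) ≤ 1 / 2 → ε * (Metric.diam B + R) ≤ δ / 2 →
      IsPatch B q (ringDens ε q) (fun z => ringPert B ε W μ q z - ringPert B ε W μ q q)
        (-ringPert B ε W μ q q) (C * (ε * (1 + log (1 / ε)))) R := by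
  obtain ⟨C₁, h₁, H₁⟩ := exists_ringDens_lipschitz hδ
  obtain ⟨C₂, h₂, H₂⟩ := exists_ringPert_lipschitz hκ hW hδ hC₀
  refine ⟨C₁ + C₂, by positivity, fun B ε μ R q H hq hε hμ hμC hR hs1 hs2 => ?_⟩
  have hε0 := H.eps_pos
  have hl : 0 ≤ log (1 / ε) := log_nonneg (by rw [le_div_iff₀ hε0]; linarith)
  have hP0 : 0 < ε * q 0 := hδ.trans_le (H.coord q hq).1
  have hR0 : 0 ≤ R := by linarith
  have hn : ∀ z ∈ B, z ∈ Metric.closedBall q (Metric.diam B + R) := fun z hz => by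
    rw [mem_closedBall_iff_norm]; linarith [H.norm_sub_le hz hq]
  refine ⟨H.isOpen, H.bounded, H.conn, hq, measurable_ringDens ε q, ?_, ?_, ?_, ?_, ?_, hR, ?_, ?_⟩
  · unfold ringDens
    exact div_self (by positivity)
  · intro x hx y hy
    refine (H₁ B ε W μ κ q H hq x hx y hy).trans (mul_le_mul_of_nonneg_right ?_ (norm_nonneg _))
    have c1 : 0 ≤ C₁ * ε * log (1 / ε) := by positivity
    have c2 : 0 ≤ C₂ * (ε * (1 + log (1 / ε))) := by positivity
    linarith
  · exact sub_self _
  · intro x hx y hy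
    rw [sub_sub_sub_cancel_right]
    refine (H₂ B ε μ R q H hq hε hμ hμC hR0 hs1 hs2 x hx y hy).trans
      (mul_le_mul_of_nonneg_right ?_ (norm_nonneg _))
    have c2 : 0 ≤ C₁ * (ε * (1 + log (1 / ε))) := by positivity
    linarith
  · positivity
  · intro z hz
    have := (H.mem_iff_logPot hδ hq (H.near hq hs1 hs2 hR0 (hn z hz))).1 hz
    linarith
  · intro z hz hzB
    have := mt (H.mem_iff_logPot hδ hq (H.near hq hs1 hs2 hR0 hz)).2 hzB
    linarith

/-- The deviation of the flux constant from its asymptotic value, rewritten through the value of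
the smooth part of the potential at `q`. -/
theorem flux_eq_ringPert {B : Set Plane} {ε W μ κ δ : ℝ} {q : Plane}
    (H : IsScaledRing B ε W μ κ δ) (hδ : 0 < δ) (hq : q ∈ B) (hL : 0 < Metric.diam B) :
    κ * (ε * q 0) / (2 * π) * log (2 * (ε * q 0) / (1 / 2 * (ε * Metric.diam B)))
      + κ / (ε * q 0) * ((ε * q 0) ^ 2 / (2 * π) * (ringReg 0 - log 2))
      - W / 2 * (ε * q 0) ^ 2 * log (1 / ε) - μ = (ε * q 0) ^ 2 / (2 * π) *
      ((κ / (ε * q 0) - volume.real B) *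
          (ringCore (ε • q) (ε • q) + log (1 / ε) - log (Metric.diam B / 2))
        - ((∫ y in B, ringDens ε q y * (log (1 / ε) + ringCore (ε • q) (ε • y)))
            - volume.real B * (log (1 / ε) + ringCore (ε • q) (ε • q)))
        - (-ringPert B ε W μ q q + volume.real B * log (Metric.diam B / 2))) := by
  have hε0 := H.eps_pos
  have hP0 : 0 < ε * q 0 := hδ.trans_le (H.coord q hq).1
  have hsP := sqrt_pos.2 hP0
  have hπ := pi_pos
  have e0 : (ε • q) 0 = ε * q 0 := rfl
  rw [ringCore_self (by rw [e0]; exact hP0), e0, ringPert]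
  have e1 : log (2 * (ε * q 0) / (1 / 2 * (ε * Metric.diam B)))
      = log 2 + log (ε * q 0) + log (1 / ε) - log (Metric.diam B / 2) := by
    rw [show 1 / 2 * (ε * Metric.diam B) = ε * (Metric.diam B / 2) by ring,
      log_div (mul_pos two_pos hP0).ne' (by positivity), log_mul two_ne_zero hP0.ne',
      log_mul hε0.ne' (half_pos hL).ne', one_div, log_inv]
    ring
  rw [e1]
  generalize (∫ y in B, ringDens ε q y * (log (1 / ε) + ringCore (ε • q) (ε • y))) = I
  have e2 := sq_sqrt hP0.le
  generalize ε * q 0 = P at *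
  generalize log (Metric.diam B / 2) = s
  generalize log (1 / ε) = l
  have e3 : 2 * π / (P * √P) * (W / 2 * l * (P * √P) + μ * (√P)⁻¹)
      = 2 * π / P ^ 2 * (W / 2 * P ^ 2 * l + μ) := by
    generalize √P = u at *
    subst e2
    field_simp
  rw [e3]
  field_simp
  ring

theorem exists_flux_error_le {κ δ : ℝ} (hκ : 0 < κ) (hδ : 0 < δ) : ∃ C : ℝ, 0 ≤ C ∧
    ∀ (B : Set Plane) (ε W μ : ℝ) (q : Plane) (s : ℝ), IsScaledRing B ε W μ κ δ → q ∈ B → ε ≤ 1 →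
      |(κ / (ε * q 0) - volume.real B) * (ringCore (ε • q) (ε • q) + log (1 / ε) - s)
        - ((∫ y in B, ringDens ε q y * (log (1 / ε) + ringCore (ε • q) (ε • y)))
            - volume.real B * (log (1 / ε) + ringCore (ε • q) (ε • q)))|
      ≤ C * (ε * Metric.diam B * (1 + |s| + log (1 / ε))) := by
  obtain ⟨C₁, h₁, H₁⟩ := exists_lipschitz_ringCore hδ (1 / δ)
  obtain ⟨C₂, h₂, H₂⟩ := exists_ringDens_lipschitz hδ
  obtain ⟨K, hK0, hK⟩ := exists_abs_ringCore_le hδ (1 / δ)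
  refine ⟨κ / δ * ((1 / δ) * (K + 1)) + κ / δ * (C₂ * (1 + K) + C₁), by positivity,
    fun B ε W μ q s H hq hε => ?_⟩
  have hε0 := H.eps_pos
  have hl : 0 ≤ log (1 / ε) := log_nonneg (by rw [le_div_iff₀ hε0]; linarith)
  set l := log (1 / ε)
  have hP := H.coord q hq
  have hP0 : 0 < ε * q 0 := hδ.trans_le hP.1
  have hM := (H.volume_mem_Icc hδ).2
  have hM0 : 0 ≤ volume.real B := measureReal_nonneg
  set D := ε * Metric.diam B with hD
  have hD0 : 0 ≤ D := mul_nonneg hε0.le Metric.diam_nonneg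
  have hdist : ∀ y ∈ B, ε * ‖y - q‖ ≤ D := fun y hy =>
    mul_le_mul_of_nonneg_left (H.norm_sub_le hy hq) hε0.le
  have hJ : |ringCore (ε • q) (ε • q)| ≤ K := hK _ _ hP hP (by simp)
  have ic : ∀ c : ℝ, IntegrableOn (fun _ : Plane => c) B :=
    fun c => integrableOn_const H.volume_ne_top
  have key : ∀ (f : Plane → ℝ) (c : ℝ), (∀ y ∈ B, |f y| ≤ c) → 0 ≤ c →
      |∫ y in B, f y| ≤ κ / δ * c := fun f c hf hc => by
    have := norm_setIntegral_le_of_norm_le_const (f := f) (μ := volume) H.bounded.measure_lt_top hf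
    rw [Real.norm_eq_abs] at this
    exact this.trans ((mul_comm _ _).trans_le (mul_le_mul_of_nonneg_right hM hc))
  have a1 : |κ / (ε * q 0) - volume.real B| ≤ κ / δ * (1 / δ * D) := by
    have i1 : IntegrableOn (fun y : Plane => ε * y 0 / (ε * q 0)) B :=
      (H.integrableOn_of_le (by fun_prop) fun y hy => H.abs_coord_le hδ hy).div_const _
    have e : κ / (ε * q 0) - volume.real B = ∫ y in B, (ε * y 0 / (ε * q 0) - 1) := by
      rw [integral_sub i1 (ic 1), integral_div, H.circ, setIntegral_const, smul_eq_mul, mul_one]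
    rw [e]
    refine key _ _ (fun y hy => ?_) (by positivity)
    rw [div_sub_one hP0.ne', abs_div, abs_of_pos hP0, ← mul_sub, abs_mul, abs_of_pos hε0]
    have b1 : |y 0 - q 0| ≤ ‖y - q‖ := PiLp.norm_apply_le (y - q) 0
    have b2 := (mul_le_mul_of_nonneg_left b1 hε0.le).trans (hdist y hy)
    exact (div_le_div₀ hD0 b2 hδ hP.1).trans_eq (by ring)
  have hself : ε * q 0 ∈ Set.Icc (δ / 2) (1 / δ + δ / 2) ∧ ∀ y ∈ B, ‖ε • q - ε • y‖ ≤ 1 :=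
    ⟨H.coord_mem_wide hδ hq, fun y hy => H.norm_smul_sub_le hq hy⟩
  have a2 : |(∫ y in B, ringDens ε q y * (l + ringCore (ε • q) (ε • y)))
      - volume.real B * (l + ringCore (ε • q) (ε • q))|
      ≤ κ / δ * (C₂ * D * (l + K) + C₁ * D) := by
    have e : (∫ y in B, ringDens ε q y * (l + ringCore (ε • q) (ε • y)))
      - volume.real B * (l + ringCore (ε • q) (ε • q))
      = ∫ y in B, (ringDens ε q y * (l + ringCore (ε • q) (ε • y))
        - (l + ringCore (ε • q) (ε • q))) := by
      rw [integral_sub (H.integrableOn_ringDens_mul_ringCore hδ hq hself) (ic _), setIntegral_const,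
        smul_eq_mul]
    rw [e]
    refine key _ _ (fun y hy => ?_) (by positivity)
    have one : ringDens ε q q = 1 := div_self (by have := sqrt_pos.2 hP0; positivity)
    have e2 : ringDens ε q y * (l + ringCore (ε • q) (ε • y)) - (l + ringCore (ε • q) (ε • q))
        = (ringDens ε q y - ringDens ε q q) * (l + ringCore (ε • q) (ε • y))
          + (ringCore (ε • y) (ε • q) - ringCore (ε • q) (ε • q)) := by
      rw [one, ringCore_comm (ε • y)]; ring
    rw [e2]
    refine (abs_add_le _ _).trans ?_
    rw [abs_mul]
    have b1 := H₂ B ε W μ κ q H hq y hy q hq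
    have b2 : C₂ * ε * ‖y - q‖ ≤ C₂ * D := by
      rw [mul_assoc]; exact mul_le_mul_of_nonneg_left (hdist y hy) h₂
    have b3 : |l + ringCore (ε • q) (ε • y)| ≤ l + K := by
      refine (abs_add_le _ _).trans (add_le_add (abs_of_nonneg hl).le ?_)
      exact hK _ _ hP (H.coord y hy) (H.norm_smul_sub_le hq hy)
    have b4 := H₁ (ε • y) (ε • q) (ε • q) (H.coord y hy) hP hP (by simp)
    rw [← smul_sub, norm_smul, Real.norm_of_nonneg hε0.le] at b4
    exact add_le_add (mul_le_mul (b1.trans b2) b3 (abs_nonneg _) (by positivity))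
      (b4.trans (mul_le_mul_of_nonneg_left (hdist y hy) h₁))
  refine (abs_sub _ _).trans ?_
  rw [abs_mul]
  have a3 : |ringCore (ε • q) (ε • q) + l - s| ≤ K + l + |s| := by
    refine (abs_sub _ _).trans (add_le_add ((abs_add_le _ _).trans ?_) le_rfl)
    exact add_le_add hJ (abs_of_nonneg hl).le
  have a4 := mul_le_mul a1 a3 (abs_nonneg _) (by positivity)
  have hs := abs_nonneg s
  have a5 : κ / δ * (1 / δ * D) * (K + l + |s|)
      ≤ κ / δ * (1 / δ * D) * ((K + 1) * (1 + |s| + l)) := by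
    refine mul_le_mul_of_nonneg_left ?_ (by positivity)
    have := mul_nonneg hK0 (add_nonneg hs hl)
    nlinarith
  have a6 : κ / δ * (C₂ * D * (l + K) + C₁ * D)
      ≤ κ / δ * (D * ((C₂ * (1 + K) + C₁) * (1 + |s| + l))) := by
    refine mul_le_mul_of_nonneg_left ?_ (by positivity)
    rw [show C₂ * D * (l + K) + C₁ * D = D * (C₂ * (l + K) + C₁) by ring]
    refine mul_le_mul_of_nonneg_left ?_ hD0
    have c1 : l + K ≤ (1 + K) * (1 + |s| + l) := by
      have := mul_nonneg hK0 (add_nonneg hs hl)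
      nlinarith
    have c2 := mul_le_mul_of_nonneg_left c1 h₂
    have c3 : 0 ≤ C₁ * (|s| + l) := by positivity
    nlinarith
  calc _ ≤ _ := add_le_add a4 a2
    _ ≤ _ := add_le_add a5 a6
    _ = _ := by ring

theorem tendsto_exp_neg_mul_add_atTop {θ : ℝ} (hθ : 0 < θ) (a : ℝ) :
    Tendsto (fun l : ℝ => rexp (-θ * l) * (a + l)) atTop (nhds 0) := by
  have h0 : Tendsto (fun l : ℝ => θ * l) atTop atTop := tendsto_id.const_mul_atTop hθ
  have h1 := (tendsto_pow_mul_exp_neg_atTop_nhds_zero 1).comp h0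
  have h2 := (tendsto_pow_mul_exp_neg_atTop_nhds_zero 0).comp h0
  have h3 := (h2.const_mul a).add (h1.const_mul θ⁻¹)
  rw [mul_zero, mul_zero, add_zero] at h3
  refine h3.congr fun l => ?_
  simp only [Function.comp_apply, pow_zero, pow_one, one_mul, neg_mul]
  field_simp

theorem exists_forall_small {C θ R S ω : ℝ} (hθ : 0 < θ) (hω : 0 < ω) :
    ∃ ε₀ > (0 : ℝ), ε₀ ≤ 1 ∧ ∀ ε ∈ Set.Ioc (0 : ℝ) ε₀,
      (C * rexp (-θ * log (1 / ε)) + ε * R) * (1 + S + log (1 / ε)) ≤ ω := by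
  have h1 := ((tendsto_exp_neg_mul_add_atTop hθ (1 + S)).const_mul C).add
    ((tendsto_exp_neg_mul_add_atTop one_pos (1 + S)).const_mul R)
  rw [mul_zero, mul_zero, add_zero] at h1
  obtain ⟨l₀, hl₀⟩ := eventually_atTop.1 (h1.eventually_le_const hω)
  refine ⟨rexp (-max l₀ 0), exp_pos _, ?_, fun ε hε => ?_⟩
  · rw [exp_le_one_iff]; linarith [le_max_right l₀ 0]
  · have h2 := log_le_log hε.1 hε.2
    rw [log_exp] at h2
    have h3 : log (1 / ε) = -log ε := by rw [one_div, log_inv]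
    have h4 := hl₀ (log (1 / ε)) (by rw [h3]; linarith [le_max_left l₀ 0])
    have h5 : ε = rexp (-1 * log (1 / ε)) := by rw [h3, neg_one_mul, neg_neg, exp_log hε.1]
    refine le_trans (le_of_eq ?_) h4
    conv_lhs => rw [show ε * R = rexp (-1 * log (1 / ε)) * R by rw [← h5]]
    ring

theorem abs_log_le_of_abs_div_sq_sub_pi_le {M s M₁ M₂ : ℝ} (hs : 0 < s) (hM₁ : 0 < M₁) (h1 : M₁ ≤ M)
    (h2 : M ≤ M₂) (h : |M / s ^ 2 - π| ≤ 1) : |log s| ≤ 5 / M₁ + M₂ := by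
  rw [abs_le] at h
  have hs2 : 0 < s ^ 2 := by positivity
  have hM : 0 < M := hM₁.trans_le h1
  have h3 : M ≤ 5 * s ^ 2 := by
    rw [← div_le_iff₀ hs2]; linarith [pi_le_four]
  have h4 : s ^ 2 ≤ M := by
    have : 1 * s ^ 2 ≤ M := by rw [← le_div_iff₀ hs2]; linarith [pi_gt_three]
    linarith
  have h5 := abs_log_le_inv_add hs2.le
  rw [log_pow, abs_mul] at h5
  have h6 : (s ^ 2)⁻¹ ≤ 5 / M₁ := by
    rw [inv_eq_one_div, div_le_div_iff₀ hs2 hM₁]; linarith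
  have h7 : |((2 : ℕ) : ℝ)| = 2 := by norm_num
  rw [h7] at h5
  linarith [abs_nonneg (log s)]

/-- Asymptotics of the scaled cross-section of a thin vortex ring. -/
theorem exists_forall_isScaledRing_almost_disc {κ W δ η : ℝ} (hκ : 0 < κ) (hW : 0 < W) (hδ : 0 < δ)
    (hη : 0 < η) : ∃ ε₀ > (0 : ℝ), ∀ (B : Set Plane) (ε μ : ℝ) (q : Plane), ε ≤ ε₀ →
      IsScaledRing B ε W μ κ δ → q ∈ B → 0 ≤ μ →
      |volume.real B / (Metric.diam B / 2) ^ 2 - π| ≤ η ∧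
      |κ * (ε * q 0) / (2 * π) * log (2 * (ε * q 0) / (1 / 2 * (ε * Metric.diam B)))
        + κ / (ε * q 0) * ((ε * q 0) ^ 2 / (2 * π) * (ringReg 0 - log 2))
        - W / 2 * (ε * q 0) ^ 2 * log (1 / ε) - μ| ≤ η := by
  have hπ := pi_pos
  set M₁ := κ * δ with hM₁
  set M₂ := max (κ * δ) (κ / δ) with hM₂
  have hM₁0 : 0 < M₁ := by positivity
  have hM₁₂ : M₁ ≤ M₂ := le_max_left _ _
  have hM₂0 : 0 < M₂ := hM₁0.trans_le hM₁₂
  set η' := min (min η 1) (π * δ ^ 2 * η) with hη'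
  have hη'0 : 0 < η' := lt_min (lt_min hη one_pos) (by positivity)
  have hη'1 : η' ≤ η := (min_le_left _ _).trans (min_le_left _ _)
  have hη'2 : η' ≤ 1 := (min_le_left _ _).trans (min_le_right _ _)
  have hη'3 : η' ≤ π * δ ^ 2 * η := min_le_right _ _
  obtain ⟨τ, hτ, Hτ⟩ := exists_forall_isPatch_almost_disc hM₁0 hM₁₂ hη'0
  obtain ⟨C₀, hC₀, θ, hθ, H₀⟩ := exists_diam_le_and_flux_le hκ hW hδ
  obtain ⟨C, hC, HC⟩ := exists_isPatch hκ hW hδ hC₀.le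
  obtain ⟨C', hC', HC'⟩ := exists_flux_error_le hκ hδ
  set S := 5 / M₁ + M₂ with hS
  have hS0 : 0 ≤ S := by positivity
  set ω := min (min (1 / 2) (δ / 2)) (min (τ / (C + 1)) (π * δ ^ 2 * η / (C' + 1))) with hω
  have hω0 : 0 < ω := lt_min (lt_min (by norm_num) (by positivity))
    (lt_min (by positivity) (by positivity))
  have hω1 : ω ≤ 1 / 2 := (min_le_left _ _).trans (min_le_left _ _)
  have hω2 : ω ≤ δ / 2 := (min_le_left _ _).trans (min_le_right _ _)
  have hω3 : C * ω ≤ τ := by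
    have h : ω ≤ τ / (C + 1) := (min_le_right _ _).trans (min_le_left _ _)
    rw [le_div_iff₀ (by positivity)] at h
    linarith
  have hω4 : C' * ω ≤ π * δ ^ 2 * η := by
    have h : ω ≤ π * δ ^ 2 * η / (C' + 1) := (min_le_right _ _).trans (min_le_right _ _)
    rw [le_div_iff₀ (by positivity)] at h
    linarith
  obtain ⟨ε₀, hε₀, hε₀1, hsmall⟩ := exists_forall_small (C := C₀) (R := 1 + M₂) (S := S) hθ hω0
  refine ⟨ε₀, hε₀, fun B ε μ q hε H hq hμ => ?_⟩
  have hε0 := H.eps_pos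
  have hε1 : ε ≤ 1 := hε.trans hε₀1
  have hl : 0 ≤ log (1 / ε) := log_nonneg (by rw [le_div_iff₀ hε0]; linarith)
  have hsm := hsmall ε ⟨hε0, hε⟩
  obtain ⟨hD, hμC⟩ := H₀ B ε μ H hε1 hμ ⟨q, hq⟩
  have hL := H.diam_pos hδ hκ
  have hE : ε * (Metric.diam B + (1 + M₂)) * (1 + S + log (1 / ε)) ≤ ω := by
    refine le_trans (mul_le_mul_of_nonneg_right ?_ (by positivity)) hsm
    linarith
  have hE0 : 0 ≤ ε * (Metric.diam B + (1 + M₂)) := by positivity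
  have hE1 : ε * (Metric.diam B + (1 + M₂)) ≤ ω := by
    have : 0 ≤ ε * (Metric.diam B + (1 + M₂)) * (S + log (1 / ε)) := by positivity
    linarith
  have hpatch := HC B ε μ (1 + M₂) q H hq hε1 hμ hμC (by linarith) (hE1.trans hω1) (hE1.trans hω2)
  have hlam : C * (ε * (1 + log (1 / ε))) * (Metric.diam B + (1 + M₂)) ≤ τ := by
    refine le_trans ?_ hω3
    rw [mul_assoc]
    refine mul_le_mul_of_nonneg_left (le_trans ?_ hE) hC
    have : 0 ≤ ε * (Metric.diam B + (1 + M₂)) * S := by positivity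
    linarith
  have hvol := H.volume_mem_Icc hδ
  have hvol2 : volume.real B ≤ M₂ := hvol.2.trans (le_max_right _ _)
  obtain ⟨c1, c2⟩ := Hτ B q _ _ _ _ hpatch hlam hvol.1 hvol2
  refine ⟨c1.trans hη'1, ?_⟩
  have hs := abs_log_le_of_abs_div_sq_sub_pi_le (by positivity) hM₁0 hvol.1 hvol2 (c1.trans hη'2)
  rw [flux_eq_ringPert H hδ hq hL, abs_mul]
  have herr := HC' B ε W μ q (log (Metric.diam B / 2)) H hq hε1
  have herr2 : C' * (ε * Metric.diam B * (1 + |log (Metric.diam B / 2)| + log (1 / ε)))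
      ≤ π * δ ^ 2 * η := by
    refine le_trans (mul_le_mul_of_nonneg_left (le_trans ?_ hE) hC') hω4
    gcongr
    linarith
  have hX := H.coord q hq
  have hX0 := hδ.trans_le hX.1
  have hfac : |(ε * q 0) ^ 2 / (2 * π)| ≤ (1 / δ) ^ 2 / (2 * π) := by
    rw [abs_of_nonneg (by positivity)]
    have := hX.2
    gcongr
  have htot := (abs_sub _ _).trans (add_le_add (herr.trans herr2) (c2.trans hη'3))
  refine (mul_le_mul hfac htot (abs_nonneg _) (by positivity)).trans (le_of_eq ?_)
  field_simp
  ring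

/-- **The rescaled cross-section is asymptotically a unit disc, and asymptotic identity for
the flux constant** (Proposition 3.6). With `σ = diam A / 2` one has `|A|/σ² → π` and
`(κ p₁/2π) ln(2p₁/σ) + (κ/p₁) H(p,p) − (W/2) p₁² ln(1/ε) − μ → 0`. -/
theorem rescaled_cross_section_disc (κ W δ₀ m₀ : ℝ)
    (hκ : 0 < κ) (hW : 0 < W) (hδ₀ : 0 < δ₀) (hm₀ : 0 < m₀) :
    ∀ η > (0 : ℝ), ∃ ε₀ > (0 : ℝ), ∃ d₀ > (0 : ℝ), ∀ ε ∈ Set.Ioc (0 : ℝ) ε₀,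
      ∀ ψ : Plane → ℝ, ∀ μ : ℝ, m₀ ≤ μ →
        IsVortexRingStream ψ ε W μ → Centralized ψ →
        circulation ψ ε W μ = κ →
        SimplyConnectedSpace ↥(crossSection ψ ε W μ) →
        crossSection ψ ε W μ ⊆ {x : Plane | δ₀ ≤ x 0 ∧ x 0 ≤ 1 / δ₀} →
        Metric.diam (crossSection ψ ε W μ) ≤ d₀ →
        ∀ p₁ : ℝ, mk2 p₁ 0 ∈ crossSection ψ ε W μ →
          (∀ x ∈ closure (crossSection ψ ε W μ), ψ x ≤ ψ (mk2 p₁ 0)) →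
          |(volume (crossSection ψ ε W μ)).toReal
              / ((1 / 2) * Metric.diam (crossSection ψ ε W μ)) ^ 2 - π| ≤ η ∧
          |κ * p₁ / (2 * π) *
                Real.log (2 * p₁ / ((1 / 2) * Metric.diam (crossSection ψ ε W μ)))
              + κ / p₁ * HkerExt p₁ (mk2 p₁ 0) (mk2 p₁ 0)
              - W / 2 * p₁ ^ 2 * Real.log (1 / ε) - μ|
            ≤ η := by
  intro η hη
  obtain ⟨ε₀, hε₀, H⟩ := exists_forall_isScaledRing_almost_disc hκ hW hδ₀ hη
  refine ⟨ε₀, hε₀, 1, one_pos, fun ε hε ψ μ hμ hring _ hcirc hsc hsub hdiam p₁ hp _ => ?_⟩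
  have hε0 := hε.1
  have hconn : IsPreconnected (crossSection ψ ε W μ) :=
    isPreconnected_iff_preconnectedSpace.2 inferInstance
  have hs := hring.isScaledRing hε0 hcirc hconn hsub hdiam
  have hq := (mem_inv_smul_iff (A := crossSection ψ ε W μ) hε0 (ε⁻¹ • mk2 p₁ 0)).2
    (by rwa [smul_inv_smul₀ hε0.ne'])
  obtain ⟨h1, h2⟩ := H _ ε μ _ hε.2 hs hq (hm₀.le.trans hμ)
  have hp₁ : 0 < p₁ := hp.1
  have e1 : ε * (ε⁻¹ • mk2 p₁ 0) 0 = p₁ := by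
    simp [hε0.ne']
  have e2 := diam_inv_smul hε0 (crossSection ψ ε W μ)
  rw [e1, e2, mul_div_cancel₀ _ hε0.ne'] at h2
  have e4 := HkerExt_self (y := mk2 p₁ 0) hp.1
  rw [mk2_zero] at e4
  refine ⟨?_, by rw [e4]; exact h2⟩
  rw [volume_real_inv_smul, e2, measureReal_def] at h1
  convert h1 using 3
  field_simp
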